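/- Let (ξ₁, ξ₂) ∈ 𝔊 (the gas phase) and fix integers Δm, Δn with Δm + Δn even. For each even N ≥ 2 let m = m(N) and n = n(N) be integers with m + n even such that m(N)/N → 1 + ξ₁ and n(N)/N → 1 + ξ₂ as N → ∞, and set m' = m + Δm, n' = n + Δn. Then, as N → ∞ through even integers, 𝕂_N(m, n; m', n') converges entrywise to 𝕂_gas(Δm, Δn). -/

import Mathlib

open Matrix Filter

/-- The two cuts `(-∞,-α²] ∪ [-β²,0]`, viewed as a subset of `ℂ`. -/
def cuts (α β : ℝ) : Set ℂ :=
  {z | ∃ t : ℝ, z = (t : ℂ) ∧ (t ≤ -α ^ 2 ∨ (-β ^ 2 ≤ t ∧ t ≤ 0))}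

/-- The matrix symbol `A(z)` of the two-periodic Aztec diamond. -/
noncomputable def symbA (α β : ℝ) (z : ℂ) : Matrix (Fin 2) (Fin 2) ℂ :=
  (z - 1)⁻¹ • !![2 * (α : ℂ) * z, (α : ℂ) * (z + 1);
                 (β : ℂ) * z * (z + 1), 2 * (β : ℂ) * z]

/-- The spectral projection `F(z)`, defined from a chosen branch `sq` of
`√(z(z+α²)(z+β²))`. -/
noncomputable def projF (α β : ℝ) (sq : ℂ → ℂ) (z : ℂ) : Matrix (Fin 2) (Fin 2) ℂ :=
  (2 : ℂ)⁻¹ • (1 : Matrix (Fin 2) (Fin 2) ℂ) +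
    (2 * sq z)⁻¹ • !![((α : ℂ) - (β : ℂ)) * z, (α : ℂ) * (z + 1);
                      (β : ℂ) * z * (z + 1), -(((α : ℂ) - (β : ℂ)) * z)]

/-- The finite-size correlation kernel `𝕂_N(m,n;m',n')` of the two-periodic Aztec
diamond, as a double contour integral (`γ01 : |z|=3`, `γ1 : |w-1|=1/2`). -/
noncomputable def KN (α β : ℝ) (sq : ℂ → ℂ) (N : ℕ) (m n m' n' : ℤ) :
    Matrix (Fin 2) (Fin 2) ℂ :=
  -(if m' < m then
      Matrix.of (fun a b =>
        (2 * (Real.pi : ℂ) * Complex.I)⁻¹ *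
          ∮ z in C(0, 3),
            z ^ ((m' + n') / 2 - (m + n) / 2 - 1) * (symbA α β z ^ (m - m')) a b)
    else 0) +
  Matrix.of (fun a b =>
    (2 * (Real.pi : ℂ) * Complex.I)⁻¹ * (2 * (Real.pi : ℂ) * Complex.I)⁻¹ *
      ∮ z in C(0, 3), z⁻¹ *
        ∮ w in C(1, 1 / 2), (z - w)⁻¹ *
          ((z ^ (N / 2) * (z - 1) ^ N) / (w ^ (N / 2) * (w - 1) ^ N) *
              w ^ ((m' + n') / 2) * (z ^ ((m + n) / 2))⁻¹) *
          (symbA α β w ^ ((N : ℤ) - m') * projF α β sq w *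
            symbA α β z ^ (m - (N : ℤ))) a b)

/-- The gas-phase kernel `𝕂_gas(Δm,Δn)`, a single contour integral over the circle
`|z| = (1+β²)/2`. -/
noncomputable def Kgas (α β : ℝ) (sq : ℂ → ℂ) (dm dn : ℤ) :
    Matrix (Fin 2) (Fin 2) ℂ :=
  Matrix.of fun a b =>
    (2 * (Real.pi : ℂ) * Complex.I)⁻¹ *
      ∮ z in C(0, (1 + β ^ 2) / 2),
        z ^ ((dm + dn) / 2 - 1) *
          ((projF α β sq z - (if dm < 0 then 1 else 0)) * symbA α β z ^ (-dm)) a b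

/-- The first branch `λ₁(z) = ((α+β)z + √(z(z+α²)(z+β²)))² / (z(z-1)²)` of the
eigenvalue function of `W`. -/
noncomputable def lam1 (α β : ℝ) (sq : ℂ → ℂ) (z : ℂ) : ℂ :=
  (((α : ℂ) + (β : ℂ)) * z + sq z) ^ 2 / (z * (z - 1) ^ 2)

/-- The two branches `λ₁, λ₂ = 1/λ₁` indexed by `j : Fin 2`. -/
noncomputable def lamBranch (α β : ℝ) (sq : ℂ → ℂ) (j : Fin 2) (z : ℂ) : ℂ :=
  if j = 0 then lam1 α β sq z else (lam1 α β sq z)⁻¹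

/-- The derivative `Φ'_j(z) = 2/(z-1) - (1+ξ₂)/z + ξ₁ λ_j'(z)/λ_j(z)` of the phase
function on the `j`-th sheet. -/
noncomputable def Phid (α β : ℝ) (sq : ℂ → ℂ) (ξ₁ ξ₂ : ℝ) (j : Fin 2) (z : ℂ) : ℂ :=
  2 / (z - 1) - (1 + (ξ₂ : ℂ)) / z +
    (ξ₁ : ℂ) * deriv (lamBranch α β sq j) z / lamBranch α β sq j z

/-- `(ξ₁,ξ₂)` lies in the gas phase `𝔊`: all zeros of `Φ'_1, Φ'_2` off the cuts are
simple and lie in `(-α²,-β²)`, and the number of such zeros plus the number of branch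
points `-α², -β²` at which `Φ'_1` has a finite nonzero limit along `(-α²,-β²)`
equals four. -/
def GasPhase (α β : ℝ) (sq : ℂ → ℂ) (ξ₁ ξ₂ : ℝ) : Prop :=
  (∀ j : Fin 2, ∀ z : ℂ,
      z ∉ cuts α β → z ≠ 1 → Phid α β sq ξ₁ ξ₂ j z = 0 →
      (∃ x : ℝ, z = (x : ℂ) ∧ -α ^ 2 < x ∧ x < -β ^ 2) ∧
        deriv (Phid α β sq ξ₁ ξ₂ j) z ≠ 0) ∧
  ({z : ℂ | z ∉ cuts α β ∧ z ≠ 1 ∧ Phid α β sq ξ₁ ξ₂ 0 z = 0}.ncard +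
    {z : ℂ | z ∉ cuts α β ∧ z ≠ 1 ∧ Phid α β sq ξ₁ ξ₂ 1 z = 0}.ncard +
    {x : ℝ | (x = -α ^ 2 ∨ x = -β ^ 2) ∧ ∃ L : ℂ, L ≠ 0 ∧
        Tendsto (fun t : ℝ => Phid α β sq ξ₁ ξ₂ 0 (t : ℂ))
          (nhdsWithin x (Set.Ioo (-α ^ 2) (-β ^ 2))) (nhds L)}.ncard = 4)

/-- The hypotheses on the parameters and on the branch `sq` of the square root. -/
structure IsBranch (α β : ℝ) (sq : ℂ → ℂ) : Prop where
  one_lt : 1 < α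
  mul_eq : α * β = 1
  sq_sq : ∀ z ∉ cuts α β, (sq z) ^ 2 = z * (z + (α : ℂ) ^ 2) * (z + (β : ℂ) ^ 2)
  diff : DifferentiableOn ℂ sq (cuts α β)ᶜ
  pos : ∀ x : ℝ, 0 < x → 0 < (sq (x : ℂ)).re ∧ (sq (x : ℂ)).im = 0

/-- The half sum `(α + β) / 2`. -/
noncomputable def hs (α β : ℝ) : ℝ := (α + β) / 2

/-- The quotient `sq z / z`. -/
noncomputable def slp (sq : ℂ → ℂ) (z : ℂ) : ℂ := sq z / z

theorem mem_cuts_iff {α β : ℝ} {z : ℂ} :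
    z ∈ cuts α β ↔ z.im = 0 ∧ (z.re ≤ -α ^ 2 ∨ (-β ^ 2 ≤ z.re ∧ z.re ≤ 0)) := by
  constructor
  · rintro ⟨t, rfl, h⟩
    simpa using h
  · rintro ⟨h0, h⟩
    exact ⟨z.re, Complex.ext (by simp) (by simp [h0]), h⟩

theorem zero_mem_cuts {α β : ℝ} : (0 : ℂ) ∈ cuts α β := by
  rw [mem_cuts_iff]; simp; right; positivity

theorem isClosed_cuts {α β : ℝ} : IsClosed (cuts α β) := by
  have : cuts α β = {z | z.im = 0} ∩ ({z | z.re ≤ -α ^ 2} ∪ ({z | -β ^ 2 ≤ z.re} ∩ {z | z.re ≤ 0})) := by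
    ext z; rw [mem_cuts_iff]; rfl
  rw [this]
  refine (isClosed_eq Complex.continuous_im continuous_const).inter (IsClosed.union ?_ (IsClosed.inter ?_ ?_))
  · exact isClosed_le Complex.continuous_re continuous_const
  · exact isClosed_le continuous_const Complex.continuous_re
  · exact isClosed_le Complex.continuous_re continuous_const

theorem isOpen_compl_cuts {α β : ℝ} : IsOpen (cuts α β)ᶜ := isClosed_cuts.isOpen_compl

theorem ne_zero_of_notMem_cuts {α β : ℝ} {z : ℂ} (hz : z ∉ cuts α β) : z ≠ 0 := by
  rintro rfl; exact hz zero_mem_cuts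

theorem slitPlane_subset_compl_cuts {α β : ℝ} : Complex.slitPlane ⊆ (cuts α β)ᶜ := by
  intro z hz hc
  rw [mem_cuts_iff] at hc
  rw [Complex.mem_slitPlane_iff] at hz
  have : (0:ℝ) ≤ α ^ 2 := sq_nonneg α
  rcases hz with h | h
  · rcases hc.2 with h' | h' <;> linarith
  · exact h hc.1

theorem dense_slitPlane : Dense Complex.slitPlane := by
  have h : Dense ((Complex.slitPlaneᶜ)ᶜ : Set ℂ) := by
    rw [← interior_eq_empty_iff_dense_compl]
    rw [Set.eq_empty_iff_forall_notMem]
    intro z hz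
    obtain ⟨ε, hε, hb⟩ := Metric.mem_nhds_iff.1 (mem_interior_iff_mem_nhds.1 hz)
    have h1 : z + (ε / 2 : ℝ) * Complex.I ∈ Metric.ball z ε := by
      simp [abs_of_pos hε, hε]
    have h2 : z ∈ Metric.ball z ε := by simpa using hε
    have h1' := hb h1
    have h2' := hb h2
    simp [Complex.mem_slitPlane_iff] at h1' h2'
    rw [h2'.2] at h1'
    simp at h1'
    linarith [h1'.2]
  simpa using h

namespace IsBranch

variable {α β : ℝ} {sq : ℂ → ℂ}

theorem beta_pos (h : IsBranch α β sq) : 0 < β := by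
  have := h.one_lt; have := h.mul_eq
  by_contra hb; push Not at hb; nlinarith

theorem beta_lt (h : IsBranch α β sq) : β < 1 := by
  have := h.one_lt; have := h.mul_eq; have := h.beta_pos
  by_contra hb; push Not at hb; nlinarith

theorem four_hs_sq (h : IsBranch α β sq) : 4 * hs α β ^ 2 = α ^ 2 + β ^ 2 + 2 := by
  have := h.mul_eq; unfold hs; linear_combination 2 * this

theorem one_lt_hs (h : IsBranch α β sq) : 1 < hs α β := by
  have h1 := h.four_hs_sq; have := h.mul_eq; have := h.one_lt; have := h.beta_pos; have := h.beta_lt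
  have h2 : 0 < (α - β) ^ 2 := by apply pow_pos; linarith
  have : 0 < hs α β := by unfold hs; linarith
  nlinarith

theorem slp_sq (h : IsBranch α β sq) {z : ℂ} (hz : z ∉ cuts α β) :
    slp sq z ^ 2 = 4 * (hs α β : ℂ) ^ 2 + (z - 1) ^ 2 / z := by
  have h0 := ne_zero_of_notMem_cuts hz
  have h1 : 4 * (hs α β : ℂ) ^ 2 = α ^ 2 + β ^ 2 + 2 := by exact_mod_cast h.four_hs_sq
  have h2 : (α : ℂ) * β = 1 := by exact_mod_cast h.mul_eq
  rw [h1, slp, div_pow, h.sq_sq z hz]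
  field_simp
  linear_combination (α * β + 1) * h2

theorem mem_cuts_of (h : IsBranch α β sq) {z : ℂ} (hz : z ≠ 0) {x : ℝ} (hx : x ≤ 0)
    (he : 4 * (hs α β : ℂ) ^ 2 + (z - 1) ^ 2 / z = x) : z ∈ cuts α β := by
  have h1 : 4 * (hs α β : ℂ) ^ 2 = α ^ 2 + β ^ 2 + 2 := by exact_mod_cast h.four_hs_sq
  have hαβ := h.mul_eq
  have h2 : (z - 1) ^ 2 / z = z + z⁻¹ - 2 := by field_simp; ring
  rw [h1, h2] at he
  have hns : 0 < Complex.normSq z := Complex.normSq_pos.2 hz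
  have hre := congrArg Complex.re he
  have him := congrArg Complex.im he
  have e1 : ((α:ℂ)^2 + (β:ℂ)^2 + 2) = ((α^2+β^2+2 : ℝ) : ℂ) := by push_cast; ring
  rw [e1] at hre him
  simp only [Complex.add_re, Complex.sub_re, Complex.inv_re, Complex.ofReal_re, Complex.re_ofNat, Complex.add_im, Complex.sub_im, Complex.inv_im, Complex.ofReal_im, Complex.im_ofNat] at hre him
  rw [mem_cuts_iff]
  have hN : Complex.normSq z = z.re ^ 2 + z.im ^ 2 := by rw [Complex.normSq_apply]; ring
  have hne := hns.ne'
  have h3 : z.im * (Complex.normSq z - 1) = 0 := by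
    field_simp at him; linarith
  have hα := h.one_lt
  rcases mul_eq_zero.1 h3 with h4 | h4
  · refine ⟨h4, ?_⟩
    rw [h4] at hN
    have hx0 : z.re ≠ 0 := by
      intro h5; rw [h5] at hN; simp at hN; exact hz hN
    have h5 : (z.re + α^2) * (z.re + β^2) = x * z.re := by
      rw [hN] at hre
      field_simp at hre
      apply mul_left_cancel₀ hx0
      linear_combination hre + z.re * (α * β + 1) * hαβ
    by_cases hpos : z.re ≤ 0
    · by_contra hcon
      push Not at hcon
      have h6 : z.re < -β^2 := by by_contra h7; push Not at h7; linarith [hcon.2 h7]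
      have h7 := hcon.1
      nlinarith [mul_pos (sub_pos.2 h6) (sub_pos.2 h7), mul_nonneg (neg_nonneg.2 hx) (neg_nonneg.2 hpos)]
    · push Not at hpos
      exfalso
      nlinarith [sq_nonneg α, sq_nonneg β, mul_pos hpos hpos, mul_nonneg (neg_nonneg.2 hx) hpos.le, mul_nonneg (sq_nonneg α) hpos.le, mul_nonneg (sq_nonneg β) hpos.le]
  · exfalso
    have h5 : Complex.normSq z = 1 := by linarith
    rw [h5] at hre hN
    have := h.one_lt_hs
    have := h.four_hs_sq
    rw [div_one] at hre
    have h6 : -1 ≤ z.re := by nlinarith [sq_nonneg z.im]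
    nlinarith

theorem notMem_of (h : IsBranch α β sq) {z s : ℂ} (hz : z ≠ 0) (hs' : 0 < s.re)
    (he : s ^ 2 = 4 * (hs α β : ℂ) ^ 2 + (z - 1) ^ 2 / z) : z ∉ cuts α β := by
  rintro ⟨t, rfl, ht⟩
  have hαβ := h.mul_eq
  have hα := h.one_lt
  have hb := h.beta_pos
  have hb1 := h.beta_lt
  have h1 : 4 * hs α β ^ 2 = α ^ 2 + β ^ 2 + 2 := h.four_hs_sq
  have ht0 : t ≠ 0 := by rintro rfl; simp at hz
  have htn : t < 0 := by
    rcases ht with h2 | h2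
    · nlinarith
    · exact lt_of_le_of_ne h2.2 ht0
  have hle : 4 * hs α β ^ 2 + (t - 1)^2 / t ≤ 0 := by
    have : 4 * hs α β ^ 2 + (t - 1)^2 / t = (t + α^2) * (t + β^2) / t := by
      rw [h1]; field_simp; linear_combination -(α * β + 1) * hαβ
    rw [this]
    apply div_nonpos_of_nonneg_of_nonpos _ htn.le
    rcases ht with h2 | h2
    · apply mul_nonneg_of_nonpos_of_nonpos <;> nlinarith
    · apply mul_nonneg <;> nlinarith
  have he' : s ^ 2 = ((4 * hs α β ^ 2 + (t - 1)^2 / t : ℝ) : ℂ) := by rw [he]; push_cast; ring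
  have hre := congrArg Complex.re he'
  have him := congrArg Complex.im he'
  rw [Complex.ofReal_re, pow_two, Complex.mul_re] at hre
  rw [Complex.ofReal_im, pow_two, Complex.mul_im] at him
  have : s.im = 0 := by
    have : s.re * s.im = 0 := by linarith
    rcases mul_eq_zero.1 this with h3 | h3
    · linarith
    · exact h3
  rw [this] at hre
  nlinarith

theorem slp_differentiableOn (h : IsBranch α β sq) : DifferentiableOn ℂ (slp sq) (cuts α β)ᶜ :=
  h.diff.div differentiableOn_id fun _ hz => ne_zero_of_notMem_cuts hz

theorem slp_re_ne (h : IsBranch α β sq) {z : ℂ} (hz : z ∉ cuts α β) : (slp sq z).re ≠ 0 := by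
  intro h0
  apply hz
  have h1 := h.slp_sq hz
  refine h.mem_cuts_of (ne_zero_of_notMem_cuts hz) (x := -(slp sq z).im ^ 2) (by nlinarith [sq_nonneg (slp sq z).im]) ?_
  rw [← h1]
  apply Complex.ext <;> simp [pow_two, h0]

theorem slp_re_pos (h : IsBranch α β sq) {z : ℂ} (hz : z ∉ cuts α β) : 0 < (slp sq z).re := by
  have hpc : IsPreconnected ((cuts α β)ᶜ) := by
    refine IsPreconnected.subset_closure (s := Complex.slitPlane) ?_ slitPlane_subset_compl_cuts ?_
    · exact (Complex.starConvex_one_slitPlane.isPathConnected (by simp)).isConnected.isPreconnected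
    · rw [dense_slitPlane.closure_eq]; exact Set.subset_univ _
  have hc : ContinuousOn (fun z => (slp sq z).re) (cuts α β)ᶜ :=
    Complex.continuous_re.comp_continuousOn h.slp_differentiableOn.continuousOn
  by_contra hneg
  push Not at hneg
  have h1 : (1:ℂ) ∈ (cuts α β)ᶜ := slitPlane_subset_compl_cuts (by simp)
  have h2 : 0 ≤ (slp sq 1).re := by
    have := (h.pos 1 one_pos).1
    simp [slp] at this ⊢; exact this.le
  obtain ⟨w, hw, hw0⟩ := hpc.intermediate_value hz h1 hc ⟨hneg, h2⟩
  exact h.slp_re_ne hw hw0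

theorem slp_unique (h : IsBranch α β sq) {z s : ℂ} (hz : z ≠ 0) (hs' : 0 < s.re)
    (he : s ^ 2 = 4 * (hs α β : ℂ) ^ 2 + (z - 1) ^ 2 / z) : z ∉ cuts α β ∧ slp sq z = s := by
  have hc := h.notMem_of hz hs' he
  refine ⟨hc, ?_⟩
  have h1 := h.slp_sq hc
  have h2 := h.slp_re_pos hc
  have h3 : (slp sq z - s) * (slp sq z + s) = 0 := by rw [← he] at h1; linear_combination h1
  rcases mul_eq_zero.1 h3 with h4 | h4
  · exact sub_eq_zero.1 h4
  · exfalso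
    have := congrArg Complex.re h4
    simp at this; linarith

theorem inv_notMem (h : IsBranch α β sq) {z : ℂ} (hz : z ∉ cuts α β) : z⁻¹ ∉ cuts α β ∧ slp sq z⁻¹ = slp sq z := by
  have h0 := ne_zero_of_notMem_cuts hz
  apply h.slp_unique (inv_ne_zero h0) (h.slp_re_pos hz)
  rw [h.slp_sq hz]; field_simp; ring

theorem sq_eq (h : IsBranch α β sq) {z : ℂ} (hz : z ∉ cuts α β) : sq z = z * slp sq z := by
  have h0 := ne_zero_of_notMem_cuts hz
  rw [slp]; field_simp

theorem sq_ne (h : IsBranch α β sq) {z : ℂ} (hz : z ∉ cuts α β) : sq z ≠ 0 := by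
  intro h0
  have := h.slp_re_pos hz
  simp [slp, h0] at this

end IsBranch

/-- The function `(s + 2 * c) / (s - 2 * c)` with `s = slp sq z`, which is `lam1` off the cuts. -/
noncomputable def om (α β : ℝ) (sq : ℂ → ℂ) (z : ℂ) : ℂ :=
  (slp sq z + 2 * (hs α β : ℂ)) / (slp sq z - 2 * (hs α β : ℂ))

/-- `|2 * c + s|² / 4`. -/
noncomputable def yv (α β : ℝ) (sq : ℂ → ℂ) (z : ℂ) : ℝ :=
  ‖2 * (hs α β : ℂ) + slp sq z‖ ^ 2 / 4

/-- `|z - 1|² / (4 |z|)`. -/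
noncomputable def dv (z : ℂ) : ℝ := ‖z - 1‖ ^ 2 / (4 * ‖z‖)

namespace IsBranch

variable {α β : ℝ} {sq : ℂ → ℂ}

theorem slp_sub_mul (h : IsBranch α β sq) {z : ℂ} (hz : z ∉ cuts α β) :
    (slp sq z + 2 * (hs α β : ℂ)) * (slp sq z - 2 * (hs α β : ℂ)) = (z - 1) ^ 2 / z := by
  linear_combination h.slp_sq hz

theorem slp_add_ne (h : IsBranch α β sq) {z : ℂ} (hz : z ∉ cuts α β) :
    slp sq z + 2 * (hs α β : ℂ) ≠ 0 := by
  intro h0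
  have := congrArg Complex.re h0
  have := h.slp_re_pos hz
  have := h.one_lt_hs
  simp at *; linarith

theorem slp_sub_ne (h : IsBranch α β sq) {z : ℂ} (hz : z ∉ cuts α β) (h1 : z ≠ 1) :
    slp sq z - 2 * (hs α β : ℂ) ≠ 0 := by
  intro h0
  have h2 := h.slp_sub_mul hz
  rw [h0, mul_zero] at h2
  have h3 : (z - 1) ^ 2 / z ≠ 0 :=
    div_ne_zero (pow_ne_zero _ (sub_ne_zero.2 h1)) (ne_zero_of_notMem_cuts hz)
  exact h3 h2.symm

theorem hs_ne (h : IsBranch α β sq) : (hs α β : ℂ) ≠ 0 := by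
  have := h.one_lt_hs
  exact_mod_cast (by linarith : hs α β ≠ 0)

theorem lam1_eq (h : IsBranch α β sq) {z : ℂ} (hz : z ∉ cuts α β) (h1 : z ≠ 1) :
    lam1 α β sq z = om α β sq z := by
  have h0 := ne_zero_of_notMem_cuts hz
  have h2 := h.slp_sub_mul hz
  have h3 := h.slp_sub_ne hz h1
  have h4 := sub_ne_zero.2 h1
  have h5 : (α : ℂ) + β = 2 * (hs α β : ℂ) := by unfold hs; push_cast; ring
  rw [lam1, om, h.sq_eq hz, h5, div_eq_div_iff (mul_ne_zero h0 (pow_ne_zero _ h4)) h3]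
  rw [eq_div_iff h0] at h2
  linear_combination z * (slp sq z + 2 * (hs α β : ℂ)) * h2

theorem one_lt_norm_om (h : IsBranch α β sq) {z : ℂ} (hz : z ∉ cuts α β) (h1 : z ≠ 1) :
    1 < ‖om α β sq z‖ := by
  have h3 := h.slp_sub_ne hz h1
  rw [om, norm_div, lt_div_iff₀ (norm_pos_iff.2 h3), one_mul]
  apply lt_of_pow_lt_pow_left₀ 2 (norm_nonneg _)
  rw [← Complex.normSq_eq_norm_sq, ← Complex.normSq_eq_norm_sq, Complex.normSq_apply, Complex.normSq_apply]
  have := h.slp_re_pos hz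
  have := h.one_lt_hs
  simp
  nlinarith

theorem om_ne_zero (h : IsBranch α β sq) {z : ℂ} (hz : z ∉ cuts α β) (h1 : z ≠ 1) :
    om α β sq z ≠ 0 := by
  intro h0; have := h.one_lt_norm_om hz h1; rw [h0] at this; simp at this; linarith

theorem om_ne_one (h : IsBranch α β sq) {z : ℂ} (hz : z ∉ cuts α β) (h1 : z ≠ 1) :
    om α β sq z ≠ 1 := by
  intro h0; have := h.one_lt_norm_om hz h1; rw [h0] at this; simp at this

theorem om_sub_one (h : IsBranch α β sq) {z : ℂ} (hz : z ∉ cuts α β) (h1 : z ≠ 1) :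
    om α β sq z - 1 = 4 * (hs α β : ℂ) / (slp sq z - 2 * (hs α β : ℂ)) := by
  have h3 := h.slp_sub_ne hz h1
  rw [om]; field_simp; ring

theorem om_curve (h : IsBranch α β sq) {z : ℂ} (hz : z ∉ cuts α β) (h1 : z ≠ 1) :
    (om α β sq z - 1) ^ 2 * (z - 1) ^ 2 = 16 * (hs α β : ℂ) ^ 2 * (om α β sq z * z) := by
  have h3 := h.slp_sub_ne hz h1
  have h0 := ne_zero_of_notMem_cuts hz
  have h2 := h.slp_sub_mul hz
  rw [eq_div_iff h0] at h2
  rw [h.om_sub_one hz h1, om, ← h2]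
  field_simp
  ring

theorem om_dual (h : IsBranch α β sq) {z : ℂ} (hz : z ∉ cuts α β) (hn : 1 < ‖z‖) :
    om α β sq z ∉ cuts α β ∧ slp sq (om α β sq z) = 2 * (hs α β : ℂ) * ((z + 1) / (z - 1)) := by
  have h1 : z ≠ 1 := by rintro rfl; simp at hn
  have h4 := sub_ne_zero.2 h1
  have ho := h.om_ne_zero hz h1
  have hcu := h.om_curve hz h1
  apply h.slp_unique ho
  · have hre : ((z + 1) / (z - 1)).re = (‖z‖ ^ 2 - 1) / Complex.normSq (z - 1) := by
      rw [← Complex.normSq_eq_norm_sq, Complex.div_re, ← add_div, Complex.normSq_apply z]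
      congr 1; simp; ring
    have e : 2 * (hs α β : ℂ) * ((z + 1) / (z - 1)) = ((2 * hs α β : ℝ) : ℂ) * ((z + 1) / (z - 1)) := by push_cast; ring
    rw [e, Complex.re_ofReal_mul, hre]
    have := h.one_lt_hs
    have := Complex.normSq_pos.2 h4
    have : 0 < ‖z‖ ^ 2 - 1 := by nlinarith
    positivity
  · rw [mul_pow, div_pow]
    field_simp
    linear_combination -hcu

theorem om_om (h : IsBranch α β sq) {z : ℂ} (hz : z ∉ cuts α β) (hn : 1 < ‖z‖) :
    om α β sq (om α β sq z) = z := by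
  have h1 : z ≠ 1 := by rintro rfl; simp at hn
  have h4 := sub_ne_zero.2 h1
  have hc := h.hs_ne
  conv_lhs => rw [om]
  rw [(h.om_dual hz hn).2]
  have e1 : 2 * (hs α β : ℂ) * ((z + 1) / (z - 1)) + 2 * (hs α β : ℂ) = 4 * hs α β * z / (z - 1) := by
    field_simp; ring
  have e2 : 2 * (hs α β : ℂ) * ((z + 1) / (z - 1)) - 2 * (hs α β : ℂ) = 4 * hs α β / (z - 1) := by
    field_simp; ring
  rw [e1, e2]; field_simp

theorem om_inv (h : IsBranch α β sq) {z : ℂ} (hz : z ∉ cuts α β) :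
    om α β sq z⁻¹ = om α β sq z := by
  rw [om, (h.inv_notMem hz).2, om]

theorem slp_hasDerivAt (h : IsBranch α β sq) {z : ℂ} (hz : z ∉ cuts α β) :
    HasDerivAt (slp sq) ((z ^ 2 - 1) / (2 * z ^ 2 * slp sq z)) z := by
  have h0 := ne_zero_of_notMem_cuts hz
  have hd : HasDerivAt (slp sq) (deriv (slp sq) z) z :=
    (h.slp_differentiableOn.differentiableAt (isOpen_compl_cuts.mem_nhds hz)).hasDerivAt
  have hs0 : slp sq z ≠ 0 := by intro h5; apply h.slp_re_ne hz; rw [h5]; rfl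
  have e1 : HasDerivAt (fun z => slp sq z ^ 2) (2 * slp sq z * deriv (slp sq) z) z := by
    exact (hd.fun_pow 2).congr_deriv (by simp)
  have e2 : HasDerivAt (fun z : ℂ => 4 * (hs α β : ℂ) ^ 2 + (z - 1) ^ 2 / z) ((z ^ 2 - 1) / z ^ 2) z := by
    have := ((((hasDerivAt_id z).sub_const 1).pow 2).div (hasDerivAt_id z) h0).const_add (4 * (hs α β : ℂ) ^ 2)
    refine (this.congr_deriv ?_)
    simp; congr 1; ring
  have e3 : HasDerivAt (fun z => slp sq z ^ 2) ((z ^ 2 - 1) / z ^ 2) z := by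
    apply e2.congr_of_eventuallyEq
    filter_upwards [isOpen_compl_cuts.mem_nhds hz] with w hw using h.slp_sq hw
  have e4 := e1.unique e3
  have : deriv (slp sq) z = (z ^ 2 - 1) / (2 * z ^ 2 * slp sq z) := by
    rw [eq_div_iff (by simp [h0, hs0])]
    rw [eq_div_iff (by simp [h0])] at e4
    linear_combination e4
  rwa [← this]

theorem om_hasDerivAt (h : IsBranch α β sq) {z : ℂ} (hz : z ∉ cuts α β) (h1 : z ≠ 1) :
    HasDerivAt (om α β sq)
      (-(2 * (hs α β : ℂ) * (z + 1) / (z * slp sq z * (z - 1))) * om α β sq z) z := by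
  have h0 := ne_zero_of_notMem_cuts hz
  have h3 := h.slp_sub_ne hz h1
  have h4 := sub_ne_zero.2 h1
  have hs0 : slp sq z ≠ 0 := by intro h5; apply h.slp_re_ne hz; rw [h5]; rfl
  have hd := h.slp_hasDerivAt hz
  have := (hd.add_const (2 * (hs α β : ℂ))).div (hd.sub_const (2 * (hs α β : ℂ))) h3
  refine this.congr_deriv ?_
  have h2 := h.slp_sub_mul hz
  rw [eq_div_iff h0] at h2
  rw [om]
  field_simp
  linear_combination 4 * (z + 1) * (hs α β : ℂ) * h2

theorem yv_eq (h : IsBranch α β sq) {z : ℂ} (hz : z ∉ cuts α β) (h1 : z ≠ 1) :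
    yv α β sq z = dv z * ‖om α β sq z‖ := by
  have h0 := ne_zero_of_notMem_cuts hz
  have h3 := h.slp_sub_ne hz h1
  have h2 := congrArg norm (h.slp_sub_mul hz)
  rw [norm_mul, norm_div, norm_pow] at h2
  have h5 := norm_pos_iff.2 h3
  have h6 := norm_pos_iff.2 h0
  rw [yv, dv, om, norm_div, add_comm (2 * (hs α β : ℂ))]
  rw [eq_div_iff h6.ne'] at h2
  field_simp
  linear_combination h2 * ‖slp sq z + 2 * (hs α β : ℂ)‖

theorem yv_pos (h : IsBranch α β sq) {z : ℂ} (hz : z ∉ cuts α β) : 0 < yv α β sq z := by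
  have := h.slp_add_ne hz
  rw [add_comm] at this
  rw [yv]; have := norm_pos_iff.2 this; positivity

theorem dv_mul_dv (h : IsBranch α β sq) {z : ℂ} (hz : z ∉ cuts α β) (h1 : z ≠ 1) :
    dv (om α β sq z) * dv z = hs α β ^ 2 := by
  have h0 := norm_pos_iff.2 (ne_zero_of_notMem_cuts hz)
  have h3 := norm_pos_iff.2 (h.om_ne_zero hz h1)
  have h2 := congrArg norm (h.om_curve hz h1)
  have h4 := h.one_lt_hs
  simp only [norm_mul, norm_pow, Complex.norm_real, Real.norm_eq_abs, Complex.norm_ofNat, sq_abs] at h2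
  rw [dv, dv]
  field_simp
  linear_combination h2

end IsBranch

/-- The numerator of `symbA`. -/
noncomputable def numB (α β : ℝ) (z : ℂ) : Matrix (Fin 2) (Fin 2) ℂ :=
  !![2 * (α : ℂ) * z, (α : ℂ) * (z + 1); (β : ℂ) * z * (z + 1), 2 * (β : ℂ) * z]

/-- The adjugate of `numB`. -/
noncomputable def adjB (α β : ℝ) (z : ℂ) : Matrix (Fin 2) (Fin 2) ℂ :=
  !![2 * (β : ℂ) * z, -((α : ℂ) * (z + 1)); -((β : ℂ) * z * (z + 1)), 2 * (α : ℂ) * z]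

/-- The traceless part of `numB`. -/
noncomputable def trlM (α β : ℝ) (z : ℂ) : Matrix (Fin 2) (Fin 2) ℂ :=
  !![((α : ℂ) - (β : ℂ)) * z, (α : ℂ) * (z + 1);
    (β : ℂ) * z * (z + 1), -(((α : ℂ) - (β : ℂ)) * z)]

/-- The polynomial numerator of the integer power `symbA ^ j`. -/
noncomputable def polyQ (α β : ℝ) (j : ℤ) (z : ℂ) : Matrix (Fin 2) (Fin 2) ℂ :=
  if 0 ≤ j then numB α β z ^ j.natAbs else adjB α β z ^ j.natAbs

/-- The eigenvalue `z * (2 * c + s)` of `numB`. -/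
noncomputable def eig1 (α β : ℝ) (sq : ℂ → ℂ) (z : ℂ) : ℂ := z * (2 * (hs α β : ℂ) + slp sq z)

/-- The eigenvalue `z * (2 * c - s)` of `numB`. -/
noncomputable def eig2 (α β : ℝ) (sq : ℂ → ℂ) (z : ℂ) : ℂ := z * (2 * (hs α β : ℂ) - slp sq z)

theorem numB_eq (α β : ℝ) (z : ℂ) :
    numB α β z = (2 * (hs α β : ℂ) * z) • (1 : Matrix (Fin 2) (Fin 2) ℂ) + trlM α β z := by
  ext i j
  fin_cases i <;> fin_cases j <;> simp [numB, trlM, hs] <;> ring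

theorem adjB_eq (α β : ℝ) (z : ℂ) :
    adjB α β z = (2 * (hs α β : ℂ) * z) • (1 : Matrix (Fin 2) (Fin 2) ℂ) - trlM α β z := by
  ext i j
  fin_cases i <;> fin_cases j <;> simp [adjB, trlM, hs] <;> ring

theorem pow_mul_eq_smul {M G : Matrix (Fin 2) (Fin 2) ℂ} {x : ℂ} (h : M * G = x • G) (k : ℕ) :
    M ^ k * G = x ^ k • G := by
  induction k with
  | zero => simp
  | succ k ih => rw [pow_succ, Matrix.mul_assoc, h, mul_smul_comm, ih, smul_smul, pow_succ']

theorem differentiable_pow_entry {M : ℂ → Matrix (Fin 2) (Fin 2) ℂ}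
    (h : ∀ i j, Differentiable ℂ fun z => M z i j) (k : ℕ) :
    ∀ i j, Differentiable ℂ fun z => (M z ^ k) i j := by
  induction k with
  | zero => intro i j; simp only [pow_zero]; exact differentiable_const _
  | succ k ih =>
    intro i j
    simp only [pow_succ, Matrix.mul_apply]
    exact Differentiable.fun_sum fun l _ => (ih i l).mul (h l j)

theorem differentiable_numB (α β : ℝ) (i j : Fin 2) : Differentiable ℂ fun z => numB α β z i j := by
  fin_cases i <;> fin_cases j <;> simp [numB] <;> fun_prop

theorem differentiable_adjB (α β : ℝ) (i j : Fin 2) : Differentiable ℂ fun z => adjB α β z i j := by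
  fin_cases i <;> fin_cases j <;> simp [adjB] <;> fun_prop

theorem differentiable_polyQ (α β : ℝ) (k : ℤ) (i j : Fin 2) :
    Differentiable ℂ fun z => polyQ α β k z i j := by
  unfold polyQ
  split_ifs
  · exact differentiable_pow_entry (differentiable_numB α β) _ i j
  · exact differentiable_pow_entry (differentiable_adjB α β) _ i j

theorem symbA_eq (α β : ℝ) (z : ℂ) : symbA α β z = (z - 1)⁻¹ • numB α β z := rfl

theorem numB_mul_adjB {α β : ℝ} (h : α * β = 1) (z : ℂ) :
    numB α β z * adjB α β z = (-(z * (z - 1) ^ 2)) • (1 : Matrix (Fin 2) (Fin 2) ℂ) := by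
  have h2 : (α : ℂ) * β = 1 := by exact_mod_cast h
  ext i j
  fin_cases i <;> fin_cases j <;> simp [numB, adjB]
  · linear_combination (-z * (z - 1)^2) * h2
  · ring
  · ring
  · linear_combination (-z * (z - 1)^2) * h2

theorem symbA_inv {α β : ℝ} (h : α * β = 1) {z : ℂ} (h0 : z ≠ 0) (h1 : z ≠ 1) :
    (symbA α β z)⁻¹ = ((-z)⁻¹ * (z - 1)⁻¹) • adjB α β z := by
  apply Matrix.inv_eq_right_inv
  have := sub_ne_zero.2 h1
  rw [symbA_eq, smul_mul_smul_comm, numB_mul_adjB h, smul_smul]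
  convert one_smul ℂ _
  field_simp

theorem isUnit_symbA_det {α β : ℝ} (h : α * β = 1) {z : ℂ} (h0 : z ≠ 0) (h1 : z ≠ 1) :
    IsUnit (symbA α β z).det := by
  have := sub_ne_zero.2 h1
  have e : symbA α β z * (((-z)⁻¹ * (z - 1)⁻¹) • adjB α β z) = 1 := by
    rw [symbA_eq, smul_mul_smul_comm, numB_mul_adjB h, smul_smul]
    convert one_smul ℂ _
    field_simp
  exact (Matrix.isUnit_iff_isUnit_det _).1 (IsUnit.of_mul_eq_one _ e)

theorem symbA_zpow {α β : ℝ} (h : α * β = 1) {z : ℂ} (h0 : z ≠ 0) (h1 : z ≠ 1) (j : ℤ) :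
    symbA α β z ^ j = ((z - 1) ^ (-|j|) * (-z) ^ (min j 0)) • polyQ α β j z := by
  rcases le_or_gt 0 j with hj | hj
  · obtain ⟨k, rfl⟩ := Int.eq_ofNat_of_zero_le hj
    simp only [polyQ, if_pos hj, zpow_natCast, Int.natAbs_natCast, min_eq_right hj, abs_of_nonneg hj]
    rw [symbA_eq, smul_pow, _root_.zpow_zero, mul_one, _root_.zpow_neg, zpow_natCast, inv_pow]
  · obtain ⟨k, rfl⟩ : ∃ k : ℕ, j = -(k : ℤ) := ⟨j.natAbs, by omega⟩
    simp only [polyQ, if_neg (not_le.2 hj), min_eq_left hj.le, abs_of_neg hj, neg_neg, Int.natAbs_neg, Int.natAbs_natCast]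
    rw [Matrix.zpow_neg (isUnit_symbA_det h h0 h1), zpow_natCast, ← Matrix.inv_pow', symbA_inv h h0 h1, smul_pow, _root_.zpow_neg, _root_.zpow_neg, zpow_natCast, zpow_natCast]
    congr 1
    rw [mul_pow, inv_pow, inv_pow, mul_comm]

namespace IsBranch

variable {α β : ℝ} {sq : ℂ → ℂ}

theorem trlM_sq (h : IsBranch α β sq) {z : ℂ} (hz : z ∉ cuts α β) :
    trlM α β z * trlM α β z = (sq z ^ 2) • (1 : Matrix (Fin 2) (Fin 2) ℂ) := by
  have h2 : (α : ℂ) * β = 1 := by exact_mod_cast h.mul_eq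
  rw [h.sq_sq z hz]
  ext i j
  fin_cases i <;> fin_cases j <;> simp [trlM]
  · linear_combination (z * (z + 1) ^ 2 - 2 * z^2 - z * (α * β + 1)) * h2
  · ring
  · ring
  · linear_combination (z * (z + 1) ^ 2 - 2 * z^2 - z * (α * β + 1)) * h2

theorem trlM_mul_projF (h : IsBranch α β sq) {z : ℂ} (hz : z ∉ cuts α β) :
    trlM α β z * projF α β sq z = sq z • projF α β sq z := by
  have h0 := h.sq_ne hz
  have h1 := h.trlM_sq hz
  change trlM α β z * ((2 : ℂ)⁻¹ • 1 + (2 * sq z)⁻¹ • trlM α β z) = sq z • ((2 : ℂ)⁻¹ • 1 + (2 * sq z)⁻¹ • trlM α β z)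
  rw [mul_add, mul_smul_comm, mul_smul_comm, h1, mul_one]
  match_scalars <;> field_simp

theorem projF_mul_trlM (h : IsBranch α β sq) {z : ℂ} (hz : z ∉ cuts α β) :
    projF α β sq z * trlM α β z = sq z • projF α β sq z := by
  rw [← h.trlM_mul_projF hz]
  change ((2 : ℂ)⁻¹ • 1 + (2 * sq z)⁻¹ • trlM α β z) * trlM α β z = trlM α β z * ((2 : ℂ)⁻¹ • 1 + (2 * sq z)⁻¹ • trlM α β z)
  rw [mul_add, add_mul, mul_smul_comm, mul_smul_comm, smul_mul_assoc, smul_mul_assoc, one_mul, mul_one]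

theorem trlM_mul_one_sub (h : IsBranch α β sq) {z : ℂ} (hz : z ∉ cuts α β) :
    trlM α β z * (1 - projF α β sq z) = (-sq z) • (1 - projF α β sq z) := by
  have h0 := h.sq_ne hz
  rw [mul_sub, mul_one, h.trlM_mul_projF hz]
  change trlM α β z - sq z • ((2 : ℂ)⁻¹ • 1 + (2 * sq z)⁻¹ • trlM α β z) = (-sq z) • (1 - ((2 : ℂ)⁻¹ • 1 + (2 * sq z)⁻¹ • trlM α β z))
  match_scalars <;> field_simp <;> ring

theorem numB_mul_projF (h : IsBranch α β sq) {z : ℂ} (hz : z ∉ cuts α β) :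
    numB α β z * projF α β sq z = eig1 α β sq z • projF α β sq z := by
  rw [numB_eq, add_mul, h.trlM_mul_projF hz, smul_mul_assoc, one_mul, ← add_smul, eig1, h.sq_eq hz]
  congr 1; ring

theorem numB_mul_one_sub (h : IsBranch α β sq) {z : ℂ} (hz : z ∉ cuts α β) :
    numB α β z * (1 - projF α β sq z) = eig2 α β sq z • (1 - projF α β sq z) := by
  rw [numB_eq, add_mul, h.trlM_mul_one_sub hz, smul_mul_assoc, one_mul, ← add_smul, eig2, h.sq_eq hz]
  congr 1; ring

theorem adjB_mul_projF (h : IsBranch α β sq) {z : ℂ} (hz : z ∉ cuts α β) :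
    adjB α β z * projF α β sq z = eig2 α β sq z • projF α β sq z := by
  rw [adjB_eq, sub_mul, h.trlM_mul_projF hz, smul_mul_assoc, one_mul, ← sub_smul, eig2, h.sq_eq hz]
  congr 1; ring

theorem adjB_mul_one_sub (h : IsBranch α β sq) {z : ℂ} (hz : z ∉ cuts α β) :
    adjB α β z * (1 - projF α β sq z) = eig1 α β sq z • (1 - projF α β sq z) := by
  rw [adjB_eq, sub_mul, h.trlM_mul_one_sub hz, smul_mul_assoc, one_mul, ← sub_smul, eig1, h.sq_eq hz]
  congr 1; ring

theorem polyQ_mul_projF (h : IsBranch α β sq) {z : ℂ} (hz : z ∉ cuts α β) (j : ℤ) :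
    polyQ α β j z * projF α β sq z =
      (if 0 ≤ j then eig1 α β sq z else eig2 α β sq z) ^ j.natAbs • projF α β sq z := by
  unfold polyQ
  split_ifs
  · exact pow_mul_eq_smul (h.numB_mul_projF hz) _
  · exact pow_mul_eq_smul (h.adjB_mul_projF hz) _

theorem polyQ_mul_one_sub (h : IsBranch α β sq) {z : ℂ} (hz : z ∉ cuts α β) (j : ℤ) :
    polyQ α β j z * (1 - projF α β sq z) =
      (if 0 ≤ j then eig2 α β sq z else eig1 α β sq z) ^ j.natAbs • (1 - projF α β sq z) := by
  unfold polyQ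
  split_ifs
  · exact pow_mul_eq_smul (h.numB_mul_one_sub hz) _
  · exact pow_mul_eq_smul (h.adjB_mul_one_sub hz) _

theorem commute_projF (h : IsBranch α β sq) {z : ℂ} (hz : z ∉ cuts α β) :
    Commute (projF α β sq z) (symbA α β z) := by
  rw [symbA_eq, numB_eq]
  apply Commute.smul_right
  apply Commute.add_right
  · exact (Commute.one_right _).smul_right _
  · exact (h.projF_mul_trlM hz).trans (h.trlM_mul_projF hz).symm

theorem symbA_projF_symbA (h : IsBranch α β sq) {z : ℂ} (hz : z ∉ cuts α β) (h1 : z ≠ 1) (k j : ℤ) :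
    symbA α β z ^ k * projF α β sq z * symbA α β z ^ j = symbA α β z ^ (k + j) * projF α β sq z := by
  have h0 := ne_zero_of_notMem_cuts hz
  have hc := Matrix.Commute.zpow_right (h.commute_projF hz) j
  rw [Matrix.mul_assoc, hc.eq, ← Matrix.mul_assoc, Matrix.zpow_add (isUnit_symbA_det h.mul_eq h0 h1)]

theorem norm_eig2_le (h : IsBranch α β sq) {z : ℂ} (hz : z ∉ cuts α β) :
    ‖eig2 α β sq z‖ ≤ ‖eig1 α β sq z‖ := by
  rw [eig1, eig2, norm_mul, norm_mul]
  gcongr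
  apply le_of_sq_le_sq _ (norm_nonneg _)
  rw [← Complex.normSq_eq_norm_sq, ← Complex.normSq_eq_norm_sq, Complex.normSq_apply, Complex.normSq_apply]
  have := h.slp_re_pos hz
  have := h.one_lt_hs
  simp
  nlinarith

theorem norm_eig1_sq (_h : IsBranch α β sq) (z : ℂ) :
    ‖eig1 α β sq z‖ ^ 2 = 4 * ‖z‖ ^ 2 * yv α β sq z := by
  rw [eig1, norm_mul, yv]; ring

theorem eig1_mul_eig2 (h : IsBranch α β sq) {z : ℂ} (hz : z ∉ cuts α β) :
    eig1 α β sq z * eig2 α β sq z = -(z * (z - 1) ^ 2) := by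
  have h0 := ne_zero_of_notMem_cuts hz
  have h2 := h.slp_sub_mul hz
  rw [eq_div_iff h0] at h2
  rw [eig1, eig2]
  linear_combination -z * h2

theorem norm_eig1_sq' (h : IsBranch α β sq) {z : ℂ} (hz : z ∉ cuts α β) (h1 : z ≠ 1) :
    ‖eig1 α β sq z‖ ^ 2 = ‖z‖ * ‖z - 1‖ ^ 2 * ‖om α β sq z‖ := by
  have h0 := norm_pos_iff.2 (ne_zero_of_notMem_cuts hz)
  rw [h.norm_eig1_sq, h.yv_eq hz h1, dv]; field_simp

theorem norm_eig2_sq (h : IsBranch α β sq) {z : ℂ} (hz : z ∉ cuts α β) (h1 : z ≠ 1) :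
    ‖eig2 α β sq z‖ ^ 2 = ‖z‖ * ‖z - 1‖ ^ 2 / ‖om α β sq z‖ := by
  have h0 := norm_pos_iff.2 (ne_zero_of_notMem_cuts hz)
  have h3 := norm_pos_iff.2 (sub_ne_zero.2 h1)
  have h4 := norm_pos_iff.2 (h.om_ne_zero hz h1)
  have h2 := congrArg norm (h.eig1_mul_eig2 hz)
  rw [norm_mul, norm_neg, norm_mul, norm_pow] at h2
  have h5 := h.norm_eig1_sq' hz h1
  have h6 : ‖eig1 α β sq z‖ ≠ 0 := by
    intro h7; rw [h7] at h5
    have : 0 < ‖z‖ * ‖z - 1‖ ^ 2 * ‖om α β sq z‖ := by positivity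
    rw [zero_pow two_ne_zero] at h5; linarith
  rw [eq_div_iff h4.ne']
  apply mul_left_cancel₀ (mul_ne_zero h0.ne' (pow_ne_zero 2 h3.ne'))
  have e : (‖z‖ * ‖z - 1‖ ^ 2) * (‖eig2 α β sq z‖ ^ 2 * ‖om α β sq z‖) = (‖eig1 α β sq z‖ * ‖eig2 α β sq z‖) ^ 2 := by
    rw [mul_pow, h5]; ring
  rw [e, h2]; ring

theorem projF_differentiableOn (h : IsBranch α β sq) (a b : Fin 2) :
    DifferentiableOn ℂ (fun z => projF α β sq z a b) (cuts α β)ᶜ := by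
  have h1 : DifferentiableOn ℂ (fun z => (2 * sq z)⁻¹) (cuts α β)ᶜ := by
    apply DifferentiableOn.inv (h.diff.const_mul 2)
    intro z hz; exact mul_ne_zero two_ne_zero (h.sq_ne hz)
  have h2 : Differentiable ℂ fun z => trlM α β z a b := by
    fin_cases a <;> fin_cases b <;> simp [trlM] <;> fun_prop
  exact (differentiableOn_const ((2 : ℂ)⁻¹ * (1 : Matrix (Fin 2) (Fin 2) ℂ) a b)).add
    (h1.mul h2.differentiableOn)

end IsBranch

section

open Filter Metric

theorem circleIntegral_swap {f : ℂ → ℂ → ℂ} {c₁ c₂ : ℂ} {R₁ R₂ : ℝ} (h₁ : 0 ≤ R₁) (h₂ : 0 ≤ R₂)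
    (hf : ContinuousOn (Function.uncurry f) (sphere c₁ R₁ ×ˢ sphere c₂ R₂)) :
    (∮ z in C(c₁, R₁), ∮ w in C(c₂, R₂), f z w) = ∮ w in C(c₂, R₂), ∮ z in C(c₁, R₁), f z w := by
  have hp : (0 : ℝ) ≤ 2 * Real.pi := by positivity
  simp only [circleIntegral, intervalIntegral.integral_of_le hp, ← MeasureTheory.integral_smul]
  rw [MeasureTheory.integral_integral_swap]
  · congr 1; ext θ; congr 1; ext φ
    simp only [smul_eq_mul]; ring
  · rw [MeasureTheory.Measure.prod_restrict]
    apply MeasureTheory.IntegrableOn.mono_set (t := Set.Icc 0 (2 * Real.pi) ×ˢ Set.Icc 0 (2 * Real.pi)) _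
      (Set.prod_mono Set.Ioc_subset_Icc_self Set.Ioc_subset_Icc_self)
    apply ContinuousOn.integrableOn_compact (isCompact_Icc.prod isCompact_Icc)
    apply Continuous.continuousOn
    simp only [deriv_circleMap]
    have hc : Continuous fun p : ℝ × ℝ => f (circleMap c₁ R₁ p.1) (circleMap c₂ R₂ p.2) := by
      have := hf.comp_continuous (f := fun p : ℝ × ℝ => (circleMap c₁ R₁ p.1, circleMap c₂ R₂ p.2))
        (((continuous_circleMap _ _).comp continuous_fst).prodMk ((continuous_circleMap _ _).comp continuous_snd))
        (fun p => ⟨circleMap_mem_sphere _ h₁ _, circleMap_mem_sphere _ h₂ _⟩)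
      exact this
    have e1 : Continuous fun p : ℝ × ℝ => circleMap 0 R₁ p.1 := (continuous_circleMap _ _).comp continuous_fst
    have e2 : Continuous fun p : ℝ × ℝ => circleMap 0 R₂ p.2 := (continuous_circleMap _ _).comp continuous_snd
    simp only [Function.uncurry_def, smul_eq_mul]
    exact (e1.mul continuous_const).mul ((e2.mul continuous_const).mul hc)

theorem continuousOn_circleIntegral {f : ℂ → ℂ → ℂ} {S : Set ℂ} {c : ℂ} {R : ℝ} (hR : 0 ≤ R)
    (hf : ContinuousOn (Function.uncurry f) (S ×ˢ sphere c R)) :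
    ContinuousOn (fun z => ∮ w in C(c, R), f z w) S := by
  simp only [circleIntegral]
  rw [continuousOn_iff_continuous_domRestrict]
  apply intervalIntegral.continuous_parametric_intervalIntegral_of_continuous'
  simp only [deriv_circleMap, smul_eq_mul]
  have e1 : Continuous fun p : S × ℝ => circleMap c R p.2 := (continuous_circleMap _ _).comp continuous_snd
  have e2 : Continuous fun p : S × ℝ => circleMap 0 R p.2 := (continuous_circleMap _ _).comp continuous_snd
  have := hf.comp_continuous (f := fun p : S × ℝ => ((p.1 : ℂ), circleMap c R p.2))
    ((continuous_subtype_val.comp continuous_fst).prodMk e1) (fun p => ⟨p.1.2, circleMap_mem_sphere _ hR _⟩)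
  exact (e2.mul continuous_const).mul this

theorem circleIntegral_annulus {f : ℂ → ℂ} {r R : ℝ} (h0 : 0 < r) (hle : r ≤ R)
    (hf : ∀ w : ℂ, r ≤ ‖w‖ → ‖w‖ ≤ R → DifferentiableAt ℂ f w) :
    (∮ z in C(0, R), f z) = ∮ z in C(0, r), f z := by
  apply Complex.circleIntegral_eq_of_differentiable_on_annulus_off_countable h0 hle Set.countable_empty
  · intro w hw
    simp only [Set.mem_sdiff, mem_closedBall, mem_ball, dist_zero_right, not_lt] at hw
    exact (hf w hw.2 hw.1).continuousAt.continuousWithinAt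
  · intro w hw
    simp only [Set.mem_sdiff, mem_closedBall, mem_ball, dist_zero_right, not_le] at hw
    exact hf w hw.1.2.le hw.1.1.le

theorem circleIntegral_disc {f : ℂ → ℂ} {c : ℂ} {R : ℝ} (h0 : 0 ≤ R)
    (hf : ∀ w : ℂ, ‖w - c‖ ≤ R → DifferentiableAt ℂ f w) : (∮ z in C(c, R), f z) = 0 := by
  apply Complex.circleIntegral_eq_zero_of_differentiable_on_off_countable h0 Set.countable_empty
  · intro w hw
    rw [mem_closedBall, dist_eq_norm] at hw
    exact (hf w hw).continuousAt.continuousWithinAt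
  · intro w hw
    simp only [Set.sdiff_empty, mem_ball, dist_eq_norm] at hw
    exact hf w hw.le

theorem integral_sub_inv_outside {w : ℂ} {R : ℝ} (h0 : 0 ≤ R) (hw : R < ‖w‖) :
    (∮ z in C(0, R), (z - w)⁻¹) = 0 := by
  apply circleIntegral_disc h0
  intro z hz
  have : z - w ≠ 0 := by
    intro h; rw [sub_zero] at hz; rw [sub_eq_zero.1 h] at hz; linarith
  fun_prop (disch := assumption)

theorem circleIntegral_residue_one {Ω : Set ℂ} (hΩ : IsOpen Ω) {ri ro : ℝ} (hi0 : 0 < ri)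
    (hi1 : ri < 1) (ho1 : 1 < ro) (hΩ1 : ∀ w : ℂ, ri ≤ ‖w‖ → ‖w‖ ≤ ro → w ∈ Ω)
    (hΩ2 : ∀ w : ℂ, ‖w - 1‖ ≤ 1 / 2 → w ∈ Ω) (M : ℕ) :
    ∀ H : ℂ → ℂ, DifferentiableOn ℂ H Ω →
      (∮ w in C(1, 1 / 2), ((w - 1) ^ M)⁻¹ * H w) =
        (∮ w in C(0, ro), ((w - 1) ^ M)⁻¹ * H w) - ∮ w in C(0, ri), ((w - 1) ^ M)⁻¹ * H w := by
  have key : ∀ (c : ℂ) (R : ℝ), 0 ≤ R → (∀ w ∈ sphere c R, w ∈ Ω ∧ w - 1 ≠ 0) → ∀ H : ℂ → ℂ,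
      DifferentiableOn ℂ H Ω → ∀ M : ℕ, (∮ w in C(c, R), ((w - 1) ^ (M + 1))⁻¹ * H w) =
        H 1 * (∮ w in C(c, R), (w - 1) ^ (-(M + 1 : ℕ) : ℤ)) +
          ∮ w in C(c, R), ((w - 1) ^ M)⁻¹ * dslope H 1 w := by
    intro c R hR hs H hH M
    have hd : DifferentiableOn ℂ (dslope H 1) Ω :=
      (Complex.differentiableOn_dslope (hΩ.mem_nhds (hΩ1 1 (by simp [hi1.le]) (by simp [ho1.le])))).2 hH
    have hcont : ∀ k : ℕ, ContinuousOn (fun w : ℂ => ((w - 1) ^ k)⁻¹) (sphere c R) := fun k =>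
      ContinuousOn.inv₀ (by fun_prop) fun w hw => pow_ne_zero _ (hs w hw).2
    rw [← circleIntegral.integral_const_mul, ← circleIntegral.integral_add]
    · apply circleIntegral.integral_congr hR
      intro w hw
      have h1 := (hs w hw).2
      have h2 := sub_smul_dslope H 1 w
      have h3 : H w = H 1 + (w - 1) * dslope H 1 w := by
        rw [smul_eq_mul] at h2; rw [h2]; ring
      simp only [_root_.zpow_neg, zpow_natCast]
      conv_lhs => rw [h3]
      field_simp; ring
    · apply ContinuousOn.circleIntegrable hR
      simp only [_root_.zpow_neg, zpow_natCast]
      exact continuousOn_const.mul (hcont _)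
    · apply ContinuousOn.circleIntegrable hR
      exact (hcont _).mul (hd.continuousOn.mono fun w hw => (hs w hw).1)
  have s1 : ∀ w ∈ sphere (1 : ℂ) (1 / 2), w ∈ Ω ∧ w - 1 ≠ 0 := by
    intro w hw
    rw [mem_sphere, dist_eq_norm] at hw
    exact ⟨hΩ2 w hw.le, by intro h; rw [h] at hw; norm_num at hw⟩
  have s2 : ∀ R, ri ≤ R → R ≤ ro → R ≠ 1 → ∀ w ∈ sphere (0 : ℂ) R, w ∈ Ω ∧ w - 1 ≠ 0 := by
    intro R h1 h2 h3 w hw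
    rw [mem_sphere, dist_zero_right] at hw
    exact ⟨hΩ1 w (hw ▸ h1) (hw ▸ h2), by intro h; rw [sub_eq_zero.1 h] at hw; simp at hw; exact h3 hw.symm⟩
  induction M with
  | zero =>
    intro H hH
    have hda : ∀ w ∈ Ω, DifferentiableAt ℂ H w := fun w hw => hH.differentiableAt (hΩ.mem_nhds hw)
    simp only [pow_zero, inv_one, one_mul]
    rw [circleIntegral_disc (by norm_num) fun w hw => hda w (hΩ2 w hw),
      circleIntegral_annulus hi0 (by linarith) fun w hw hw' => hda w (hΩ1 w hw hw'), sub_self]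
  | succ M ih =>
    intro H hH
    have hd : DifferentiableOn ℂ (dslope H 1) Ω :=
      (Complex.differentiableOn_dslope (hΩ.mem_nhds (hΩ1 1 (by simp [hi1.le]) (by simp [ho1.le])))).2 hH
    rw [key 1 (1 / 2) (by norm_num) s1 H hH, key 0 ro (by linarith) (s2 ro (by linarith) le_rfl ho1.ne') H hH,
      key 0 ri hi0.le (s2 ri le_rfl (by linarith) hi1.ne) H hH, ih _ hd]
    have : (∮ w in C(1, 1 / 2), (w - 1) ^ (-(M + 1 : ℕ) : ℤ)) =
        (∮ w in C(0, ro), (w - 1) ^ (-(M + 1 : ℕ) : ℤ)) - ∮ w in C(0, ri), (w - 1) ^ (-(M + 1 : ℕ) : ℤ) := by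
      rcases Nat.eq_zero_or_pos M with rfl | hM
      · simp only [zero_add, Nat.cast_one, _root_.zpow_neg_one]
        rw [circleIntegral.integral_sub_inv_of_mem_ball (by simp),
          circleIntegral.integral_sub_inv_of_mem_ball (by simp [ho1]),
          integral_sub_inv_outside hi0.le (by simp [hi1]), sub_zero]
      · rw [circleIntegral.integral_sub_zpow_of_ne (by omega), circleIntegral.integral_sub_zpow_of_ne (by omega),
          circleIntegral.integral_sub_zpow_of_ne (by omega), sub_zero]
    rw [this]; ring

theorem circleIntegral_pole_between {h : ℂ → ℂ} (hh : ∀ z ≠ 0, DifferentiableAt ℂ h z) {r Z : ℝ}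
    (hr : 0 < r) {w : ℂ} (h1 : r < ‖w‖) (h2 : ‖w‖ < Z) :
    (∮ z in C(0, Z), (z - w)⁻¹ * h z) = (∮ z in C(0, r), (z - w)⁻¹ * h z) + 2 * Real.pi * Complex.I * h w := by
  have hw0 : w ≠ 0 := by intro h; rw [h] at h1; simp at h1; linarith
  have hd : ∀ z ≠ 0, DifferentiableAt ℂ (dslope h w) z := by
    intro z hz
    have hopen : IsOpen ({0}ᶜ : Set ℂ) := isOpen_compl_singleton
    have : DifferentiableOn ℂ (dslope h w) {0}ᶜ :=
      (Complex.differentiableOn_dslope (hopen.mem_nhds hw0)).2 fun z hz => (hh z hz).differentiableWithinAt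
    exact this.differentiableAt (hopen.mem_nhds hz)
  have key : ∀ R, 0 < R → R ≠ ‖w‖ → (∮ z in C(0, R), (z - w)⁻¹ * h z) =
      (∮ z in C(0, R), dslope h w z) + h w * ∮ z in C(0, R), (z - w)⁻¹ := by
    intro R hR hRw
    have hne : ∀ z ∈ sphere (0 : ℂ) R, z - w ≠ 0 := by
      intro z hz h; rw [sub_eq_zero.1 h, mem_sphere, dist_zero_right] at hz; exact hRw hz.symm
    have hne' : ∀ z ∈ sphere (0 : ℂ) R, z ≠ 0 := by
      rintro z hz rfl; rw [mem_sphere, dist_self] at hz; exact hR.ne hz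
    rw [← circleIntegral.integral_const_mul, ← circleIntegral.integral_add]
    · apply circleIntegral.integral_congr hR.le
      intro z hz
      have h3 := hne z hz
      have h4 := sub_smul_dslope h w z
      have h5 : h z = h w + (z - w) * dslope h w z := by
        rw [smul_eq_mul] at h4; rw [h4]; ring
      beta_reduce
      conv_lhs => rw [h5]
      field_simp; ring
    · exact ContinuousOn.circleIntegrable hR.le fun z hz => (hd z (hne' z hz)).continuousAt.continuousWithinAt
    · apply ContinuousOn.circleIntegrable hR.le
      exact continuousOn_const.mul (ContinuousOn.inv₀ (by fun_prop) hne)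
  rw [key Z (by linarith) h2.ne', key r hr h1.ne, circleIntegral.integral_sub_inv_of_mem_ball (by simpa using h2),
    integral_sub_inv_outside hr.le h1, circleIntegral_annulus hr (by linarith) (f := dslope h w)]
  · ring
  · intro z hz _; apply hd; rintro rfl; simp at hz; linarith

theorem continuousOn_kernel {g h : ℂ → ℂ} {S T : Set ℂ} (hg : ContinuousOn g T) (hh : ContinuousOn h S)
    (hne : ∀ z ∈ S, ∀ w ∈ T, z ≠ w) :
    ContinuousOn (Function.uncurry fun z w => (z - w)⁻¹ * (g w * h z)) (S ×ˢ T) := by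
  simp only [Function.uncurry_def]
  refine ContinuousOn.mul (ContinuousOn.inv₀ (by fun_prop) fun p hp => sub_ne_zero.2 (hne _ hp.1 _ hp.2)) ?_
  exact (hg.comp continuousOn_snd fun p hp => hp.2).mul (hh.comp continuousOn_fst fun p hp => hp.1)

set_option maxHeartbeats 1000000 in
theorem double_contour {Ω : Set ℂ} (hΩ : IsOpen Ω) {ri ro r : ℝ} (hi0 : 0 < ri)
    (hi1 : ri < 1) (ho1 : 1 < ro) (hir : ri < r) (hro : r < ro)
    (hΩ1 : ∀ w : ℂ, ri ≤ ‖w‖ → ‖w‖ ≤ ro → w ∈ Ω)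
    (hΩ2 : ∀ w : ℂ, ‖w - 1‖ ≤ 1 / 2 → w ∈ Ω) (M : ℕ) {G h : ℂ → ℂ} (hG : DifferentiableOn ℂ G Ω)
    (hh : ∀ z ≠ 0, DifferentiableAt ℂ h z) :
    (∮ z in C(0, 3), ∮ w in C(1, 1 / 2), (z - w)⁻¹ * (((w - 1) ^ M)⁻¹ * G w * h z)) =
      (∮ z in C(0, r), ((∮ w in C(0, ro), (z - w)⁻¹ * (((w - 1) ^ M)⁻¹ * G w * h z)) -
        ∮ w in C(0, ri), (z - w)⁻¹ * (((w - 1) ^ M)⁻¹ * G w * h z))) +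
      2 * Real.pi * Complex.I * ∮ w in C(0, ro), ((w - 1) ^ M)⁻¹ * G w * h w := by
  set g : ℂ → ℂ := fun w => ((w - 1) ^ M)⁻¹ * G w with hg
  obtain ⟨Z, hZ3, hZo⟩ : ∃ Z, 3 < Z ∧ ro < Z := ⟨max 3 ro + 1, by linarith [le_max_left 3 ro], by linarith [le_max_right 3 ro]⟩
  have hhc : ∀ R, 0 < R → ContinuousOn h (sphere 0 R) := by
    intro R hR z hz
    refine (hh z ?_).continuousAt.continuousWithinAt
    rintro rfl; rw [mem_sphere, dist_self] at hz; exact hR.ne hz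
  have hinv : ∀ S : Set ℂ, (∀ w ∈ S, w ∈ Ω ∧ w ≠ 1) → ContinuousOn g S := by
    intro S hS
    refine ContinuousOn.mul (ContinuousOn.inv₀ (by fun_prop) fun w hw => pow_ne_zero _ (sub_ne_zero.2 (hS w hw).2))
      (hG.continuousOn.mono fun w hw => (hS w hw).1)
  have hg1 : ContinuousOn g (sphere 1 (1 / 2)) := by
    apply hinv
    intro w hw
    rw [mem_sphere, dist_eq_norm] at hw
    exact ⟨hΩ2 w hw.le, by rintro rfl; norm_num at hw⟩
  have hgR : ∀ R, ri ≤ R → R ≤ ro → R ≠ 1 → ContinuousOn g (sphere 0 R) := by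
    intro R h1 h2 h3
    apply hinv
    intro w hw
    rw [mem_sphere, dist_zero_right] at hw
    exact ⟨hΩ1 w (hw ▸ h1) (hw ▸ h2), by rintro rfl; simp at hw; exact h3 hw.symm⟩
  have hgo := hgR ro (by linarith) le_rfl ho1.ne'
  have hgi := hgR ri le_rfl (by linarith) hi1.ne
  have hw1 : ∀ w ∈ sphere (1 : ℂ) (1 / 2), ‖w‖ ≤ 3 / 2 := by
    intro w hw
    rw [mem_sphere, dist_eq_norm] at hw
    have := norm_add_le (w - 1) 1
    rw [sub_add_cancel, hw, norm_one] at this; linarith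
  have hns : ∀ R R', R ≠ R' → ∀ z ∈ sphere (0 : ℂ) R, ∀ w ∈ sphere (0 : ℂ) R', z ≠ w := by
    rintro R R' hR z hz w hw rfl
    rw [mem_sphere, dist_zero_right] at hz hw; exact hR (hz ▸ hw)
  have hns1 : ∀ R, 3 ≤ R → ∀ z ∈ sphere (0 : ℂ) R, ∀ w ∈ sphere (1 : ℂ) (1 / 2), z ≠ w := by
    rintro R hR z hz w hw rfl
    have := hw1 z hw
    rw [mem_sphere, dist_zero_right] at hz; linarith
  -- enlarge the outer contour
  have st1 : (∮ z in C(0, 3), ∮ w in C(1, 1 / 2), (z - w)⁻¹ * (g w * h z)) =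
      ∮ z in C(0, Z), ∮ w in C(1, 1 / 2), (z - w)⁻¹ * (g w * h z) := by
    rw [circleIntegral_swap (by norm_num) (by norm_num) (continuousOn_kernel hg1 (hhc 3 (by norm_num)) (hns1 3 le_rfl)),
      circleIntegral_swap (by linarith) (by norm_num) (continuousOn_kernel hg1 (hhc Z (by linarith)) (hns1 Z hZ3.le))]
    apply circleIntegral.integral_congr (by norm_num)
    intro w hw
    refine (circleIntegral_annulus (by norm_num) hZ3.le ?_).symm
    intro z hz _
    have := hw1 w hw
    have h0 : z - w ≠ 0 := by rw [sub_ne_zero]; rintro rfl; linarith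
    have h0' : z ≠ 0 := by rintro rfl; simp at hz; linarith
    have := hh z h0'
    fun_prop (disch := assumption)
  have st2 : ∀ z ∈ sphere (0 : ℂ) Z, (∮ w in C(1, 1 / 2), (z - w)⁻¹ * (g w * h z)) =
      (∮ w in C(0, ro), (z - w)⁻¹ * (g w * h z)) - ∮ w in C(0, ri), (z - w)⁻¹ * (g w * h z) := by
    intro z hz
    rw [mem_sphere, dist_zero_right] at hz
    have hO : IsOpen (Ω ∩ {z}ᶜ) := hΩ.inter isOpen_compl_singleton
    have hH : DifferentiableOn ℂ (fun w => (z - w)⁻¹ * (G w * h z)) (Ω ∩ {z}ᶜ) := by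
      refine DifferentiableOn.mul (DifferentiableOn.inv (by fun_prop) ?_) ?_
      · intro w hw h0; exact hw.2 (sub_eq_zero.1 h0).symm
      · exact (hG.mono Set.inter_subset_left).mul_const _
    have := circleIntegral_residue_one hO hi0 hi1 ho1 (fun w h1 h2 => ⟨hΩ1 w h1 h2, by rintro rfl; linarith⟩)
      (fun w h1 => ⟨hΩ2 w h1, by
        rintro rfl
        have := norm_add_le (w - 1) 1
        rw [sub_add_cancel, norm_one] at this; linarith⟩) M _ hH
    have e : ∀ w, (z - w)⁻¹ * (g w * h z) = ((w - 1) ^ M)⁻¹ * ((z - w)⁻¹ * (G w * h z)) := by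
      intro w; rw [hg]; ring
    simpa only [e] using this
  have ci : ∀ {R R' : ℝ}, 0 < R → 0 < R' → R ≠ R' → ContinuousOn g (sphere 0 R') →
      CircleIntegrable (fun z => ∮ w in C(0, R'), (z - w)⁻¹ * (g w * h z)) 0 R := by
    intro R R' hR hR' hne hgc
    apply ContinuousOn.circleIntegrable hR.le
    exact continuousOn_circleIntegral hR'.le (continuousOn_kernel hgc (hhc R hR) (hns R R' hne))
  have hr : 0 < r := by linarith
  rw [st1, circleIntegral.integral_congr (by linarith) st2,
    circleIntegral.integral_sub (ci (by linarith) (by linarith) hZo.ne' hgo) (ci (by linarith) hi0 (by linarith) hgi),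
    circleIntegral.integral_sub (ci hr (by linarith) hro.ne hgo) (ci hr hi0 hir.ne' hgi)]
  have pull : ∀ (R : ℝ) (w : ℂ), (∮ z in C(0, R), (z - w)⁻¹ * (g w * h z)) = g w * ∮ z in C(0, R), (z - w)⁻¹ * h z := by
    intro R w
    rw [← circleIntegral.integral_const_mul]
    congr 1; ext z; ring
  have st3 : (∮ z in C(0, Z), ∮ w in C(0, ro), (z - w)⁻¹ * (g w * h z)) =
      (∮ z in C(0, r), ∮ w in C(0, ro), (z - w)⁻¹ * (g w * h z)) + 2 * Real.pi * Complex.I * ∮ w in C(0, ro), g w * h w := by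
    have kZ := continuousOn_kernel hgo (hhc Z (by linarith)) (hns Z ro hZo.ne')
    have kr := continuousOn_kernel hgo (hhc r hr) (hns r ro hro.ne)
    rw [circleIntegral_swap (by linarith) (by linarith) kZ, circleIntegral_swap (by linarith) (by linarith) kr,
      ← circleIntegral.integral_const_mul, ← circleIntegral.integral_add]
    · apply circleIntegral.integral_congr (by linarith)
      intro w hw
      rw [mem_sphere, dist_zero_right] at hw
      beta_reduce
      rw [pull, pull, circleIntegral_pole_between hh hr (by linarith) (by linarith)]
      ring
    · apply ContinuousOn.circleIntegrable (by linarith)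
      apply continuousOn_circleIntegral (f := fun w z => (z - w)⁻¹ * (g w * h z)) hr.le
      have := kr.comp (f := Prod.swap) (s := sphere (0 : ℂ) ro ×ˢ sphere (0 : ℂ) r)
        continuous_swap.continuousOn fun p hp => ⟨hp.2, hp.1⟩
      simpa only [Function.comp_def, Function.uncurry_def, Prod.fst_swap, Prod.snd_swap] using this
    · apply ContinuousOn.circleIntegrable (by linarith)
      exact continuousOn_const.mul (hgo.mul (hhc ro (by linarith)))
  have st4 : (∮ z in C(0, Z), ∮ w in C(0, ri), (z - w)⁻¹ * (g w * h z)) =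
      ∮ z in C(0, r), ∮ w in C(0, ri), (z - w)⁻¹ * (g w * h z) := by
    have kZ := continuousOn_kernel hgi (hhc Z (by linarith)) (hns Z ri (by linarith))
    have kr := continuousOn_kernel hgi (hhc r hr) (hns r ri hir.ne')
    rw [circleIntegral_swap (by linarith) (by linarith) kZ, circleIntegral_swap (by linarith) (by linarith) kr]
    apply circleIntegral.integral_congr (by linarith)
    intro w hw
    rw [mem_sphere, dist_zero_right] at hw
    refine circleIntegral_annulus hr (by linarith) ?_
    intro z hz _
    have h0 : z - w ≠ 0 := by rw [sub_ne_zero]; rintro rfl; linarith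
    have h0' : z ≠ 0 := by rintro rfl; simp at hz; linarith
    have := hh z h0'
    fun_prop (disch := assumption)
  rw [st3, st4]; ring

end

theorem circleIntegral_inv (f : ℂ → ℂ) {ρ : ℝ} (hρ : 0 < ρ) :
    (∮ w in C(0, ρ⁻¹), f w) = ∮ s in C(0, ρ), f s⁻¹ * (s ^ 2)⁻¹ := by
  have hρ' : (ρ : ℂ) ≠ 0 := by exact_mod_cast hρ.ne'
  have e := intervalIntegral.integral_comp_sub_left (a := 0) (b := 2 * Real.pi)
    (fun θ => deriv (circleMap 0 ρ) θ • (f (circleMap 0 ρ θ)⁻¹ * (circleMap 0 ρ θ ^ 2)⁻¹)) (2 * Real.pi)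
  rw [sub_self, sub_zero] at e
  simp only [circleIntegral]
  rw [← e]
  congr 1; ext θ
  have h1 : circleMap 0 ρ (2 * Real.pi - θ) = ρ * (Complex.exp (θ * Complex.I))⁻¹ := by
    rw [circleMap, ← Complex.exp_neg]
    have : ((2 * Real.pi - θ : ℝ) : ℂ) * Complex.I = -(θ * Complex.I) + 2 * Real.pi * Complex.I := by
      push_cast; ring
    rw [this, Complex.exp_periodic]; simp
  have h2 : circleMap 0 ρ⁻¹ θ = (ρ : ℂ)⁻¹ * Complex.exp (θ * Complex.I) := by simp [circleMap]
  have h3 := Complex.exp_ne_zero (θ * Complex.I)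
  simp only [deriv_circleMap, h1, h2, smul_eq_mul, mul_inv, inv_inv]
  field_simp

theorem circleIntegral_eq_symm (f : ℂ → ℂ) (R : ℝ) :
    (∮ w in C(0, R), f w) = ∫ θ in -Real.pi..Real.pi, deriv (circleMap 0 R) θ • f (circleMap 0 R θ) := by
  have hp : Function.Periodic (fun θ => deriv (circleMap 0 R) θ • f (circleMap 0 R θ)) (2 * Real.pi) := by
    intro θ
    simp only [deriv_circleMap, periodic_circleMap (0 : ℂ) R θ]
  have := hp.intervalIntegral_add_eq 0 (-Real.pi)
  rw [zero_add] at this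
  rw [circleIntegral, this]
  congr 1; ring

/-- The preimage of `{|w| > 1}` minus the outer cut under the exponential, with both sides of the gap. -/
def expStrip (L : ℝ) : Set ℂ :=
  {ζ | 0 < ζ.re ∧ |ζ.im| ≤ Real.pi ∧ (|ζ.im| < Real.pi ∨ ζ.re < L)}

theorem convex_expStrip (L : ℝ) : Convex ℝ (expStrip L) := by
  rw [convex_iff_forall_pos]
  rintro x ⟨hx1, hx2, hx3⟩ y ⟨hy1, hy2, hy3⟩ a b ha hb hab
  have hre : (a • x + b • y).re = a * x.re + b * y.re := by simp
  have him : (a • x + b • y).im = a * x.im + b * y.im := by simp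
  have hb1 : b = 1 - a := by linarith
  simp only [expStrip, Set.mem_ofPred_eq, hre, him]
  rw [abs_le] at hx2 hy2
  have h1 := mul_pos ha hx1
  have h2 := mul_pos hb hy1
  have k1 : a * x.im + b * y.im ≤ Real.pi := by nlinarith [mul_le_mul_of_nonneg_left hx2.2 ha.le, mul_le_mul_of_nonneg_left hy2.2 hb.le]
  have k2 : -Real.pi ≤ a * x.im + b * y.im := by nlinarith [mul_le_mul_of_nonneg_left hx2.1 ha.le, mul_le_mul_of_nonneg_left hy2.1 hb.le]
  refine ⟨by linarith, abs_le.2 ⟨k2, k1⟩, ?_⟩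
  by_contra hcon
  push Not at hcon
  have h3 : Real.pi = |a * x.im + b * y.im| := le_antisymm hcon.1 (abs_le.2 ⟨k2, k1⟩)
  have : |x.im| = Real.pi ∧ |y.im| = Real.pi := by
    rcases abs_choice (a * x.im + b * y.im) with h4 | h4
    · rw [h4] at h3
      have h5 := mul_nonneg ha.le (sub_nonneg.2 hx2.2)
      have h6 := mul_nonneg hb.le (sub_nonneg.2 hy2.2)
      have h7 : a * (Real.pi - x.im) = 0 := by subst hb1; linarith
      have h8 : b * (Real.pi - y.im) = 0 := by subst hb1; linarith
      have h9 : x.im = Real.pi := by rcases mul_eq_zero.1 h7 with h | h <;> linarith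
      have h10 : y.im = Real.pi := by rcases mul_eq_zero.1 h8 with h | h <;> linarith
      rw [h9, h10, abs_of_pos Real.pi_pos]; simp
    · rw [h4] at h3
      have h5 := mul_nonneg ha.le (sub_nonneg.2 hx2.1)
      have h6 := mul_nonneg hb.le (sub_nonneg.2 hy2.1)
      have h7 : a * (x.im - -Real.pi) = 0 := by subst hb1; linarith
      have h8 : b * (y.im - -Real.pi) = 0 := by subst hb1; linarith
      have h9 : x.im = -Real.pi := by rcases mul_eq_zero.1 h7 with h | h <;> linarith
      have h10 : y.im = -Real.pi := by rcases mul_eq_zero.1 h8 with h | h <;> linarith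
      rw [h9, h10, abs_neg, abs_of_pos Real.pi_pos]; simp
  rw [this.1] at hx3; rw [this.2] at hy3
  have hx4 := hx3.resolve_left (lt_irrefl _)
  have hy4 := hy3.resolve_left (lt_irrefl _)
  have := hcon.2
  subst hb1
  nlinarith [mul_lt_mul_of_pos_left hx4 ha, mul_lt_mul_of_pos_left hy4 hb]

namespace IsBranch

variable {α β : ℝ} {sq : ℂ → ℂ}

theorem exp_notMem_cuts (h : IsBranch α β sq) {ζ : ℂ} (hζ : ζ ∈ expStrip (2 * Real.log α)) :
    1 < ‖Complex.exp ζ‖ ∧ Complex.exp ζ ∉ cuts α β := by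
  obtain ⟨h1, h2, h3⟩ := hζ
  have hn : ‖Complex.exp ζ‖ = Real.exp ζ.re := Complex.norm_exp ζ
  have hgt : 1 < ‖Complex.exp ζ‖ := by rw [hn]; exact Real.one_lt_exp_iff.2 h1
  refine ⟨hgt, ?_⟩
  rintro ⟨t, ht, ht'⟩
  have hα := h.one_lt
  have hb := h.beta_lt
  have hb0 := h.beta_pos
  rw [ht, Complex.norm_real, Real.norm_eq_abs] at hgt
  have htn : t ≤ -α ^ 2 := by
    rcases ht' with h4 | h4
    · exact h4
    · exfalso; rw [abs_of_nonpos h4.2] at hgt; nlinarith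
  have htneg : t < 0 := by nlinarith
  have him := congrArg Complex.im ht
  have hre := congrArg Complex.re ht
  rw [Complex.exp_im, Complex.ofReal_im] at him
  rw [Complex.exp_re, Complex.ofReal_re] at hre
  have hpos := Real.exp_pos ζ.re
  rcases h3 with h3 | h3
  · have hsin : Real.sin ζ.im = 0 := by
      rcases mul_eq_zero.1 him with h5 | h5
      · linarith
      · exact h5
    rw [abs_lt] at h3
    have : ζ.im = 0 := (Real.sin_eq_zero_iff_of_lt_of_lt h3.1 h3.2).1 hsin
    rw [this, Real.cos_zero, mul_one] at hre; linarith
  · have h5 : Real.exp ζ.re < α ^ 2 := by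
      have : α ^ 2 = Real.exp (2 * Real.log α) := by
        rw [mul_comm, Real.exp_mul, Real.exp_log (by linarith)]; norm_cast
      rw [this]; exact Real.exp_lt_exp.2 h3
    rw [ht, Complex.norm_real, Real.norm_eq_abs, abs_of_neg htneg] at hn
    linarith

theorem im_slp (h : IsBranch α β sq) {z : ℂ} (hz : z ∉ cuts α β) :
    2 * (slp sq z).re * (slp sq z).im = z.im * (1 - 1 / Complex.normSq z) := by
  have h0 := ne_zero_of_notMem_cuts hz
  have h1 := h.slp_sq hz
  have e : 4 * (hs α β : ℂ) ^ 2 + (z - 1) ^ 2 / z = ((4 * hs α β ^ 2 - 2 : ℝ) : ℂ) + (z + z⁻¹) := by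
    push_cast; field_simp; ring
  rw [e] at h1
  have him := congrArg Complex.im h1
  rw [Complex.add_im, Complex.ofReal_im, Complex.add_im, Complex.inv_im, pow_two, Complex.mul_im] at him
  rw [mul_sub, mul_one_div]
  linear_combination him

theorem om_im (h : IsBranch α β sq) {z : ℂ} (hz : z ∉ cuts α β) (h1 : z ≠ 1) :
    (om α β sq z).im * Complex.normSq (slp sq z - 2 * (hs α β : ℂ)) = -(4 * hs α β * (slp sq z).im) := by
  have h3 := Complex.normSq_pos.2 (h.slp_sub_ne hz h1)
  have e : om α β sq z = 1 + ((4 * hs α β : ℝ) : ℂ) * (slp sq z - 2 * (hs α β : ℂ))⁻¹ := by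
    have := h.om_sub_one hz h1
    rw [sub_eq_iff_eq_add] at this
    rw [this]; push_cast; ring
  rw [e, Complex.add_im, Complex.im_ofReal_mul, Complex.inv_im]
  simp
  field_simp

theorem om_im_neg (h : IsBranch α β sq) {z : ℂ} (hz : z ∉ cuts α β) (hn : 1 < ‖z‖) (hi : 0 < z.im) :
    (om α β sq z).im < 0 := by
  have h1 : z ≠ 1 := by rintro rfl; simp at hn
  have h3 := Complex.normSq_pos.2 (h.slp_sub_ne hz h1)
  have h4 := h.om_im hz h1
  have h5 := h.im_slp hz
  have h6 := h.slp_re_pos hz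
  have h7 := h.one_lt_hs
  have h8 : 0 < 1 - 1 / Complex.normSq z := by
    rw [Complex.normSq_eq_norm_sq, sub_pos, div_lt_one (by positivity)]; nlinarith
  have h9 : 0 < (slp sq z).im := by
    have := mul_pos hi h8
    rw [← h5] at this
    exact pos_of_mul_pos_right this (by positivity)
  by_contra hcon
  push Not at hcon
  have := mul_nonneg hcon h3.le
  rw [h4] at this
  have : 0 < hs α β * (slp sq z).im := by positivity
  linarith

theorem om_im_pos (h : IsBranch α β sq) {z : ℂ} (hz : z ∉ cuts α β) (hn : 1 < ‖z‖) (hi : z.im < 0) :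
    0 < (om α β sq z).im := by
  have h1 : z ≠ 1 := by rintro rfl; simp at hn
  have h3 := Complex.normSq_pos.2 (h.slp_sub_ne hz h1)
  have h4 := h.om_im hz h1
  have h5 := h.im_slp hz
  have h6 := h.slp_re_pos hz
  have h7 := h.one_lt_hs
  have h8 : 0 < 1 - 1 / Complex.normSq z := by
    rw [Complex.normSq_eq_norm_sq, sub_pos, div_lt_one (by positivity)]; nlinarith
  have h9 : (slp sq z).im < 0 := by
    have := mul_neg_of_neg_of_pos hi h8
    rw [← h5] at this
    by_contra hc; push Not at hc
    have : 0 ≤ 2 * (slp sq z).re * (slp sq z).im := by positivity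
    linarith
  by_contra hcon
  push Not at hcon
  have := mul_nonneg (neg_nonneg.2 hcon) h3.le
  have : 0 < hs α β * (-(slp sq z).im) := mul_pos (by linarith) (by linarith)
  linarith

theorem om_mem_slitPlane (h : IsBranch α β sq) {z : ℂ} (hz : z ∈ Complex.slitPlane) (hn : 1 < ‖z‖) :
    om α β sq z ∈ Complex.slitPlane := by
  have hc : z ∉ cuts α β := slitPlane_subset_compl_cuts hz
  have h1 : z ≠ 1 := by rintro rfl; simp at hn
  rcases lt_trichotomy z.im 0 with hi | hi | hi
  · exact Complex.mem_slitPlane_iff.2 (Or.inr (h.om_im_pos hc hn hi).ne')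
  · have hre : 0 < z.re := by
      rcases Complex.mem_slitPlane_iff.1 hz with h2 | h2
      · exact h2
      · exact absurd hi h2
    have h5 := h.im_slp hc
    have h6 := h.slp_re_pos hc
    rw [hi, zero_mul] at h5
    have h7 : (slp sq z).im = 0 := by
      rcases mul_eq_zero.1 h5 with h8 | h8
      · linarith
      · exact h8
    have hzr : z = (z.re : ℂ) := Complex.ext (by simp) (by simp [hi])
    have hsr : slp sq z = ((slp sq z).re : ℂ) := Complex.ext (by simp) (by simp [h7])
    have h9 := h.slp_sub_mul hc
    have hre1 : z.re ≠ 1 := by intro h10; rw [h10] at hzr; exact h1 (by simpa using hzr)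
    set x := z.re
    set s := (slp sq z).re
    rw [hsr, hzr] at h9
    have h10 : (s + 2 * hs α β) * (s - 2 * hs α β) = (x - 1) ^ 2 / x := by exact_mod_cast h9
    have h11 : 0 < (x - 1) ^ 2 / x := div_pos (by have := sub_ne_zero.2 hre1; positivity) hre
    have h12 := h.one_lt_hs
    have h13 : 0 < s - 2 * hs α β := by
      rw [← h10] at h11; exact pos_of_mul_pos_right h11 (by linarith)
    have e : om α β sq z = (((s + 2 * hs α β) / (s - 2 * hs α β) : ℝ) : ℂ) := by
      rw [om, hsr]; push_cast; rfl
    rw [e, Complex.ofReal_mem_slitPlane]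
    positivity
  · exact Complex.mem_slitPlane_iff.2 (Or.inr (h.om_im_neg hc hn hi).ne)

end IsBranch

/-- Half the value of `√(z(z+α²)(z+β²))/z` at `z = -t` in the gap `(-α²,-β²)`. -/
noncomputable def gapv (α β t : ℝ) : ℝ := √(hs α β ^ 2 - (t + 1) ^ 2 / (4 * t))

namespace IsBranch

variable {α β : ℝ} {sq : ℂ → ℂ}

theorem gapv_arg_pos (h : IsBranch α β sq) {t : ℝ} (h1 : β ^ 2 < t) (h2 : t < α ^ 2) :
    0 < hs α β ^ 2 - (t + 1) ^ 2 / (4 * t) := by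
  have hb := h.beta_pos
  have ht : 0 < t := by nlinarith
  have h4 := h.four_hs_sq
  have hm : α ^ 2 * β ^ 2 = 1 := by rw [← mul_pow, h.mul_eq, one_pow]
  have : hs α β ^ 2 - (t + 1) ^ 2 / (4 * t) = (α ^ 2 - t) * (t - β ^ 2) / (4 * t) := by
    field_simp; nlinarith
  rw [this]
  exact div_pos (mul_pos (by linarith) (by linarith)) (by linarith)

theorem gapv_pos (h : IsBranch α β sq) {t : ℝ} (h1 : β ^ 2 < t) (h2 : t < α ^ 2) :
    0 < gapv α β t := Real.sqrt_pos.2 (h.gapv_arg_pos h1 h2)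

theorem gapv_sq (h : IsBranch α β sq) {t : ℝ} (h1 : β ^ 2 < t) (h2 : t < α ^ 2) :
    gapv α β t ^ 2 = hs α β ^ 2 - (t + 1) ^ 2 / (4 * t) := Real.sq_sqrt (h.gapv_arg_pos h1 h2).le

theorem slp_gap (h : IsBranch α β sq) {t : ℝ} (h1 : β ^ 2 < t) (h2 : t < α ^ 2) :
    ((-t : ℝ) : ℂ) ∉ cuts α β ∧ slp sq ((-t : ℝ) : ℂ) = ((2 * gapv α β t : ℝ) : ℂ) := by
  have hb := h.beta_pos
  have ht : 0 < t := by nlinarith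
  have h0 : ((-t : ℝ) : ℂ) ≠ 0 := by exact_mod_cast (neg_ne_zero.2 ht.ne')
  refine h.slp_unique h0 ?_ ?_
  · rw [Complex.ofReal_re]; have := h.gapv_pos h1 h2; positivity
  · have e := h.gapv_sq h1 h2
    have : (2 * gapv α β t) ^ 2 = 4 * hs α β ^ 2 + (-t - 1) ^ 2 / (-t) := by
      rw [mul_pow, e]; field_simp; ring
    exact_mod_cast this

theorem om_gap (h : IsBranch α β sq) {t : ℝ} (h1 : β ^ 2 < t) (h2 : t < α ^ 2) :
    om α β sq ((-t : ℝ) : ℂ) =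
      ((-((hs α β + gapv α β t) / (hs α β - gapv α β t)) : ℝ) : ℂ) := by
  have hg := h.gapv_pos h1 h2
  have hb := h.beta_pos
  have ht : 0 < t := by nlinarith
  have hgc : gapv α β t < hs α β := by
    have := h.gapv_sq h1 h2
    have h3 : 0 < (t + 1) ^ 2 / (4 * t) := by positivity
    have h4 := h.one_lt_hs
    nlinarith
  rw [om, (h.slp_gap h1 h2).2, ← Complex.ofReal_ofNat, ← Complex.ofReal_mul, ← Complex.ofReal_add,
    ← Complex.ofReal_sub, ← Complex.ofReal_div]
  congr 1
  have h5 : hs α β - gapv α β t ≠ 0 := by linarith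
  rw [show 2 * gapv α β t + 2 * hs α β = 2 * (hs α β + gapv α β t) by ring,
    show 2 * gapv α β t - 2 * hs α β = 2 * (-(hs α β - gapv α β t)) by ring,
    mul_div_mul_left _ _ two_ne_zero, div_neg]

theorem gapv_lt (h : IsBranch α β sq) {t : ℝ} (h1 : β ^ 2 < t) (h2 : t < α ^ 2) :
    gapv α β t < hs α β := by
  have hb := h.beta_pos
  have ht : 0 < t := by nlinarith
  have hg := h.gapv_pos h1 h2
  have := h.gapv_sq h1 h2
  have h3 : 0 < (t + 1) ^ 2 / (4 * t) := by positivity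
  have h4 := h.one_lt_hs
  nlinarith

theorem dual_radius (h : IsBranch α β sq) {T : ℝ} (h1 : 1 < T) (h2 : T < α ^ 2) :
    ∃ R : ℝ, R = (hs α β + gapv α β T) / (hs α β - gapv α β T) ∧ 1 < R ∧ R < α ^ 2 ∧
      om α β sq ((-R : ℝ) : ℂ) = ((-T : ℝ) : ℂ) := by
  have hb0 := h.beta_pos
  have hb : β ^ 2 < T := by have := h.beta_lt; nlinarith
  have hg := h.gapv_pos hb h2
  have hgc := h.gapv_lt hb h2
  have hc := (h.slp_gap hb h2).1
  have hn : 1 < ‖((-T : ℝ) : ℂ)‖ := by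
    rw [Complex.norm_real, Real.norm_eq_abs, abs_neg, abs_of_pos (by linarith)]; exact h1
  have h1R : 1 < (hs α β + gapv α β T) / (hs α β - gapv α β T) := by
    rw [one_lt_div (by linarith)]; linarith
  refine ⟨_, rfl, h1R, ?_, ?_⟩
  · by_contra hcon
    push Not at hcon
    have := (h.om_dual hc hn).1
    rw [h.om_gap hb h2] at this
    exact this ⟨_, rfl, Or.inl (by linarith)⟩
  · rw [← h.om_gap hb h2, h.om_om hc hn]

end IsBranch

/-- The derivative of `om`. -/
noncomputable def omd (α β : ℝ) (sq : ℂ → ℂ) (z : ℂ) : ℂ :=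
  -(2 * (hs α β : ℂ) * (z + 1) / (z * slp sq z * (z - 1))) * om α β sq z

theorem dv_le {z : ℂ} (hz : z ≠ 0) : dv z ≤ (‖z‖ + 1) ^ 2 / (4 * ‖z‖) := by
  have h0 := norm_pos_iff.2 hz
  have h1 : ‖z - 1‖ ≤ ‖z‖ + 1 := by simpa using norm_sub_le z 1
  unfold dv; gcongr

namespace IsBranch

variable {α β : ℝ} {sq : ℂ → ℂ}

theorem notMem_cuts_of_norm (h : IsBranch α β sq) {z : ℂ} (h1 : β ^ 2 < ‖z‖) (h2 : ‖z‖ < α ^ 2) :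
    z ∉ cuts α β := by
  rintro ⟨t, rfl, ht⟩
  rw [Complex.norm_real, Real.norm_eq_abs] at h1 h2
  have hb := h.beta_pos
  rcases ht with ht | ht
  · rw [abs_of_nonpos (by nlinarith [sq_nonneg α])] at h2; linarith
  · rw [abs_of_nonpos ht.2] at h1; linarith

theorem continuousAt_slp (h : IsBranch α β sq) {z : ℂ} (hz : z ∉ cuts α β) :
    ContinuousAt (slp sq) z :=
  (h.slp_hasDerivAt hz).continuousAt

theorem slp_ne (h : IsBranch α β sq) {z : ℂ} (hz : z ∉ cuts α β) : slp sq z ≠ 0 := by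
  intro h0; apply h.slp_re_ne hz; rw [h0]; rfl

theorem continuousAt_omd (h : IsBranch α β sq) {z : ℂ} (hz : z ∉ cuts α β) (h1 : z ≠ 1) :
    ContinuousAt (omd α β sq) z := by
  have h2 := (h.om_hasDerivAt hz h1).continuousAt
  have h3 := h.continuousAt_slp hz
  have h4 : z * slp sq z * (z - 1) ≠ 0 :=
    mul_ne_zero (mul_ne_zero (ne_zero_of_notMem_cuts hz) (h.slp_ne hz)) (sub_ne_zero.2 h1)
  unfold omd
  fun_prop (disch := assumption)

theorem le_norm_om (h : IsBranch α β sq) {T R : ℝ} (hT : 1 < T) (hR : 1 < R)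
    (hom : om α β sq ((-R : ℝ) : ℂ) = ((-T : ℝ) : ℂ)) (hRc : ((-R : ℝ) : ℂ) ∉ cuts α β) {l : ℂ}
    (hl : l ∉ cuts α β) (hlR : ‖l‖ = R) : T ≤ ‖om α β sq l‖ := by
  have hn : ∀ x : ℝ, 0 < x → dv ((-x : ℝ) : ℂ) = (x + 1) ^ 2 / (4 * x) := by
    intro x hx
    have e : ((-x : ℝ) : ℂ) - 1 = ((-(x + 1) : ℝ) : ℂ) := by push_cast; ring
    rw [dv, e, Complex.norm_real, Complex.norm_real, Real.norm_eq_abs, Real.norm_eq_abs, abs_neg,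
      abs_neg, abs_of_pos hx, abs_of_pos (by linarith)]
  have hl1 : l ≠ 1 := by rintro rfl; rw [norm_one] at hlR; linarith
  have hR1 : ((-R : ℝ) : ℂ) ≠ 1 := by
    intro e; have := congrArg Complex.re e; simp at this; linarith
  have k1 := h.dv_mul_dv hl hl1
  have k2 := h.dv_mul_dv hRc hR1
  rw [hom, hn T (by linarith), hn R (by linarith)] at k2
  have k3 := dv_le (ne_zero_of_notMem_cuts hl)
  rw [hlR] at k3
  have k4 := dv_le (h.om_ne_zero hl hl1)
  have hw := h.one_lt_norm_om hl hl1
  set t := ‖om α β sq l‖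
  have hdR : 0 < (R + 1) ^ 2 / (4 * R) := by positivity
  have hdT : 0 < (T + 1) ^ 2 / (4 * T) := by positivity
  have hdl : 0 ≤ dv l := by unfold dv; positivity
  have k5 : (T + 1) ^ 2 / (4 * T) ≤ (t + 1) ^ 2 / (4 * t) := by
    refine le_trans ?_ k4
    by_contra hcon
    push Not at hcon
    have h0 : 0 < dv l * ((T + 1) ^ 2 / (4 * T)) := by
      by_contra h5
      have : dv l = 0 := by
        rcases hdl.eq_or_lt with h6 | h6
        · exact h6.symm
        · exact absurd (mul_pos h6 hdT) h5
      rw [this, mul_zero] at k1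
      have := mul_pos hdT hdR
      linarith
    have h6 : 0 < dv l := by
      rcases hdl.eq_or_lt with h6 | h6
      · rw [← h6] at h0; simp at h0
      · exact h6
    nlinarith [mul_lt_mul_of_pos_right hcon h6, mul_le_mul_of_nonneg_left k3 hdT.le]
  rw [div_le_div_iff₀ (by linarith) (by linarith)] at k5
  by_contra hcon
  push Not at hcon
  nlinarith [mul_pos (sub_pos.2 hcon) (sub_pos.2 (one_lt_mul hT.le hw))]

/-- The change of variables `w = om ℓ` for contour integrals: the curve `om (C(0,R))` is
homotopic to `C(0,T)` reversed. -/
theorem circleIntegral_comp_om (h : IsBranch α β sq) {f : ℂ → ℂ}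
    {r₀ : ℝ} (hr₀ : 1 ≤ r₀) (hf : DifferentiableOn ℂ f ({w | r₀ < ‖w‖} ∩ (cuts α β)ᶜ)) {T R : ℝ}
    (hT1 : r₀ < T) (hT2 : T < α ^ 2) (hR1 : 1 < R) (hR2 : R < α ^ 2)
    (hom : om α β sq ((-R : ℝ) : ℂ) = ((-T : ℝ) : ℂ)) :
    (∮ w in C(0, T), f w) = -∮ l in C(0, R), f (om α β sq l) * omd α β sq l := by
  have hb0 := h.beta_pos
  have hb1 : β ^ 2 < 1 := by have := h.beta_lt; nlinarith
  have hα := h.one_lt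
  set L := 2 * Real.log α with hL
  set S := expStrip L ∩ {ζ | Real.log r₀ < ζ.re} with hS
  have hOpen : IsOpen ({w : ℂ | r₀ < ‖w‖} ∩ (cuts α β)ᶜ) :=
    (isOpen_lt continuous_const continuous_norm).inter isOpen_compl_cuts
  have hexp : ∀ ζ ∈ S, Complex.exp ζ ∈ {w : ℂ | r₀ < ‖w‖} ∩ (cuts α β)ᶜ := fun ζ hζ =>
    ⟨by
      have h1 : Real.log r₀ < ζ.re := hζ.2
      rwa [Set.mem_ofPred_eq, Complex.norm_exp, ← Real.log_lt_iff_lt_exp (by linarith)],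
      (h.exp_notMem_cuts hζ.1).2⟩
  have hg : DifferentiableOn ℂ (fun ζ => f (Complex.exp ζ) * Complex.exp ζ) S := by
    intro ζ hζ
    have h1 : DifferentiableAt ℂ f (Complex.exp ζ) := (hf.differentiableAt (hOpen.mem_nhds (hexp ζ hζ)))
    exact ((h1.comp ζ Complex.differentiableAt_exp).mul Complex.differentiableAt_exp).differentiableWithinAt
  obtain ⟨P, hP⟩ := ((convex_expStrip L).inter (convex_halfSpace_re_gt _)).exists_forall_hasDerivWithinAt hg
  have hαL : α ^ 2 = Real.exp L := by
    rw [hL, mul_comm, Real.exp_mul, Real.exp_log (by linarith)]; norm_cast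
  have hlogT : Real.log T < L := by
    rw [Real.log_lt_iff_lt_exp (by linarith), ← hαL]; exact hT2
  have hT0 : 1 < T := hr₀.trans_lt hT1
  have hlogT0 : 0 < Real.log T := Real.log_pos hT0
  have hlogr : Real.log r₀ < Real.log T := Real.log_lt_log (by linarith) hT1
  have hTexp : (T : ℂ) = Complex.exp (Real.log T) := by
    rw [← Complex.ofReal_exp, Real.exp_log (by linarith)]
  have hπ := Real.pi_pos
  -- the outer circle
  have hI1 : (∮ w in C(0, T), f w) =
      P (Real.log T + Real.pi * Complex.I) - P (Real.log T - Real.pi * Complex.I) := by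
    rw [circleIntegral_eq_symm]
    have hmem : Set.MapsTo (fun θ : ℝ => (Real.log T : ℂ) + θ * Complex.I) (Set.Icc (-Real.pi) Real.pi) S := by
      intro θ hθ
      refine ⟨⟨?_, ?_, Or.inr ?_⟩, ?_⟩
      · simpa using hlogT0
      · simpa using abs_le.2 hθ
      · simpa using hlogT
      · simpa using hlogr
    have hd : ∀ θ : ℝ, HasDerivAt (fun θ : ℝ => (Real.log T : ℂ) + θ * Complex.I) Complex.I θ := by
      intro θ
      have := ((Complex.ofRealCLM.hasDerivAt (x := θ)).mul_const Complex.I).const_add (Real.log T : ℂ)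
      simpa using this
    have hc : ∀ θ : ℝ, Complex.exp (Real.log T + θ * Complex.I) = circleMap 0 T θ := by
      intro θ; rw [Complex.exp_add, ← hTexp]; simp [circleMap]
    have hder : ∀ θ ∈ Set.Icc (-Real.pi) Real.pi, HasDerivWithinAt
        (P ∘ fun θ : ℝ => (Real.log T : ℂ) + θ * Complex.I)
        (deriv (circleMap 0 T) θ • f (circleMap 0 T θ)) (Set.Icc (-Real.pi) Real.pi) θ := by
      intro θ hθ
      have := HasDerivWithinAt.scomp θ (hP _ (hmem hθ)) (hd θ).hasDerivWithinAt hmem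
      refine this.congr_deriv ?_
      simp only [hc, deriv_circleMap, smul_eq_mul]; ring
    have hint : IntervalIntegrable (fun θ => deriv (circleMap 0 T) θ • f (circleMap 0 T θ))
        MeasureTheory.volume (-Real.pi) Real.pi := by
      apply Continuous.intervalIntegrable
      simp only [deriv_circleMap, smul_eq_mul]
      have hfc : Continuous fun θ => f (circleMap 0 T θ) := by
        rw [continuous_iff_continuousAt]
        intro θ
        have hn : ‖circleMap 0 T θ‖ = T := by simp [abs_of_pos (by linarith : 0 < T)]
        have : ContinuousAt f (circleMap 0 T θ) :=
          (hf.differentiableAt (hOpen.mem_nhds ⟨by simpa [hn] using hT1,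
            h.notMem_cuts_of_norm (by rw [hn]; linarith) (by rw [hn]; linarith)⟩)).continuousAt
        exact this.comp (f := circleMap 0 T) (continuous_circleMap 0 T).continuousAt
      exact ((continuous_circleMap 0 T).mul continuous_const).mul hfc
    rw [intervalIntegral.integral_eq_sub_of_hasDerivAt_of_le (by linarith)
      (fun θ hθ => (hder θ hθ).continuousWithinAt)
      (fun θ hθ => (hder θ ⟨hθ.1.le, hθ.2.le⟩).hasDerivAt (Icc_mem_nhds hθ.1 hθ.2)) hint]
    simp only [Function.comp_apply, Complex.ofReal_neg, neg_mul, sub_eq_add_neg]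
  -- the image of the inner circle
  have hI2 : (∮ l in C(0, R), f (om α β sq l) * omd α β sq l) =
      P (Real.log T - Real.pi * Complex.I) - P (Real.log T + Real.pi * Complex.I) := by
    rw [circleIntegral_eq_symm]
    have hnR : ∀ θ, ‖circleMap 0 R θ‖ = R := fun θ => by simp [abs_of_pos (by linarith : 0 < R)]
    have hRc : ∀ θ, circleMap 0 R θ ∉ cuts α β := fun θ =>
      h.notMem_cuts_of_norm (by rw [hnR]; linarith) (by rw [hnR]; linarith)
    have hRc' : ((-R : ℝ) : ℂ) ∉ cuts α β := h.notMem_cuts_of_norm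
      (by rw [Complex.norm_real, Real.norm_eq_abs, abs_neg, abs_of_pos (by linarith)]; linarith)
      (by rw [Complex.norm_real, Real.norm_eq_abs, abs_neg, abs_of_pos (by linarith)]; linarith)
    have hR1' : ∀ θ, circleMap 0 R θ ≠ 1 := by
      intro θ h1; have := hnR θ; rw [h1, norm_one] at this; linarith
    have hRgt : ∀ θ, 1 < ‖circleMap 0 R θ‖ := fun θ => by rw [hnR]; exact hR1
    have hom1 : ∀ θ, om α β sq (circleMap 0 R θ) ∈ {w : ℂ | r₀ < ‖w‖} ∩ (cuts α β)ᶜ := fun θ =>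
      ⟨hT1.trans_le (h.le_norm_om (by linarith) hR1 hom hRc' (hRc θ) (hnR θ)), (h.om_dual (hRc θ) (hRgt θ)).1⟩
    have hγd : ∀ θ, HasDerivAt (fun θ => om α β sq (circleMap 0 R θ))
        (omd α β sq (circleMap 0 R θ) * deriv (circleMap 0 R) θ) θ := by
      intro θ
      have := HasDerivAt.scomp θ (h.om_hasDerivAt (hRc θ) (hR1' θ)) (hasDerivAt_circleMap 0 R θ)
      rw [deriv_circleMap]
      refine this.congr_deriv ?_
      simp only [smul_eq_mul, omd]; ring
    have hslit : ∀ θ ∈ Set.Ioo (-Real.pi) Real.pi, circleMap 0 R θ ∈ Complex.slitPlane := by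
      intro θ hθ
      rw [Complex.mem_slitPlane_iff]
      by_cases h0 : θ = 0
      · left; subst h0; simp [circleMap]; linarith
      · right
        have e : (circleMap 0 R θ).im = R * Real.sin θ := by
          simp [circleMap, Complex.exp_ofReal_mul_I_im]
        rw [e]
        refine mul_ne_zero (by linarith) fun hsin => h0 ?_
        exact (Real.sin_eq_zero_iff_of_lt_of_lt hθ.1 hθ.2).1 hsin
    have hint : IntervalIntegrable (fun θ => deriv (circleMap 0 R) θ •
        (f (om α β sq (circleMap 0 R θ)) * omd α β sq (circleMap 0 R θ)))
        MeasureTheory.volume (-Real.pi) Real.pi := by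
      apply Continuous.intervalIntegrable
      simp only [deriv_circleMap, smul_eq_mul]
      have hfc : Continuous fun θ => f (om α β sq (circleMap 0 R θ)) := by
        rw [continuous_iff_continuousAt]
        intro θ
        have : ContinuousAt f (om α β sq (circleMap 0 R θ)) :=
          (hf.differentiableAt (hOpen.mem_nhds (hom1 θ))).continuousAt
        exact this.comp (f := fun θ => om α β sq (circleMap 0 R θ)) (hγd θ).continuousAt
      have hdc : Continuous fun θ => omd α β sq (circleMap 0 R θ) := by
        rw [continuous_iff_continuousAt]
        intro θ
        exact (h.continuousAt_omd (hRc θ) (hR1' θ)).comp (f := circleMap 0 R) (continuous_circleMap 0 R).continuousAt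
      exact ((continuous_circleMap 0 R).mul continuous_const).mul (hfc.mul hdc)
    have hlog : ∀ θ ∈ Set.Ioo (-Real.pi) Real.pi, Complex.log (om α β sq (circleMap 0 R θ)) ∈ S := by
      intro θ hθ
      have hs := h.om_mem_slitPlane (hslit θ hθ) (hRgt θ)
      have harg := Complex.mem_slitPlane_iff_arg.1 hs
      have him : |(Complex.log (om α β sq (circleMap 0 R θ))).im| < Real.pi := by
        rw [Complex.log_im, abs_lt]
        exact ⟨Complex.neg_pi_lt_arg _, lt_of_le_of_ne (Complex.arg_le_pi _) harg.1⟩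
      refine ⟨⟨?_, him.le, Or.inl him⟩, ?_⟩
      · rw [Complex.log_re]; exact Real.log_pos (hr₀.trans_lt (hom1 θ).1)
      · rw [Set.mem_ofPred_eq, Complex.log_re]; exact Real.log_lt_log (by linarith) (hom1 θ).1
    have hder : ∀ θ ∈ Set.Ioo (-Real.pi) Real.pi, HasDerivAt
        (P ∘ fun θ => Complex.log (om α β sq (circleMap 0 R θ)))
        (deriv (circleMap 0 R) θ • (f (om α β sq (circleMap 0 R θ)) * omd α β sq (circleMap 0 R θ))) θ := by
      intro θ hθ
      have hs := h.om_mem_slitPlane (hslit θ hθ) (hRgt θ)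
      have := HasDerivWithinAt.scomp θ (hP _ (hlog θ hθ)) ((hγd θ).clog_real hs).hasDerivWithinAt hlog
      have h0 : om α β sq (circleMap 0 R θ) ≠ 0 := h.om_ne_zero (hRc θ) (hR1' θ)
      refine (this.hasDerivAt (Ioo_mem_nhds hθ.1 hθ.2)).congr_deriv ?_
      rw [Complex.exp_log h0, smul_eq_mul, smul_eq_mul]
      field_simp
    have hcont : ContinuousAt (fun θ => om α β sq (circleMap 0 R θ)) Real.pi := (hγd _).continuousAt
    have hcont' : ContinuousAt (fun θ => om α β sq (circleMap 0 R θ)) (-Real.pi) := (hγd _).continuousAt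
    have e1 : om α β sq (circleMap 0 R Real.pi) = ((-T : ℝ) : ℂ) := by
      rw [← hom]; congr 1; simp [circleMap]
    have e2 : om α β sq (circleMap 0 R (-Real.pi)) = ((-T : ℝ) : ℂ) := by
      rw [← hom]; congr 1; simp [circleMap, Complex.exp_neg]
    have hre : ((-T : ℝ) : ℂ).re < 0 := by rw [Complex.ofReal_re]; linarith
    have him0 : ((-T : ℝ) : ℂ).im = 0 := Complex.ofReal_im _
    have hnT : ‖((-T : ℝ) : ℂ)‖ = T := by
      rw [Complex.norm_real, Real.norm_eq_abs, abs_neg, abs_of_pos (by linarith)]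
    have him : ∀ θ, (circleMap 0 R θ).im = R * Real.sin θ := by
      intro θ; simp [circleMap, Complex.exp_ofReal_mul_I_im]
    have hmemIoo_pi : Set.Ioo (-Real.pi) Real.pi ∈ nhdsWithin Real.pi (Set.Iio Real.pi) :=
      Ioo_mem_nhdsLT (by linarith)
    have hmemIoo_npi : Set.Ioo (-Real.pi) Real.pi ∈ nhdsWithin (-Real.pi) (Set.Ioi (-Real.pi)) :=
      Ioo_mem_nhdsGT (by linarith)
    have t1 : Tendsto (fun θ => Complex.log (om α β sq (circleMap 0 R θ)))
        (nhdsWithin Real.pi (Set.Iio Real.pi)) (nhdsWithin (Real.log T - Real.pi * Complex.I) S) := by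
      rw [tendsto_nhdsWithin_iff]
      refine ⟨?_, mem_of_superset hmemIoo_pi hlog⟩
      have k := Complex.tendsto_log_nhdsWithin_im_neg_of_re_neg_of_im_zero hre him0
      rw [hnT] at k
      refine k.comp (tendsto_nhdsWithin_iff.2 ⟨?_, ?_⟩)
      · rw [← e1]; exact hcont.tendsto.mono_left nhdsWithin_le_nhds
      · filter_upwards [Ioo_mem_nhdsLT hπ] with θ hθ
        exact h.om_im_neg (hRc θ) (hRgt θ) (by
          rw [him]; exact mul_pos (by linarith) (Real.sin_pos_of_pos_of_lt_pi hθ.1 hθ.2))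
    have t2 : Tendsto (fun θ => Complex.log (om α β sq (circleMap 0 R θ)))
        (nhdsWithin (-Real.pi) (Set.Ioi (-Real.pi))) (nhdsWithin (Real.log T + Real.pi * Complex.I) S) := by
      rw [tendsto_nhdsWithin_iff]
      refine ⟨?_, mem_of_superset hmemIoo_npi hlog⟩
      have k := (Complex.continuousWithinAt_log_of_re_neg_of_im_zero hre him0).tendsto
      have e3 : Complex.log ((-T : ℝ) : ℂ) = Real.log T + Real.pi * Complex.I := by
        rw [Complex.log, hnT, Complex.arg_ofReal_of_neg (by linarith)]
      rw [e3] at k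
      refine k.comp (tendsto_nhdsWithin_iff.2 ⟨?_, ?_⟩)
      · rw [← e2]; exact hcont'.tendsto.mono_left nhdsWithin_le_nhds
      · filter_upwards [Ioo_mem_nhdsGT (show -Real.pi < 0 by linarith)] with θ hθ
        exact (h.om_im_pos (hRc θ) (hRgt θ) (by
          rw [him]; exact mul_neg_of_pos_of_neg (by linarith) (Real.sin_neg_of_neg_of_neg_pi_lt hθ.2 hθ.1))).le
    have m1 : (Real.log T : ℂ) - Real.pi * Complex.I ∈ S :=
      ⟨⟨by simpa using hlogT0, by simp [abs_of_pos hπ], Or.inr (by simpa using hlogT)⟩,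
        by simpa using hlogr⟩
    have m2 : (Real.log T : ℂ) + Real.pi * Complex.I ∈ S :=
      ⟨⟨by simpa using hlogT0, by simp [abs_of_pos hπ], Or.inr (by simpa using hlogT)⟩,
        by simpa using hlogr⟩
    exact intervalIntegral.integral_eq_sub_of_hasDerivAt_of_tendsto (by linarith) hder hint
      ((hP _ m2).continuousWithinAt.tendsto.comp t2) ((hP _ m1).continuousWithinAt.tendsto.comp t1)
  rw [hI1, hI2]; ring

end IsBranch

theorem conc_linear {c C g D W ρ j N : ℝ} (hc : 1 < c) (hC : 1 ≤ C) (hg : 0 < g)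
    (hg2 : g ^ 2 = c ^ 2 - C) (hD : D ≤ C)
    (hW2 : W ^ 2 = c ^ 4 - 2 * c ^ 2 * ((2 * C - 1) * D - 2 * C ^ 2 + 2 * C) + D ^ 2)
    (hρ : 2 * ρ ^ 2 = W + c ^ 2 - ((2 * C - 1) * D - 2 * C ^ 2 + 2 * C))
    (hj : 0 ≤ j) (hjN : j * c * (C ^ 2 - 2 * C + c ^ 2) ≤ N * g ^ 3) :
    (N - j) * (D / C) + j * ((c ^ 2 + W + 2 * c * ρ) / (c + g) ^ 2) ≤ N := by
  have hcg : 0 < c + g := by linarith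
  set d := C - D with hd
  have hd0 : 0 ≤ d := by linarith
  have hDd : D = C - d := by ring
  -- `W` lies below its tangent
  have h1 : W * g ^ 2 ≤ g ^ 4 + (c ^ 2 * (2 * C - 1) - C) * d := by
    have hk : g ^ 2 ≤ c ^ 2 * (2 * C - 1) - C := by rw [hg2]; nlinarith
    have hL : 0 ≤ g ^ 4 + (c ^ 2 * (2 * C - 1) - C) * d := by
      have : 0 ≤ c ^ 2 * (2 * C - 1) - C := le_trans (by positivity) hk
      positivity
    refine abs_le_of_sq_le_sq' ?_ hL |>.2
    have e1 : W ^ 2 = g ^ 4 + 2 * (c ^ 2 * (2 * C - 1) - C) * d + d ^ 2 := by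
      rw [hW2, hDd, show g ^ 4 = (g ^ 2) ^ 2 by ring, hg2]; ring
    have e2 : (W * g ^ 2) ^ 2 = g ^ 8 + 2 * g ^ 4 * (c ^ 2 * (2 * C - 1) - C) * d + g ^ 4 * d ^ 2 := by
      rw [mul_pow, e1]; ring
    rw [e2]
    have : (g ^ 2) ^ 2 ≤ (c ^ 2 * (2 * C - 1) - C) ^ 2 := pow_le_pow_left₀ (by positivity) hk 2
    nlinarith [mul_le_mul_of_nonneg_right this (sq_nonneg d)]
  -- so does `ρ`
  have h2 : 2 * g * ρ ≤ ρ ^ 2 + g ^ 2 := by nlinarith [sq_nonneg (ρ - g)]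
  have h3 : 4 * g * ρ * g ^ 2 ≤ 4 * g ^ 4 + 2 * (2 * c ^ 2 * C - c ^ 2 - C ^ 2) * d := by
    have : 4 * g * ρ ≤ W + c ^ 2 - ((2 * C - 1) * D - 2 * C ^ 2 + 2 * C) + 2 * g ^ 2 := by linarith
    have h4 := mul_le_mul_of_nonneg_right this (sq_nonneg g)
    have e : c ^ 2 - ((2 * C - 1) * D - 2 * C ^ 2 + 2 * C) + 2 * g ^ 2 = 3 * g ^ 2 + (2 * C - 1) * d := by
      rw [hg2, hDd]; ring
    have e5 : (2 * C - 1) * d * g ^ 2 = (2 * C - 1) * d * (c ^ 2 - C) := by rw [hg2]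
    nlinarith
  have h5 : (c ^ 2 + W + 2 * c * ρ) * g ^ 3 ≤ (c + g) ^ 2 * g ^ 3 +
      (g * (2 * c ^ 2 * C - c ^ 2 - C) + c * (2 * c ^ 2 * C - c ^ 2 - C ^ 2)) * d := by
    nlinarith [mul_le_mul_of_nonneg_left h1 hg.le, mul_le_mul_of_nonneg_left h3 (by linarith : 0 ≤ c)]
  have key : C * (g * (2 * c ^ 2 * C - c ^ 2 - C) + c * (2 * c ^ 2 * C - c ^ 2 - C ^ 2)) +
      (c + g) ^ 2 * g ^ 3 = (c + g) ^ 2 * (c * (C ^ 2 - 2 * C + c ^ 2)) := by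
    have e : C = c ^ 2 - g ^ 2 := by linarith
    rw [e]; ring
  set Y := g * (2 * c ^ 2 * C - c ^ 2 - C) + c * (2 * c ^ 2 * C - c ^ 2 - C ^ 2)
  have h6 : (N - j) * (D / C) + j * ((c ^ 2 + W + 2 * c * ρ) / (c + g) ^ 2) ≤
      (N - j) * (D / C) + j * (((c + g) ^ 2 + Y * d / g ^ 3) / (c + g) ^ 2) := by
    refine add_le_add le_rfl (mul_le_mul_of_nonneg_left (div_le_div_of_nonneg_right ?_ (by positivity)) hj)
    have : (c + g) ^ 2 + Y * d / g ^ 3 = ((c + g) ^ 2 * g ^ 3 + Y * d) / g ^ 3 := by field_simp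
    rw [this, le_div_iff₀ (by positivity)]
    exact h5
  refine h6.trans ?_
  have hC0 : 0 < C := by linarith
  have e7 : (N - j) * (D / C) + j * (((c + g) ^ 2 + Y * d / g ^ 3) / (c + g) ^ 2) =
      N - d * (N * g ^ 3 * (c + g) ^ 2 - j * (C * Y + (c + g) ^ 2 * g ^ 3)) / (C * g ^ 3 * (c + g) ^ 2) := by
    rw [hDd]; field_simp; ring
  rw [e7, key, sub_le_self_iff]
  apply div_nonneg _ (by positivity)
  apply mul_nonneg hd0
  nlinarith [mul_le_mul_of_nonneg_right hjN (sq_nonneg (c + g))]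

theorem pow_mul_pow_le_one {a b : ℝ} (ha : 0 ≤ a) (hb : 0 ≤ b) (i j : ℕ) 
    (h : (i : ℝ) * a + j * b ≤ i + j) : a ^ i * b ^ j ≤ 1 := by
  rcases Nat.eq_zero_or_pos (i + j) with h0 | h0
  · have : i = 0 ∧ j = 0 := by omega
    simp [this.1, this.2]
  have hN : (0 : ℝ) < i + j := by exact_mod_cast h0
  have h1 := Real.geom_mean_le_arith_mean2_weighted (w₁ := i / (i + j)) (w₂ := j / (i + j))
    (by positivity) (by positivity) ha hb (by field_simp)
  have h2 : (i : ℝ) / (i + j) * a + j / (i + j) * b ≤ 1 := by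
    rw [div_mul_eq_mul_div, div_mul_eq_mul_div, ← add_div, div_le_one hN]; exact h
  have h3 := Real.rpow_le_one (by positivity) (h1.trans h2) hN.le
  rw [Real.mul_rpow (by positivity) (by positivity), ← Real.rpow_mul ha, ← Real.rpow_mul hb,
    div_mul_cancel₀ _ hN.ne', div_mul_cancel₀ _ hN.ne', Real.rpow_natCast, Real.rpow_natCast] at h3
  exact h3

theorem one_le_cosh_sq_aux {r : ℝ} (hr : 0 < r) : 1 ≤ (r + 1) ^ 2 / (4 * r) := by
  rw [one_le_div (by linarith)]; nlinarith [sq_nonneg (r - 1)]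

namespace IsBranch

variable {α β : ℝ} {sq : ℂ → ℂ}

/-- The maximum of `dv ^ i * yv ^ j` over the circle `|z| = r` is attained at `-r`. -/
theorem conc_circle (h : IsBranch α β sq) {z : ℂ} (hz : z ∉ cuts α β) {r C g : ℝ}
    (hr : ‖z‖ = r) (hC : C = (r + 1) ^ 2 / (4 * r)) (hg : 0 < g) (hg2 : g ^ 2 = hs α β ^ 2 - C)
    (i j : ℕ) (hj : (j : ℝ) * hs α β * (C ^ 2 - 2 * C + hs α β ^ 2) ≤ (i + j) * g ^ 3) :
    dv z ^ i * yv α β sq z ^ j ≤ C ^ i * ((hs α β + g) ^ 2) ^ j := by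
  have h0 := ne_zero_of_notMem_cuts hz
  have hr0 : 0 < r := hr ▸ norm_pos_iff.2 h0
  have hC1 : 1 ≤ C := hC ▸ one_le_cosh_sq_aux hr0
  have hc := h.one_lt_hs
  have hD : dv z ≤ C := by rw [hC, ← hr]; exact dv_le h0
  have hD0 : 0 ≤ dv z := by unfold dv; positivity
  have hY0 := h.yv_pos hz
  set c := hs α β with hcdef
  set s := slp sq z with hsdef
  have hs2 := h.slp_sq hz
  rw [← hsdef, ← hcdef] at hs2
  -- the real part of `(z-1)²/z`
  set x := z.re with hx
  set t := z.im with ht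
  have hn : x ^ 2 + t ^ 2 = r ^ 2 := by
    rw [← hr, ← Complex.normSq_eq_norm_sq, Complex.normSq_apply]; ring
  have hq : (z - 1) ^ 2 / z = z + z⁻¹ - 2 := by field_simp; ring
  have hDx : dv z = (r ^ 2 - 2 * x + 1) / (4 * r) := by
    rw [dv, hr, ← Complex.normSq_eq_norm_sq, Complex.normSq_apply, Complex.sub_re, Complex.sub_im]
    congr 1; simp; linarith
  have hre : ((z - 1) ^ 2 / z).re = -4 * ((2 * C - 1) * dv z - 2 * C ^ 2 + 2 * C) := by
    rw [hq, Complex.sub_re, Complex.add_re, Complex.inv_re, Complex.normSq_eq_norm_sq, hr, hDx, hC]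
    simp only [Complex.re_ofNat]
    rw [← hx]
    field_simp
    ring
  set X := (2 * C - 1) * dv z - 2 * C ^ 2 + 2 * C with hX
  have hnq : ‖(z - 1) ^ 2 / z‖ = 4 * dv z := by
    rw [norm_div, norm_pow, dv]; field_simp
  have hW2 : (‖s‖ ^ 2 / 4) ^ 2 = c ^ 4 - 2 * c ^ 2 * X + dv z ^ 2 := by
    have e : ‖s ^ 2‖ ^ 2 = (4 * c ^ 2) ^ 2 + 2 * (4 * c ^ 2) * ((z - 1) ^ 2 / z).re + ‖(z - 1) ^ 2 / z‖ ^ 2 := by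
      rw [hs2, ← Complex.normSq_eq_norm_sq, ← Complex.normSq_eq_norm_sq, Complex.normSq_add,
        show (4 * (c : ℂ) ^ 2) = ((4 * c ^ 2 : ℝ) : ℂ) by push_cast; rfl, Complex.normSq_ofReal, Complex.re_ofReal_mul,
        Complex.conj_re]
      ring
    rw [hre, hnq, norm_pow] at e
    linear_combination e / 16
  have hρ : 2 * (s.re / 2) ^ 2 = ‖s‖ ^ 2 / 4 + c ^ 2 - X := by
    have e := congrArg Complex.re hs2
    rw [Complex.add_re, hre, pow_two, Complex.mul_re,
      show (4 * (c : ℂ) ^ 2) = ((4 * c ^ 2 : ℝ) : ℂ) by push_cast; rfl, Complex.ofReal_re] at e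
    have e2 : ‖s‖ ^ 2 = s.re * s.re + s.im * s.im := by
      rw [← Complex.normSq_eq_norm_sq, Complex.normSq_apply]
    rw [e2]; linear_combination e / 4
  have hy : yv α β sq z = c ^ 2 + ‖s‖ ^ 2 / 4 + 2 * c * (s.re / 2) := by
    rw [yv, ← hsdef, ← hcdef, ← Complex.normSq_eq_norm_sq, ← Complex.normSq_eq_norm_sq, Complex.normSq_apply,
      Complex.normSq_apply]
    simp; ring
  have hlin := conc_linear (j := j) (N := i + j) hc hC1 hg hg2 hD hW2 hρ (by positivity) hj
  rw [← hy, add_sub_cancel_right] at hlin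
  have hfin := pow_mul_pow_le_one (by positivity) (by positivity) i j hlin
  rw [div_pow, div_pow, div_mul_div_comm, div_le_one (by positivity)] at hfin
  exact hfin

end IsBranch

/-- `√(c² - cosh² u)`. -/
noncomputable def gapu (c u : ℝ) : ℝ := √(c ^ 2 - Real.cosh u ^ 2)

/-- The real phase function along the gap. -/
noncomputable def gapPhase (c η θ u : ℝ) : ℝ :=
  Real.log (Real.cosh u) - θ * u + η * (Real.log (c + gapu c u) - Real.log (Real.cosh u))

/-- The derivative of `gapPhase`. -/
noncomputable def gapSlope (c η θ u : ℝ) : ℝ :=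
  Real.sinh u / Real.cosh u * (1 - η * c / gapu c u) - θ

theorem gapu_pos {c u : ℝ} (h : Real.cosh u < c) : 0 < gapu c u :=
  Real.sqrt_pos.2 (by nlinarith [Real.cosh_pos u])

theorem gapu_sq {c u : ℝ} (h : Real.cosh u < c) : gapu c u ^ 2 = c ^ 2 - Real.cosh u ^ 2 :=
  Real.sq_sqrt (by nlinarith [Real.cosh_pos u])

theorem hasDerivAt_gapu {c u : ℝ} (h : Real.cosh u < c) :
    HasDerivAt (gapu c) (-(Real.cosh u * Real.sinh u / gapu c u)) u := by
  have h1 : c ^ 2 - Real.cosh u ^ 2 ≠ 0 := by nlinarith [Real.cosh_pos u]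
  have := (((Real.hasDerivAt_cosh u).fun_pow 2).const_sub (c ^ 2)).sqrt h1
  refine this.congr_deriv ?_
  have h2 := (gapu_pos h).ne'
  change _ / (2 * gapu c u) = _
  field_simp
  simp; ring

theorem hasDerivAt_gapPhase {c η θ u : ℝ} (h : Real.cosh u < c) :
    HasDerivAt (gapPhase c η θ) (gapSlope c η θ u) u := by
  have hg := gapu_pos h
  have hC := Real.cosh_pos u
  have h1 := (Real.hasDerivAt_cosh u).log hC.ne'
  have hcg : c + gapu c u ≠ 0 := by linarith
  have h2 := ((hasDerivAt_gapu h).const_add c).log hcg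
  have h3 := (h1.sub ((hasDerivAt_id u).const_mul θ)).add ((h2.sub h1).const_mul η)
  refine h3.congr_deriv ?_
  have hs := gapu_sq h
  unfold gapSlope
  field_simp
  have e : Real.cosh u ^ 2 = c ^ 2 - gapu c u ^ 2 := by linarith
  rw [e]; ring

theorem hasDerivAt_gapSlope {c η θ u : ℝ} (h : Real.cosh u < c) :
    HasDerivAt (gapSlope c η θ) ((gapu c u ^ 3 - η * c *
      (Real.cosh u ^ 4 - 2 * Real.cosh u ^ 2 + c ^ 2)) / (Real.cosh u ^ 2 * gapu c u ^ 3)) u := by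
  have hg := gapu_pos h
  have hC := Real.cosh_pos u
  have h1 := (Real.hasDerivAt_sinh u).div (Real.hasDerivAt_cosh u) hC.ne'
  have h2 := (((hasDerivAt_gapu h).inv hg.ne').const_mul (η * c)).const_sub 1
  have h3 := (h1.mul h2).sub_const θ
  refine h3.congr_deriv ?_
  have hs := gapu_sq h
  have hCS := Real.cosh_sq u
  simp only [Pi.div_apply]
  field_simp
  simp only [Pi.inv_apply]
  field_simp
  have e : c ^ 2 = gapu c u ^ 2 + (Real.sinh u ^ 2 + 1) := by linarith
  rw [hCS]; linear_combination η * c * e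

/-- A point with larger phase at which the slope condition of the dual circle holds. -/
theorem exists_dual_point {c η θ P L : ℝ} (hη : 0 ≤ η) (hP : 0 ≤ P) (hPL : P < L)
    (hL : Real.cosh L = c) (hK : gapSlope c η θ P = 0)
    (hS : η * c * (Real.cosh P ^ 4 - 2 * Real.cosh P ^ 2 + c ^ 2) < gapu c P ^ 3) :
    ∃ q, P < q ∧ q < L ∧ gapPhase c η θ P < gapPhase c η θ q ∧
      θ * (Real.cosh q ^ 4 - 2 * Real.cosh q ^ 2 + c ^ 2) < Real.cosh q * Real.sinh q ^ 3 := by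
  have hL0 : 0 < L := by linarith
  have hlt : ∀ u, 0 ≤ u → u < L → Real.cosh u < c := fun u h0 h1 => by
    rw [← hL, Real.cosh_lt_cosh, abs_of_nonneg h0, abs_of_pos hL0]; exact h1
  have hc : 0 < c := hL ▸ Real.cosh_pos L
  set F : ℝ → ℝ := fun u => Real.cosh u * Real.sinh u ^ 3 -
    θ * (Real.cosh u ^ 4 - 2 * Real.cosh u ^ 2 + c ^ 2) with hF
  have hFc : Continuous F := by
    have := Real.continuous_cosh; have := Real.continuous_sinh; fun_prop
  -- positivity of the slope just after `P`
  have hpos : ∀ᶠ u in nhdsWithin P (Set.Ioi P), 0 < gapSlope c η θ u := by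
    have hg := gapu_pos (hlt P hP hPL)
    have hd := hasDerivAt_gapSlope (η := η) (θ := θ) (hlt P hP hPL)
    have h1 : 0 < (gapu c P ^ 3 - η * c *
      (Real.cosh P ^ 4 - 2 * Real.cosh P ^ 2 + c ^ 2)) / (Real.cosh P ^ 2 * gapu c P ^ 3) := by
      have := Real.cosh_pos P
      exact div_pos (by linarith) (by positivity)
    have h2 := (hasDerivAt_iff_tendsto_slope.1 hd).eventually (lt_mem_nhds h1)
    have h3 : ∀ᶠ u in nhdsWithin P (Set.Ioi P), 0 < slope (gapSlope c η θ) P u :=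
      h2.filter_mono (nhdsWithin_mono _ fun x hx => (ne_of_gt hx))
    filter_upwards [h3, self_mem_nhdsWithin] with u hu hu'
    rw [slope_def_field, hK, sub_zero] at hu
    exact (div_pos_iff_of_pos_right (sub_pos.2 hu')).1 hu
  obtain ⟨b, hb1, hb2⟩ := (mem_nhdsGT_iff_exists_Ioo_subset).1 hpos
  set δ := min b L with hδ
  have hPδ : P < δ := lt_min hb1 hPL
  have hslope : ∀ u, P < u → u < δ → 0 < gapSlope c η θ u := fun u h1 h2 =>
    hb2 ⟨h1, lt_of_lt_of_le h2 (min_le_left _ _)⟩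
  have hδL : δ ≤ L := min_le_right _ _
  have hdiff : ∀ u, 0 ≤ u → u < L → HasDerivAt (gapPhase c η θ) (gapSlope c η θ u) u :=
    fun u h0 h1 => hasDerivAt_gapPhase (hlt u h0 h1)
  have hmono : ∀ u, P < u → u < δ → gapPhase c η θ P < gapPhase c η θ u := by
    intro u h1 h2
    have : StrictMonoOn (gapPhase c η θ) (Set.Icc P u) := by
      apply strictMonoOn_of_deriv_pos (convex_Icc _ _)
      · intro x hx
        exact (hdiff x (by linarith [hx.1]) (by linarith [hx.2])).continuousAt.continuousWithinAt
      · intro x hx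
        rw [interior_Icc] at hx
        rw [(hdiff x (by linarith [hx.1]) (by linarith [hx.2])).deriv]
        exact hslope x hx.1 (by linarith [hx.2])
    exact this ⟨le_rfl, h1.le⟩ ⟨h1.le, le_rfl⟩ h1
  by_cases hex : ∃ u, P < u ∧ u < δ ∧ 0 < F u
  · obtain ⟨u, h1, h2, h3⟩ := hex
    exact ⟨u, h1, by linarith, hmono u h1 h2, by simp only [hF] at h3; linarith⟩
  push Not at hex
  -- the condition holds near `L`
  have hθP : θ * c < Real.sinh L := by
    have hg := gapu_pos (hlt P hP hPL)
    have h1 : θ ≤ Real.sinh P / Real.cosh P := by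
      have : θ = Real.sinh P / Real.cosh P * (1 - η * c / gapu c P) := by
        unfold gapSlope at hK; linarith
      rw [this]
      have h2 : 0 ≤ Real.sinh P / Real.cosh P := div_nonneg (Real.sinh_nonneg_iff.2 hP) (Real.cosh_pos _).le
      have h3 : 0 ≤ η * c / gapu c P := by positivity
      nlinarith
    have h4 : Real.sinh P / Real.cosh P < Real.sinh L / Real.cosh L := by
      rw [div_lt_div_iff₀ (Real.cosh_pos _) (Real.cosh_pos _)]
      have := Real.sinh_pos_iff.2 (sub_pos.2 hPL)
      rw [Real.sinh_sub] at this
      linarith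
    rw [hL] at h4
    rw [← lt_div_iff₀ hc]; linarith
  have hsL : 0 < Real.sinh L := Real.sinh_pos_iff.2 hL0
  have hFL : 0 < F L := by
    have h1 := Real.cosh_sq L
    rw [hL] at h1
    have : F L = c * Real.sinh L ^ 2 * (Real.sinh L - θ * c) := by
      simp only [hF, hL]
      have e4 : c ^ 4 = c ^ 2 * (Real.sinh L ^ 2 + 1) := by rw [← h1]; ring
      rw [e4]; ring
    rw [this]
    exact mul_pos (by positivity) (by linarith)
  set A : Set ℝ := {u | P < u ∧ u < L ∧ 0 < F u} with hA
  have hAne : A.Nonempty := by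
    have h1 : ∀ᶠ u in nhdsWithin L (Set.Iio L), 0 < F u :=
      (hFc.continuousAt.eventually (lt_mem_nhds hFL)).filter_mono nhdsWithin_le_nhds
    obtain ⟨u, hu1, hu2⟩ := (h1.and (Ioo_mem_nhdsLT hPL)).exists
    exact ⟨u, hu2.1, hu2.2, hu1⟩
  have hAb : BddBelow A := ⟨P, fun u hu => hu.1.le⟩
  set q₀ := sInf A with hq₀
  have hq₀δ : δ ≤ q₀ := le_csInf hAne fun u hu => by
    by_contra hcon; push Not at hcon
    exact absurd hu.2.2 (not_lt.2 (hex u hu.1 hcon))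
  have hq₀L : q₀ < L := by
    obtain ⟨u, hu⟩ := hAne
    exact lt_of_le_of_lt (csInf_le hAb hu) hu.2.1
  have hFle : ∀ u, P < u → u < q₀ → F u ≤ 0 := fun u h1 h2 => by
    by_contra hcon; push Not at hcon
    exact absurd (csInf_le hAb (show u ∈ A from ⟨h1, by linarith, hcon⟩)) (not_le.2 h2)
  set u₁ := (P + δ) / 2 with hu₁
  have h1P : P < u₁ := by linarith
  have h1δ : u₁ < δ := by linarith
  set J : ℝ → ℝ := fun u => gapu c u / c * (1 - θ * (Real.cosh u / Real.sinh u)) with hJ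
  have hJd : ∀ u, u₁ ≤ u → u ≤ q₀ → HasDerivAt J (-F u / (c * gapu c u * Real.sinh u ^ 2)) u := by
    intro u h1 h2
    have hu := hlt u (by linarith) (by linarith)
    have hs : 0 < Real.sinh u := Real.sinh_pos_iff.2 (by linarith)
    have hg := gapu_pos hu
    have d1 := (hasDerivAt_gapu hu).div_const c
    have d2 := (((Real.hasDerivAt_cosh u).div (Real.hasDerivAt_sinh u) hs.ne').const_mul θ).const_sub 1
    refine (d1.mul d2).congr_deriv ?_
    have e := gapu_sq hu
    have hCS := Real.cosh_sq u
    simp only [hF, Pi.div_apply]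
    field_simp
    rw [e]
    linear_combination -θ * (2 * Real.cosh u ^ 2 - c ^ 2) * hCS
  have hJmono : MonotoneOn J (Set.Icc u₁ q₀) := by
    apply monotoneOn_of_deriv_nonneg (convex_Icc _ _)
    · intro x hx; exact (hJd x hx.1 hx.2).continuousAt.continuousWithinAt
    · intro x hx
      rw [interior_Icc] at hx
      exact (hJd x hx.1.le hx.2.le).differentiableAt.differentiableWithinAt
    · intro x hx
      rw [interior_Icc] at hx
      rw [(hJd x hx.1.le hx.2.le).deriv]
      have hg := gapu_pos (hlt x (by linarith [hx.1]) (by linarith [hx.2]))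
      exact div_nonneg (by linarith [hFle x (by linarith [hx.1]) hx.2]) (by positivity)
  have hJK : ∀ u, u₁ ≤ u → u ≤ q₀ → gapSlope c η θ u =
      Real.sinh u / Real.cosh u * c / gapu c u * (J u - η) := by
    intro u h1 h2
    have hs : 0 < Real.sinh u := Real.sinh_pos_iff.2 (by linarith)
    have hg := gapu_pos (hlt u (by linarith) (by linarith))
    have hC := Real.cosh_pos u
    simp only [hJ, gapSlope]
    field_simp
    ring
  have hcoef : ∀ u, u₁ ≤ u → u ≤ q₀ → 0 < Real.sinh u / Real.cosh u * c / gapu c u := by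
    intro u h1 h2
    have hs : 0 < Real.sinh u := Real.sinh_pos_iff.2 (by linarith)
    have hg := gapu_pos (hlt u (by linarith) (by linarith))
    have hC := Real.cosh_pos u
    positivity
  have hJ1 : η < J u₁ := by
    have h1 := hslope u₁ h1P h1δ
    rw [hJK u₁ le_rfl (by linarith)] at h1
    linarith [(pos_iff_pos_of_mul_pos h1).1 (hcoef u₁ le_rfl (by linarith))]
  have hHmono : MonotoneOn (gapPhase c η θ) (Set.Icc u₁ q₀) := by
    apply monotoneOn_of_deriv_nonneg (convex_Icc _ _)
    · intro x hx
      exact (hdiff x (by linarith [hx.1]) (by linarith [hx.2])).continuousAt.continuousWithinAt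
    · intro x hx
      rw [interior_Icc] at hx
      exact (hdiff x (by linarith [hx.1]) (by linarith [hx.2])).differentiableAt.differentiableWithinAt
    · intro x hx
      rw [interior_Icc] at hx
      rw [(hdiff x (by linarith [hx.1]) (by linarith [hx.2])).deriv, hJK x hx.1.le hx.2.le]
      have := hJmono ⟨le_rfl, by linarith⟩ ⟨hx.1.le, hx.2.le⟩ hx.1.le
      exact mul_nonneg (hcoef x hx.1.le hx.2.le).le (by linarith)
  have hH0 : gapPhase c η θ P < gapPhase c η θ q₀ :=
    lt_of_lt_of_le (hmono u₁ h1P h1δ) (hHmono ⟨le_rfl, by linarith⟩ ⟨by linarith, le_rfl⟩ (by linarith))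
  have hev := (hdiff q₀ (by linarith) hq₀L).continuousAt.eventually (lt_mem_nhds hH0)
  obtain ⟨ε, hε, hball⟩ := Metric.eventually_nhds_iff.1 hev
  obtain ⟨q, hqA, hq⟩ := exists_lt_of_csInf_lt hAne (show sInf A < q₀ + ε by linarith)
  have hq' := csInf_le hAb hqA
  refine ⟨q, hqA.1, hqA.2.1, hball ?_, ?_⟩
  · rw [Real.dist_eq, abs_lt]; constructor <;> linarith
  · have := hqA.2.2; simp only [hF] at this; linarith

theorem exists_zero_deriv_pos {K K' : ℝ → ℝ} {a b x₁ x₂ : ℝ}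
    (hK : ∀ x, a < x → x < b → HasDerivAt K (K' x) x)
    (hs : ∀ x, a < x → x < b → K x = 0 → K' x ≠ 0) (h1 : a < x₁) (h12 : x₁ < x₂) (h2 : x₂ < b)
    (z1 : K x₁ = 0) (z2 : K x₂ = 0) : ∃ x, a < x ∧ x < b ∧ K x = 0 ∧ 0 < K' x := by
  by_contra hcon
  push Not at hcon
  have hneg : ∀ x, a < x → x < b → K x = 0 → K' x < 0 := fun x h h' h'' =>
    lt_of_le_of_ne (hcon x h h' h'') (hs x h h' h'')
  have hsl : ∀ x, a < x → x < b → K x = 0 → ∀ᶠ y in nhdsWithin x {x}ᶜ, K y / (y - x) < 0 := by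
    intro x h h' h''
    have := (hasDerivAt_iff_tendsto_slope.1 (hK x h h')).eventually (gt_mem_nhds (hneg x h h' h''))
    filter_upwards [this] with y hy
    rwa [slope_def_field, h'', sub_zero] at hy
  have hr := (hsl x₁ h1 (by linarith) z1).filter_mono
    (nhdsWithin_mono x₁ (show Set.Ioi x₁ ⊆ {x₁}ᶜ from fun y hy => ne_of_gt hy))
  obtain ⟨y, hy, hy1, hy2⟩ := (hr.and (Ioo_mem_nhdsGT h12)).exists
  have hKy : K y < 0 := by
    have := sub_pos.2 hy1
    by_contra hc; push Not at hc
    exact absurd hy (not_lt.2 (div_nonneg hc this.le))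
  have hcont : ContinuousOn K (Set.Icc y x₂) := fun x hx =>
    (hK x (by linarith [hx.1]) (by linarith [hx.2])).continuousAt.continuousWithinAt
  have hcl : IsCompact (Set.Icc y x₂ ∩ K ⁻¹' Set.Ici 0) :=
    (isCompact_Icc).of_isClosed_subset (hcont.preimage_isClosed_of_isClosed isClosed_Icc isClosed_Ici)
      Set.inter_subset_left
  obtain ⟨s, hs1, hs2⟩ := hcl.exists_isLeast ⟨x₂, ⟨hy2.le, le_rfl⟩, by simp [z2]⟩
  have hKs : 0 ≤ K s := hs1.2
  have hys : y < s := lt_of_le_of_ne hs1.1.1 (by rintro rfl; linarith)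
  have hmin : ∀ x, y ≤ x → x < s → K x < 0 := fun x hx hx' => by
    by_contra hc; push Not at hc
    exact absurd (hs2 ⟨⟨hx, by linarith [hs1.1.2]⟩, hc⟩) (not_le.2 hx')
  have hKs0 : K s = 0 := by
    obtain ⟨w, hw, hw0⟩ := intermediate_value_Icc hys.le
      (hcont.mono (Set.Icc_subset_Icc_right hs1.1.2)) (show (0:ℝ) ∈ Set.Icc (K y) (K s) from ⟨hKy.le, hKs⟩)
    rcases eq_or_lt_of_le hw.2 with h | h
    · rw [← h]; exact hw0
    · exact absurd hw0 (hmin w hw.1 h).ne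
  have hl := (hsl s (by linarith) (by linarith [hs1.1.2]) hKs0).filter_mono
    (nhdsWithin_mono s (show Set.Iio s ⊆ {s}ᶜ from fun y hy => ne_of_lt hy))
  obtain ⟨x, hx, hx1, hx2⟩ := (hl.and (Ioo_mem_nhdsLT hys)).exists
  have := hmin x hx1.le hx2
  exact absurd hx (not_lt.2 (div_nonneg_of_nonpos this.le (by linarith)))

namespace IsBranch

variable {α β : ℝ} {sq : ℂ → ℂ}

theorem cosh_log (h : IsBranch α β sq) : Real.cosh (Real.log α) = hs α β := by
  have hα : 0 < α := by linarith [h.one_lt]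
  have hb : β = α⁻¹ := eq_inv_of_mul_eq_one_right h.mul_eq
  rw [Real.cosh_eq, Real.exp_neg, Real.exp_log hα, hs, hb]

theorem exp_bounds (h : IsBranch α β sq) {u : ℝ} (h1 : -Real.log α < u) (h2 : u < Real.log α) :
    β ^ 2 < Real.exp (2 * u) ∧ Real.exp (2 * u) < α ^ 2 := by
  have hα : 0 < α := by linarith [h.one_lt]
  have hb : β = α⁻¹ := eq_inv_of_mul_eq_one_right h.mul_eq
  have e : Real.exp (2 * u) = Real.exp u ^ 2 := by rw [← Real.exp_nat_mul]; norm_cast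
  have k1 : β < Real.exp u := by
    rw [hb, ← Real.exp_log hα, ← Real.exp_neg]; exact Real.exp_lt_exp.2 h1
  have k2 : Real.exp u < α := by
    rw [← Real.exp_log hα]; simpa using Real.exp_lt_exp.2 h2
  rw [e]
  have hb0 := h.beta_pos
  constructor
  · gcongr
  · have := Real.exp_pos u
    gcongr

theorem cosh_lt (h : IsBranch α β sq) {u : ℝ} (h1 : -Real.log α < u) (h2 : u < Real.log α) :
    Real.cosh u < hs α β := by
  rw [← h.cosh_log, Real.cosh_lt_cosh, abs_of_pos (by linarith : 0 < Real.log α)]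
  exact abs_lt.2 ⟨h1, h2⟩

theorem gapv_exp (α β u : ℝ) : gapv α β (Real.exp (2 * u)) = gapu (hs α β) u := by
  rw [gapv, gapu]
  congr 2
  have e : Real.exp (2 * u) = Real.exp u ^ 2 := by rw [← Real.exp_nat_mul]; norm_cast
  rw [e, Real.cosh_eq, Real.exp_neg]
  have := Real.exp_pos u
  field_simp
  norm_num

theorem deriv_lamBranch_div (h : IsBranch α β sq) (j : Fin 2) {z : ℂ} (hz : z ∉ cuts α β) (h1 : z ≠ 1) :
    deriv (lamBranch α β sq j) z / lamBranch α β sq j z =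
      (if j = 0 then 1 else -1) * -(2 * (hs α β : ℂ) * (z + 1) / (z * slp sq z * (z - 1))) := by
  have hev : lam1 α β sq =ᶠ[nhds z] om α β sq := by
    filter_upwards [(isOpen_compl_cuts (α := α) (β := β)).mem_nhds hz, isOpen_ne.mem_nhds h1] with w hw hw1
    exact h.lam1_eq hw hw1
  have hd := h.om_hasDerivAt hz h1
  have h0 := h.om_ne_zero hz h1
  fin_cases j
  · have e : lamBranch α β sq 0 = lam1 α β sq := by ext w; simp [lamBranch]
    simp only [Fin.zero_eta, e, if_true, one_mul]
    rw [hev.deriv_eq, hd.deriv, h.lam1_eq hz h1, mul_div_cancel_right₀ _ h0]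
  · have e : lamBranch α β sq 1 = fun w => (lam1 α β sq w)⁻¹ := by ext w; simp [lamBranch]
    simp only [Fin.mk_one, e, Fin.isValue, one_ne_zero, if_false]
    have hev' : (fun w => (lam1 α β sq w)⁻¹) =ᶠ[nhds z] fun w => (om α β sq w)⁻¹ :=
      hev.fun_comp (fun w => w⁻¹)
    rw [hev'.deriv_eq, (hd.fun_inv h0).deriv, h.lam1_eq hz h1]
    field_simp

theorem Phid_gap (h : IsBranch α β sq) (ξ₁ ξ₂ : ℝ) (j : Fin 2) {u : ℝ} (h1 : -Real.log α < u)
    (h2 : u < Real.log α) :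
    Phid α β sq ξ₁ ξ₂ j ((-Real.exp (2 * u) : ℝ) : ℂ) =
      ((-Real.exp (-(2 * u)) * gapSlope (hs α β) (if j = 0 then ξ₁ else -ξ₁) ξ₂ u : ℝ) : ℂ) := by
  have hb := h.exp_bounds h1 h2
  obtain ⟨hz, hslp⟩ := h.slp_gap hb.1 hb.2
  rw [gapv_exp] at hslp
  have hg := gapu_pos (h.cosh_lt h1 h2)
  set t := Real.exp (2 * u) with ht
  have ht0 : 0 < t := Real.exp_pos _
  have hz1 : ((-t : ℝ) : ℂ) ≠ 1 := by intro h3; have : -t = 1 := by exact_mod_cast h3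
                                      linarith
  have htan : Real.sinh u / Real.cosh u = (t - 1) / (t + 1) := by
    have e : t = Real.exp u ^ 2 := by rw [ht, ← Real.exp_nat_mul]; norm_cast
    rw [e, Real.sinh_eq, Real.cosh_eq, Real.exp_neg]
    have := Real.exp_pos u
    field_simp
  rw [Phid, mul_div_assoc, h.deriv_lamBranch_div j hz hz1, hslp, gapSlope, htan, Real.exp_neg, ← ht]
  set g := gapu (hs α β) u
  have hreal : 2 / (-t - 1) - (1 + ξ₂) / (-t) + ξ₁ * ((if j = 0 then 1 else -1) *
      -(2 * hs α β * (-t + 1) / (-t * (2 * g) * (-t - 1)))) =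
      -t⁻¹ * ((t - 1) / (t + 1) * (1 - (if j = 0 then ξ₁ else -ξ₁) * hs α β / g) - ξ₂) := by
    have k1 : -t - 1 = -(t + 1) := by ring
    have k2 : t + 1 ≠ 0 := by linarith
    rw [k1]
    split_ifs
    · field_simp; ring
    · field_simp; ring
  rw [← hreal]
  push_cast
  split_ifs <;> push_cast <;> rfl

end IsBranch

namespace IsBranch

variable {α β : ℝ} {sq : ℂ → ℂ}

/-- Zeros of the phase derivative on a sheet of the gas phase. -/
theorem phid_zero (h : IsBranch α β sq) {ξ₁ ξ₂ : ℝ} (hgas : GasPhase α β sq ξ₁ ξ₂) (j : Fin 2) {z : ℂ}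
    (hz : z ∈ {z : ℂ | z ∉ cuts α β ∧ z ≠ 1 ∧ Phid α β sq ξ₁ ξ₂ j z = 0}) :
    ∃ u, -Real.log α < u ∧ u < Real.log α ∧ z = ((-Real.exp (2 * u) : ℝ) : ℂ) ∧
      gapSlope (hs α β) (if j = 0 then ξ₁ else -ξ₁) ξ₂ u = 0 := by
  obtain ⟨hz1, hz2, hz3⟩ := hz
  obtain ⟨⟨x, rfl, hx1, hx2⟩, -⟩ := hgas.1 j z hz1 hz2 hz3
  have hα : 0 < α := by linarith [h.one_lt]
  have hb := h.beta_pos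
  have hx : 0 < -x := by nlinarith
  have hb' : β = α⁻¹ := eq_inv_of_mul_eq_one_right h.mul_eq
  have e : Real.exp (2 * (Real.log (-x) / 2)) = -x := by
    rw [mul_div_cancel₀ _ two_ne_zero, Real.exp_log hx]
  have h1 : -Real.log α < Real.log (-x) / 2 := by
    have : Real.log (β ^ 2) < Real.log (-x) := Real.log_lt_log (by positivity) (by linarith)
    rw [Real.log_pow, hb', Real.log_inv] at this
    push_cast at this; linarith
  have h2 : Real.log (-x) / 2 < Real.log α := by
    have : Real.log (-x) < Real.log (α ^ 2) := Real.log_lt_log hx (by linarith)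
    rw [Real.log_pow] at this
    push_cast at this; linarith
  refine ⟨Real.log (-x) / 2, h1, h2, by rw [e, neg_neg], ?_⟩
  have h3 := h.Phid_gap ξ₁ ξ₂ j h1 h2
  rw [e, neg_neg, hz3] at h3
  have h4 : -Real.exp (-(2 * (Real.log (-x) / 2))) * gapSlope (hs α β) (if j = 0 then ξ₁ else -ξ₁) ξ₂
    (Real.log (-x) / 2) = 0 := by exact_mod_cast h3.symm
  rcases mul_eq_zero.1 h4 with h5 | h5
  · exact absurd h5 (neg_ne_zero.2 (Real.exp_pos _).ne')
  · exact h5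

/-- Zeros of the real slope are simple in the gas phase. -/
theorem gapSlope_simple (h : IsBranch α β sq) {ξ₁ ξ₂ : ℝ} (hgas : GasPhase α β sq ξ₁ ξ₂) (j : Fin 2)
    {u D : ℝ} (h1 : -Real.log α < u) (h2 : u < Real.log α)
    (hu : gapSlope (hs α β) (if j = 0 then ξ₁ else -ξ₁) ξ₂ u = 0)
    (hD : HasDerivAt (gapSlope (hs α β) (if j = 0 then ξ₁ else -ξ₁) ξ₂) D u) : D ≠ 0 := by
  have hb := h.exp_bounds h1 h2
  have hz := (h.slp_gap hb.1 hb.2).1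
  have hz1 : ((-Real.exp (2 * u) : ℝ) : ℂ) ≠ 1 := by
    intro h3
    have : -Real.exp (2 * u) = 1 := by exact_mod_cast h3
    linarith [Real.exp_pos (2 * u)]
  have h3 := h.Phid_gap ξ₁ ξ₂ j h1 h2
  have h0 : Phid α β sq ξ₁ ξ₂ j ((-Real.exp (2 * u) : ℝ) : ℂ) = 0 := by rw [h3, hu]; simp
  have hd := (hgas.1 j _ hz hz1 h0).2
  rintro rfl
  have hda := (differentiableAt_of_deriv_ne_zero hd).hasDerivAt
  have he : HasDerivAt (fun v : ℝ => ((-Real.exp (2 * v) : ℝ) : ℂ)) ((-(Real.exp (2 * u) * 2) : ℝ) : ℂ) u := by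
    have := (((hasDerivAt_id u).const_mul (2 : ℝ)).exp).fun_neg
    exact HasDerivAt.ofReal_comp (this.congr_deriv (by simp))
  have hcomp := HasDerivAt.scomp u hda he
  have hright : HasDerivAt (fun v : ℝ => ((-Real.exp (-(2 * v)) *
      gapSlope (hs α β) (if j = 0 then ξ₁ else -ξ₁) ξ₂ v : ℝ) : ℂ)) 0 u := by
    have he2 : HasDerivAt (fun v : ℝ => -Real.exp (-(2 * v))) (2 * Real.exp (-(2 * u))) u := by
      have := ((((hasDerivAt_id u).const_mul (2 : ℝ)).fun_neg).exp).fun_neg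
      refine this.congr_deriv ?_
      simp; ring
    have := (he2.mul hD).ofReal_comp
    simpa [hu] using this
  have hev : (Phid α β sq ξ₁ ξ₂ j ∘ fun v : ℝ => ((-Real.exp (2 * v) : ℝ) : ℂ)) =ᶠ[nhds u]
      fun v : ℝ => ((-Real.exp (-(2 * v)) *
        gapSlope (hs α β) (if j = 0 then ξ₁ else -ξ₁) ξ₂ v : ℝ) : ℂ) := by
    filter_upwards [Ioo_mem_nhds h1 h2] with v hv
    exact h.Phid_gap ξ₁ ξ₂ j hv.1 hv.2
  have := hcomp.unique (hright.congr_of_eventuallyEq hev)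
  rw [smul_eq_mul, mul_eq_zero] at this
  rcases this with h5 | h5
  · have : -(Real.exp (2 * u) * 2) = 0 := by exact_mod_cast h5
    linarith [Real.exp_pos (2 * u)]
  · exact hd h5

theorem branch_set_empty (h : IsBranch α β sq) {ξ₁ : ℝ} (ξ₂ : ℝ) (hξ : ξ₁ ≠ 0) {x : ℝ} {L : ℂ}
    (hx : x = -α ^ 2 ∨ x = -β ^ 2)
    (hL : Tendsto (fun t : ℝ => Phid α β sq ξ₁ ξ₂ 0 (t : ℂ))
        (nhdsWithin x (Set.Ioo (-α ^ 2) (-β ^ 2))) (nhds L)) : False := by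
  have hα1 := h.one_lt
  have hα : 0 < α := by linarith
  have hb' : β = α⁻¹ := eq_inv_of_mul_eq_one_right h.mul_eq
  set l := Real.log α with hl
  have hl0 : 0 < l := Real.log_pos hα1
  obtain ⟨v, hv, hvx⟩ : ∃ v, (v = l ∨ v = -l) ∧ x = -Real.exp (2 * v) := by
    have e : ∀ u, Real.exp (2 * u) = Real.exp u ^ 2 := fun u => by rw [← Real.exp_nat_mul]; norm_cast
    rcases hx with rfl | rfl
    · exact ⟨l, Or.inl rfl, by rw [e, hl, Real.exp_log hα]⟩
    · exact ⟨-l, Or.inr rfl, by rw [e, Real.exp_neg, hl, Real.exp_log hα, hb']⟩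
  have hcv : Real.cosh v = hs α β := by
    rcases hv with rfl | rfl
    · exact h.cosh_log
    · rw [Real.cosh_neg]; exact h.cosh_log
  have hsv : Real.sinh v ≠ 0 := by
    rw [Real.sinh_ne_zero]; rcases hv with rfl | rfl <;> simp [hl0.ne']
  have : (nhdsWithin v (Set.Ioo (-l) l)).NeBot := by
    rw [← mem_closure_iff_nhdsWithin_neBot, closure_Ioo (by linarith)]
    rcases hv with rfl | rfl <;> constructor <;> linarith
  have htend : Tendsto (fun u : ℝ => -Real.exp (2 * u)) (nhdsWithin v (Set.Ioo (-l) l))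
      (nhdsWithin x (Set.Ioo (-α ^ 2) (-β ^ 2))) := by
    rw [tendsto_nhdsWithin_iff]
    constructor
    · rw [hvx]
      have : Continuous fun u : ℝ => -Real.exp (2 * u) := by fun_prop
      exact this.continuousAt.tendsto.mono_left nhdsWithin_le_nhds
    · filter_upwards [self_mem_nhdsWithin] with u hu
      have := h.exp_bounds hu.1 hu.2
      exact ⟨by linarith [this.2], by linarith [this.1]⟩
  have hgc : Continuous (gapu (hs α β)) := by
    have := Real.continuous_cosh; unfold gapu; fun_prop
  have hg0 : gapu (hs α β) v = 0 := by rw [gapu, hcv]; simp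
  have hT1 : Tendsto (fun u : ℝ => (gapu (hs α β) u : ℂ) * Phid α β sq ξ₁ ξ₂ 0 ((-Real.exp (2 * u) : ℝ) : ℂ))
      (nhdsWithin v (Set.Ioo (-l) l)) (nhds 0) := by
    have h1 := hL.comp htend
    have h2 : Tendsto (fun u : ℝ => (gapu (hs α β) u : ℂ)) (nhdsWithin v (Set.Ioo (-l) l)) (nhds 0) := by
      have : Tendsto (gapu (hs α β)) (nhdsWithin v (Set.Ioo (-l) l)) (nhds 0) := by
        rw [← hg0]; exact hgc.continuousAt.tendsto.mono_left nhdsWithin_le_nhds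
      exact_mod_cast (Complex.continuous_ofReal.tendsto 0).comp this
    simpa using h2.mul h1
  set M : ℝ → ℝ := fun u => -Real.exp (-(2 * u)) * (Real.sinh u / Real.cosh u * (gapu (hs α β) u - ξ₁ * hs α β) -
    ξ₂ * gapu (hs α β) u) with hM
  have hMc : Continuous M := by
    have := Real.continuous_cosh; have := Real.continuous_sinh
    have h3 : ∀ u, Real.cosh u ≠ 0 := fun u => (Real.cosh_pos u).ne'
    simp only [hM]
    fun_prop (disch := assumption)
  have hT2 : Tendsto (fun u : ℝ => (gapu (hs α β) u : ℂ) * Phid α β sq ξ₁ ξ₂ 0 ((-Real.exp (2 * u) : ℝ) : ℂ))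
      (nhdsWithin v (Set.Ioo (-l) l)) (nhds (M v : ℂ)) := by
    have h1 : Tendsto (fun u : ℝ => (M u : ℂ)) (nhdsWithin v (Set.Ioo (-l) l)) (nhds (M v : ℂ)) :=
      (Complex.continuous_ofReal.comp hMc).continuousAt.tendsto.mono_left nhdsWithin_le_nhds
    refine h1.congr' ?_
    filter_upwards [self_mem_nhdsWithin] with u hu
    rw [h.Phid_gap ξ₁ ξ₂ 0 hu.1 hu.2]
    have hg := (gapu_pos (h.cosh_lt hu.1 hu.2)).ne'
    have : M u = gapu (hs α β) u * (-Real.exp (-(2 * u)) * gapSlope (hs α β) ξ₁ ξ₂ u) := by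
      simp only [hM, gapSlope]; field_simp
    rw [this]; push_cast; simp
  have hM0 : M v = 0 := by exact_mod_cast tendsto_nhds_unique hT2 hT1
  simp only [hM, hg0, hcv] at hM0
  have hc := h.one_lt_hs
  have : Real.sinh v * ξ₁ = 0 := by
    have he := Real.exp_pos (-(2 * v))
    have h2 : Real.sinh v / hs α β * (0 - ξ₁ * hs α β) - ξ₂ * 0 = -(Real.sinh v * ξ₁) := by
      field_simp; ring
    rw [h2] at hM0
    rcases mul_eq_zero.1 hM0 with h3 | h3 <;> linarith
  rcases mul_eq_zero.1 this with h3 | h3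
  · exact hsv h3
  · exact hξ h3

/-- In the gas phase there is a saddle in the gap which is a strict maximum along the circle
through it. -/
theorem exists_gas_point (h : IsBranch α β sq) {ξ₁ ξ₂ : ℝ} (hgas : GasPhase α β sq ξ₁ ξ₂) :
    ∃ p, -Real.log α < p ∧ p < Real.log α ∧ gapSlope (hs α β) |ξ₁| ξ₂ p = 0 ∧
      |ξ₁| * hs α β * (Real.cosh p ^ 4 - 2 * Real.cosh p ^ 2 + hs α β ^ 2) < gapu (hs α β) p ^ 3 := by
  set c := hs α β with hc
  have hc1 := h.one_lt_hs
  set l := Real.log α with hl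
  set S : ℝ → ℝ → ℝ := fun σ u => (gapu c u ^ 3 - σ * c *
      (Real.cosh u ^ 4 - 2 * Real.cosh u ^ 2 + c ^ 2)) / (Real.cosh u ^ 2 * gapu c u ^ 3) with hS
  have hd : ∀ σ u, -l < u → u < l → HasDerivAt (gapSlope c σ ξ₂) (S σ u) u := fun σ u h1 h2 =>
    hasDerivAt_gapSlope (h.cosh_lt h1 h2)
  have hSpos : ∀ σ u, -l < u → u < l → (0 < S σ u ↔ σ * c * (Real.cosh u ^ 4 - 2 * Real.cosh u ^ 2 + c ^ 2) < gapu c u ^ 3) := by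
    intro σ u h1 h2
    have hg := gapu_pos (h.cosh_lt h1 h2)
    have := Real.cosh_pos u
    rw [hS, div_pos_iff_of_pos_right (by positivity), sub_pos]
  have hSneg : ∀ σ u, σ ≤ 0 → -l < u → u < l → 0 < S σ u := by
    intro σ u h0 h1 h2
    rw [hSpos σ u h1 h2]
    have hg := gapu_pos (h.cosh_lt h1 h2)
    have : 0 ≤ Real.cosh u ^ 4 - 2 * Real.cosh u ^ 2 + c ^ 2 := by nlinarith [sq_nonneg (Real.cosh u ^ 2 - 1)]
    have h3 : σ * c * (Real.cosh u ^ 4 - 2 * Real.cosh u ^ 2 + c ^ 2) ≤ 0 :=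
      mul_nonpos_of_nonpos_of_nonneg (mul_nonpos_of_nonpos_of_nonneg h0 (by linarith)) this
    have : 0 < gapu c u ^ 3 := by positivity
    linarith
  set Z : Fin 2 → Set ℂ := fun j => {z : ℂ | z ∉ cuts α β ∧ z ≠ 1 ∧ Phid α β sq ξ₁ ξ₂ j z = 0} with hZ
  have hcount := hgas.2
  -- it suffices to have one zero when `ξ₁ = 0` and two zeros on the sheet of sign `|ξ₁|` otherwise
  by_cases hξ : ξ₁ = 0
  · have hB : {x : ℝ | (x = -α ^ 2 ∨ x = -β ^ 2) ∧ ∃ L : ℂ, L ≠ 0 ∧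
        Tendsto (fun t : ℝ => Phid α β sq ξ₁ ξ₂ 0 (t : ℂ))
          (nhdsWithin x (Set.Ioo (-α ^ 2) (-β ^ 2))) (nhds L)}.ncard ≤ 2 := by
      refine (Set.ncard_le_ncard (t := {-α ^ 2, -β ^ 2}) (fun x hx => hx.1)).trans ?_
      exact (Set.ncard_insert_le _ _).trans (by simp)
    have : ∃ j, (Z j).Nonempty := by
      by_contra hcon
      push Not at hcon
      have h0 := hcon 0
      have h1 := hcon 1
      simp only [hZ] at h0 h1
      rw [h0, h1] at hcount
      rw [Set.ncard_empty] at hcount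
      omega
    obtain ⟨j, z, hz⟩ := this
    obtain ⟨u, h1, h2, -, h4⟩ := h.phid_zero hgas j hz
    have h5 : (if j = 0 then ξ₁ else -ξ₁) = |ξ₁| := by simp [hξ]
    rw [h5] at h4
    exact ⟨u, h1, h2, h4, (hSpos _ u h1 h2).1 (hSneg _ u (by simp [hξ]) h1 h2)⟩
  · have hB : {x : ℝ | (x = -α ^ 2 ∨ x = -β ^ 2) ∧ ∃ L : ℂ, L ≠ 0 ∧
        Tendsto (fun t : ℝ => Phid α β sq ξ₁ ξ₂ 0 (t : ℂ))
          (nhdsWithin x (Set.Ioo (-α ^ 2) (-β ^ 2))) (nhds L)} = ∅ := by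
      rw [Set.eq_empty_iff_forall_notMem]
      rintro x ⟨hx, L, -, hL⟩
      exact h.branch_set_empty ξ₂ hξ hx hL
    rw [hB, Set.ncard_empty, add_zero] at hcount
    have hone : ∀ j : Fin 2, (if j = 0 then ξ₁ else -ξ₁) ≤ 0 → (Z j).ncard ≤ 1 := by
      intro j hj
      by_contra hcon
      push Not at hcon
      obtain ⟨x, hx, y, hy, hxy⟩ := (Set.one_lt_ncard (Set.finite_of_ncard_pos (by omega))).1 hcon
      obtain ⟨u, h1, h2, h3, h4⟩ := h.phid_zero hgas j hx
      obtain ⟨v, k1, k2, k3, k4⟩ := h.phid_zero hgas j hy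
      have hmono : StrictMonoOn (gapSlope c (if j = 0 then ξ₁ else -ξ₁) ξ₂) (Set.Ioo (-l) l) := by
        apply strictMonoOn_of_deriv_pos (convex_Ioo _ _)
        · intro w hw; exact (hd _ w hw.1 hw.2).continuousAt.continuousWithinAt
        · intro w hw
          rw [interior_Ioo] at hw
          rw [(hd _ w hw.1 hw.2).deriv]
          exact hSneg _ w hj hw.1 hw.2
      have : u = v := hmono.injOn ⟨h1, h2⟩ ⟨k1, k2⟩ (h4.trans k4.symm)
      exact hxy (by rw [h3, k3, this])
    obtain ⟨j, hj, hj2⟩ : ∃ j : Fin 2, (if j = 0 then ξ₁ else -ξ₁) = |ξ₁| ∧ 1 < (Z j).ncard := by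
      rcases le_total 0 ξ₁ with h0 | h0
      · refine ⟨0, by simp [abs_of_nonneg h0], ?_⟩
        have := hone 1 (by simpa using h0)
        simp only [hZ] at this ⊢
        omega
      · refine ⟨1, by simp [abs_of_nonpos h0], ?_⟩
        have := hone 0 (by simpa using h0)
        simp only [hZ] at this ⊢
        omega
    obtain ⟨x, hx, y, hy, hxy⟩ := (Set.one_lt_ncard (Set.finite_of_ncard_pos (by omega))).1 hj2
    obtain ⟨u, h1, h2, h3, h4⟩ := h.phid_zero hgas j hx
    obtain ⟨v, k1, k2, k3, k4⟩ := h.phid_zero hgas j hy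
    have huv : u ≠ v := by rintro rfl; exact hxy (h3.trans k3.symm)
    have hsimple : ∀ w, -l < w → w < l → gapSlope c |ξ₁| ξ₂ w = 0 → S |ξ₁| w ≠ 0 := by
      intro w w1 w2 w3
      have := hd |ξ₁| w w1 w2
      rw [← hj] at this w3 ⊢
      exact h.gapSlope_simple hgas j w1 w2 w3 this
    rw [hj] at h4 k4
    have : ∃ w, -l < w ∧ w < l ∧ gapSlope c |ξ₁| ξ₂ w = 0 ∧ 0 < S |ξ₁| w := by
      rcases lt_or_gt_of_ne huv with h5 | h5
      · exact exists_zero_deriv_pos (hd |ξ₁|) hsimple h1 h5 k2 h4 k4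
      · exact exists_zero_deriv_pos (hd |ξ₁|) hsimple k1 h5 h2 k4 h4
    obtain ⟨w, w1, w2, w3, w4⟩ := this
    exact ⟨w, w1, w2, w3, (hSpos _ w w1 w2).1 w4⟩

end IsBranch

namespace IsBranch

variable {α β : ℝ} {sq : ℂ → ℂ}

/-- The two contour parameters of the steepest descent analysis. -/
theorem exists_contours (h : IsBranch α β sq) {ξ₁ ξ₂ : ℝ} (hgas : GasPhase α β sq ξ₁ ξ₂) :
    ∃ p q : ℝ, |p| < q ∧ q < Real.log α ∧
      |ξ₁| * hs α β * (Real.cosh p ^ 4 - 2 * Real.cosh p ^ 2 + hs α β ^ 2) < gapu (hs α β) p ^ 3 ∧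
      |ξ₂| * (Real.cosh q ^ 4 - 2 * Real.cosh q ^ 2 + hs α β ^ 2) < Real.cosh q * Real.sinh q ^ 3 ∧
      gapPhase (hs α β) |ξ₁| ξ₂ p < gapPhase (hs α β) |ξ₁| |ξ₂| q := by
  obtain ⟨p, hp1, hp2, hK, hS⟩ := h.exists_gas_point hgas
  have hc := h.one_lt_hs
  have hg := gapu_pos (h.cosh_lt hp1 hp2)
  have hcp := Real.cosh_pos p
  have hcg : Real.cosh p ^ 2 = hs α β ^ 2 - gapu (hs α β) p ^ 2 := by
    rw [gapu_sq (h.cosh_lt hp1 hp2)]; ring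
  -- the sign of `p` is that of `ξ₂`
  have hpos : 0 < 1 - |ξ₁| * hs α β / gapu (hs α β) p := by
    rw [sub_pos, div_lt_one hg]
    have h1 : gapu (hs α β) p ^ 2 * (|ξ₁| * hs α β) < gapu (hs α β) p ^ 2 * gapu (hs α β) p := by
      refine lt_of_le_of_lt ?_ (hS.trans_eq (by ring))
      have h2 : gapu (hs α β) p ^ 2 ≤ Real.cosh p ^ 4 - 2 * Real.cosh p ^ 2 + hs α β ^ 2 := by
        have := Real.one_le_cosh p
        have : 1 ≤ Real.cosh p ^ 2 := by nlinarith
        nlinarith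
      have h3 : 0 ≤ |ξ₁| * hs α β := by positivity
      nlinarith
    exact lt_of_mul_lt_mul_left h1 (by positivity)
  have hslope : ξ₂ = Real.sinh p / Real.cosh p * (1 - |ξ₁| * hs α β / gapu (hs α β) p) := by
    unfold gapSlope at hK; linarith
  have hPcosh : Real.cosh |p| = Real.cosh p := Real.cosh_abs p
  have hPg : gapu (hs α β) |p| = gapu (hs α β) p := by unfold gapu; rw [hPcosh]
  have hPs : |ξ₂| = Real.sinh |p| / Real.cosh p * (1 - |ξ₁| * hs α β / gapu (hs α β) p) := by
    rw [hslope, abs_mul, abs_div, abs_of_pos hpos, abs_of_pos hcp, Real.abs_sinh]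
  have hpξ : p * ξ₂ = |ξ₂| * |p| := by
    rcases le_total 0 p with h0 | h0
    · have : 0 ≤ ξ₂ := by
        rw [hslope]; exact mul_nonneg (div_nonneg (Real.sinh_nonneg_iff.2 h0) hcp.le) hpos.le
      rw [abs_of_nonneg h0, abs_of_nonneg this]; ring
    · have : ξ₂ ≤ 0 := by
        rw [hslope]; exact mul_nonpos_of_nonpos_of_nonneg (div_nonpos_of_nonpos_of_nonneg (Real.sinh_nonpos_iff.2 h0) hcp.le) hpos.le
      rw [abs_of_nonpos h0, abs_of_nonpos this]; ring
  obtain ⟨q, hq1, hq2, hq3, hq4⟩ := exists_dual_point (c := hs α β) (η := |ξ₁|) (θ := |ξ₂|) (P := |p|)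
    (L := Real.log α) (abs_nonneg _) (abs_nonneg _) (abs_lt.2 ⟨hp1, hp2⟩) h.cosh_log
    (by rw [gapSlope, hPcosh, hPg, hPs, sub_self]) (by rw [hPcosh, hPg]; exact hS)
  refine ⟨p, q, hq1, hq2, hS, hq4, ?_⟩
  have : gapPhase (hs α β) |ξ₁| ξ₂ p = gapPhase (hs α β) |ξ₁| |ξ₂| |p| := by
    unfold gapPhase; rw [hPcosh, hPg, ← hpξ]; ring
  rw [this]; exact hq3

end IsBranch

/-- The factor of the double contour integrand depending on the outer variable. -/
noncomputable def hfun (α β : ℝ) (K : ℕ) (J j : ℤ) (c b : Fin 2) (z : ℂ) : ℂ :=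
  z ^ ((K : ℤ) - J - 1) * (-z) ^ (min j 0) * (z - 1) ^ (2 * K - j.natAbs) * polyQ α β j z c b

/-- The factor of the double contour integrand depending on the inner variable, without its pole
at `1`. -/
noncomputable def gfun (α β : ℝ) (X : ℂ → Matrix (Fin 2) (Fin 2) ℂ) (K : ℕ) (J k : ℤ) (a c : Fin 2)
    (w : ℂ) : ℂ :=
  w ^ (J - (K : ℤ)) * (-w) ^ (min k 0) * (polyQ α β k w * X w) a c

theorem hfun_differentiableAt (α β : ℝ) (K : ℕ) (J j : ℤ) (c b : Fin 2) {z : ℂ} (hz : z ≠ 0) :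
    DifferentiableAt ℂ (hfun α β K J j c b) z := by
  unfold hfun
  have h1 := (differentiable_polyQ α β j c b) z
  have h2 : DifferentiableAt ℂ (fun z : ℂ => z ^ ((K : ℤ) - J - 1)) z :=
    (differentiableAt_id).zpow (Or.inl hz)
  have h3 : DifferentiableAt ℂ (fun z : ℂ => (-z) ^ (min j 0)) z :=
    (differentiableAt_id.neg).zpow (Or.inl (neg_ne_zero.2 hz))
  fun_prop

theorem gfun_differentiableAt (α β : ℝ) {X : ℂ → Matrix (Fin 2) (Fin 2) ℂ} (K : ℕ) (J k : ℤ)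
    (a c : Fin 2) {w : ℂ} (hw : w ≠ 0) (hX : ∀ a b, DifferentiableAt ℂ (fun w => X w a b) w) :
    DifferentiableAt ℂ (gfun α β X K J k a c) w := by
  unfold gfun
  have h1 : DifferentiableAt ℂ (fun w => (polyQ α β k w * X w) a c) w := by
    simp only [Matrix.mul_apply]
    exact DifferentiableAt.fun_sum fun l _ => ((differentiable_polyQ α β k a l) w).mul (hX l c)
  have h2 : DifferentiableAt ℂ (fun z : ℂ => z ^ (J - (K : ℤ))) w :=
    (differentiableAt_id).zpow (Or.inl hw)
  have h3 : DifferentiableAt ℂ (fun z : ℂ => (-z) ^ (min k 0)) w :=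
    (differentiableAt_id.neg).zpow (Or.inl (neg_ne_zero.2 hw))
  exact (h2.mul h3).mul h1

theorem hfun_eq {α β : ℝ} (h : α * β = 1) {K : ℕ} {J j : ℤ} (hj : j.natAbs ≤ 2 * K) (c b : Fin 2) {z : ℂ}
    (h0 : z ≠ 0) (h1 : z ≠ 1) :
    hfun α β K J j c b z = z⁻¹ * (z ^ K * (z - 1) ^ (2 * K)) * (z ^ J)⁻¹ * (symbA α β z ^ j) c b := by
  have hz1 : z - 1 ≠ 0 := sub_ne_zero.2 h1
  rw [hfun, symbA_zpow h h0 h1, Matrix.smul_apply, smul_eq_mul, zpow_sub₀ h0, zpow_sub₀ h0, zpow_natCast, zpow_one,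
    pow_sub₀ _ hz1 hj, _root_.zpow_neg, ← Int.natCast_natAbs, zpow_natCast]
  field_simp

theorem gfun_eq {α β : ℝ} (h : α * β = 1) (X : ℂ → Matrix (Fin 2) (Fin 2) ℂ) (K : ℕ) (J k : ℤ) (a c : Fin 2) {w : ℂ}
    (h0 : w ≠ 0) (h1 : w ≠ 1) :
    ((w - 1) ^ (2 * K + k.natAbs))⁻¹ * gfun α β X K J k a c w =
      (w ^ K * (w - 1) ^ (2 * K))⁻¹ * w ^ J * (symbA α β w ^ k * X w) a c := by
  have hz1 : w - 1 ≠ 0 := sub_ne_zero.2 h1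
  rw [gfun, symbA_zpow h h0 h1, Matrix.smul_mul, Matrix.smul_apply, smul_eq_mul, zpow_sub₀ h0, zpow_natCast,
    pow_add, _root_.zpow_neg, ← Int.natCast_natAbs, zpow_natCast]
  field_simp

namespace IsBranch

variable {α β : ℝ} {sq : ℂ → ℂ}

theorem gfun_projF_differentiableOn (h : IsBranch α β sq) (K : ℕ) (J k : ℤ) (a c : Fin 2) :
    DifferentiableOn ℂ (gfun α β (projF α β sq) K J k a c) (cuts α β)ᶜ := fun _ hw =>
  (gfun_differentiableAt α β K J k a c (ne_zero_of_notMem_cuts hw) fun a b =>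
    (h.projF_differentiableOn a b).differentiableAt (isOpen_compl_cuts.mem_nhds hw)).differentiableWithinAt

theorem notMem_cuts_of_norm_sub_one {w : ℂ} (hw : ‖w - 1‖ ≤ 1 / 2) : w ∉ cuts α β := by
  rw [mem_cuts_iff]
  rintro ⟨-, h⟩
  have h1 : 1 / 2 ≤ w.re := by
    have := (abs_le.1 ((Complex.abs_re_le_norm (w - 1)).trans hw)).1
    simp at this; linarith
  rcases h with h | h
  · nlinarith [sq_nonneg α]
  · linarith [h.2]

theorem double_integral_eq (h : IsBranch α β sq) {K : ℕ} {J J' k j : ℤ} (hj : j.natAbs ≤ 2 * K) (a b : Fin 2) :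
    (∮ z in C(0, 3), z⁻¹ *
        ∮ w in C(1, 1 / 2), (z - w)⁻¹ *
          ((z ^ K * (z - 1) ^ (2 * K)) / (w ^ K * (w - 1) ^ (2 * K)) * w ^ J' * (z ^ J)⁻¹) *
          (symbA α β w ^ k * projF α β sq w * symbA α β z ^ j) a b) =
      ∑ c, ∮ z in C(0, 3), ∮ w in C(1, 1 / 2), (z - w)⁻¹ *
        (((w - 1) ^ (2 * K + k.natAbs))⁻¹ * gfun α β (projF α β sq) K J' k a c w * hfun α β K J j c b z) := by
  have hw : ∀ w ∈ Metric.sphere (1 : ℂ) (1 / 2), w ∉ cuts α β ∧ w ≠ 1 := by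
    intro w hw
    rw [Metric.mem_sphere, dist_eq_norm] at hw
    exact ⟨notMem_cuts_of_norm_sub_one hw.le, by rintro rfl; norm_num at hw⟩
  have hz : ∀ z ∈ Metric.sphere (0 : ℂ) 3, z ≠ 0 ∧ z ≠ 1 := by
    intro z hz
    rw [Metric.mem_sphere, dist_zero_right] at hz
    exact ⟨by rintro rfl; norm_num at hz, by rintro rfl; norm_num at hz⟩
  have hne : ∀ z ∈ Metric.sphere (0 : ℂ) 3, ∀ w ∈ Metric.sphere (1 : ℂ) (1 / 2), z ≠ w := by
    rintro z hz w hw rfl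
    rw [Metric.mem_sphere, dist_zero_right] at hz
    rw [Metric.mem_sphere, dist_eq_norm] at hw
    have := norm_add_le (z - 1) 1
    rw [sub_add_cancel, hw, hz, norm_one] at this; norm_num at this
  have hker : ∀ c, ContinuousOn (Function.uncurry fun z w => (z - w)⁻¹ *
      (((w - 1) ^ (2 * K + k.natAbs))⁻¹ * gfun α β (projF α β sq) K J' k a c w * hfun α β K J j c b z))
      (Metric.sphere (0 : ℂ) 3 ×ˢ Metric.sphere (1 : ℂ) (1 / 2)) := by
    intro c
    refine continuousOn_kernel (ContinuousOn.mul (ContinuousOn.inv₀ (by fun_prop) fun w h1 =>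
      pow_ne_zero _ (sub_ne_zero.2 (hw w h1).2)) ?_) ?_ hne
    · exact (h.gfun_projF_differentiableOn K J' k a c).continuousOn.mono fun w h1 => (hw w h1).1
    · exact fun z h1 => (hfun_differentiableAt α β K J j c b (hz z h1).1).continuousAt.continuousWithinAt
  have hint : ∀ c, CircleIntegrable (fun z => ∮ w in C(1, 1 / 2), (z - w)⁻¹ *
      (((w - 1) ^ (2 * K + k.natAbs))⁻¹ * gfun α β (projF α β sq) K J' k a c w * hfun α β K J j c b z)) 0 3 :=
    fun c => (continuousOn_circleIntegral (by norm_num) (hker c)).circleIntegrable (by norm_num)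
  have hint2 : ∀ c, ∀ z ∈ Metric.sphere (0 : ℂ) 3, CircleIntegrable (fun w => (z - w)⁻¹ *
      (((w - 1) ^ (2 * K + k.natAbs))⁻¹ * gfun α β (projF α β sq) K J' k a c w * hfun α β K J j c b z)) 1 (1 / 2) := by
    intro c z h1
    apply ContinuousOn.circleIntegrable (by norm_num)
    exact (hker c).comp (f := fun w => (z, w)) (by fun_prop) fun w hw => ⟨h1, hw⟩
  rw [Fin.sum_univ_two, ← circleIntegral.integral_add (hint 0) (hint 1)]
  apply circleIntegral.integral_congr (by norm_num)
  intro z h1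
  beta_reduce
  rw [← circleIntegral.integral_add (hint2 0 z h1) (hint2 1 z h1), ← circleIntegral.integral_const_mul]
  apply circleIntegral.integral_congr (by norm_num)
  intro w h2
  beta_reduce
  obtain ⟨h3, h4⟩ := hz z h1
  obtain ⟨h5, h6⟩ := hw w h2
  rw [gfun_eq h.mul_eq _ K J' k a 0 (ne_zero_of_notMem_cuts h5) h6, gfun_eq h.mul_eq _ K J' k a 1 (ne_zero_of_notMem_cuts h5) h6,
    hfun_eq h.mul_eq hj 0 b h3 h4, hfun_eq h.mul_eq hj 1 b h3 h4, Matrix.mul_apply, Fin.sum_univ_two, div_eq_mul_inv]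
  ring

/-- The residue of the double contour integrand on the diagonal. -/
theorem sum_residue_eq (h : IsBranch α β sq) {K : ℕ} {J J' k j : ℤ} (hj : j.natAbs ≤ 2 * K) (a b : Fin 2) {w : ℂ}
    (hw : w ∉ cuts α β) (h1 : w ≠ 1) :
    ∑ c, ((w - 1) ^ (2 * K + k.natAbs))⁻¹ * gfun α β (projF α β sq) K J' k a c w * hfun α β K J j c b w =
      w ^ (J' - J - 1) * (projF α β sq w * symbA α β w ^ (k + j)) a b := by
  have h0 := ne_zero_of_notMem_cuts hw
  have hz1 : w - 1 ≠ 0 := sub_ne_zero.2 h1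
  have e : ∀ c, ((w - 1) ^ (2 * K + k.natAbs))⁻¹ * gfun α β (projF α β sq) K J' k a c w * hfun α β K J j c b w =
      w ^ (J' - J - 1) * ((symbA α β w ^ k * projF α β sq w) a c * (symbA α β w ^ j) c b) := by
    intro c
    rw [gfun_eq h.mul_eq _ K J' k a c h0 h1, hfun_eq h.mul_eq hj c b h0 h1, zpow_sub₀ h0, zpow_sub₀ h0]
    field_simp
  simp only [e]
  rw [← Finset.mul_sum, ← Matrix.mul_apply, h.symbA_projF_symbA hw h1,
    (Matrix.Commute.zpow_right (h.commute_projF hw) (k + j)).eq]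

end IsBranch

namespace IsBranch

variable {α β : ℝ} {sq : ℂ → ℂ}

theorem eig1_ne_zero (h : IsBranch α β sq) {z : ℂ} (hz : z ∉ cuts α β) : eig1 α β sq z ≠ 0 := by
  rw [eig1, add_comm]
  exact mul_ne_zero (ne_zero_of_notMem_cuts hz) (h.slp_add_ne hz)

theorem eig1_differentiableOn (h : IsBranch α β sq) : DifferentiableOn ℂ (eig1 α β sq) (cuts α β)ᶜ := by
  have := h.slp_differentiableOn
  unfold eig1
  fun_prop

theorem projF_mul_symbA_zpow_neg (h : IsBranch α β sq) {z : ℂ} (hz : z ∉ cuts α β) (h1 : z ≠ 1) {n : ℤ} (hn : n ≤ 0) :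
    projF α β sq z * symbA α β z ^ n = ((z - 1) / eig1 α β sq z) ^ n.natAbs • projF α β sq z := by
  have h0 := ne_zero_of_notMem_cuts hz
  have hz1 : z - 1 ≠ 0 := sub_ne_zero.2 h1
  have he := h.eig1_ne_zero hz
  have e2 : eig2 α β sq z = -(z * (z - 1) ^ 2) / eig1 α β sq z := by
    rw [eq_div_iff he, mul_comm, h.eig1_mul_eig2 hz]
  rw [(Matrix.Commute.zpow_right (h.commute_projF hz) n).eq, symbA_zpow h.mul_eq h0 h1, Matrix.smul_mul,
    h.polyQ_mul_projF hz, smul_smul]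
  congr 1
  rcases hn.eq_or_lt with rfl | hn
  · simp
  · obtain ⟨k, rfl⟩ : ∃ k : ℕ, n = -(k : ℤ) := ⟨n.natAbs, by omega⟩
    rw [if_neg (by omega), e2, min_eq_left hn.le, abs_neg, Nat.abs_cast, Int.natAbs_neg, Int.natAbs_natCast,
      _root_.zpow_neg, _root_.zpow_neg, zpow_natCast, zpow_natCast, ← inv_pow, ← inv_pow, ← mul_pow, ← mul_pow]
    congr 1
    field_simp

theorem one_sub_projF_mul_symbA_zpow (h : IsBranch α β sq) {z : ℂ} (hz : z ∉ cuts α β) (h1 : z ≠ 1) {n : ℤ}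
    (hn : 0 < n) :
    (1 - projF α β sq z) * symbA α β z ^ n =
      (-(z * (z - 1)) / eig1 α β sq z) ^ n.natAbs • (1 - projF α β sq z) := by
  have h0 := ne_zero_of_notMem_cuts hz
  have hz1 : z - 1 ≠ 0 := sub_ne_zero.2 h1
  have he := h.eig1_ne_zero hz
  have e2 : eig2 α β sq z = -(z * (z - 1) ^ 2) / eig1 α β sq z := by
    rw [eq_div_iff he, mul_comm, h.eig1_mul_eig2 hz]
  have hc : Commute (1 - projF α β sq z) (symbA α β z) := (Commute.one_left _).sub_left (h.commute_projF hz)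
  rw [(Matrix.Commute.zpow_right hc n).eq, symbA_zpow h.mul_eq h0 h1, Matrix.smul_mul,
    h.polyQ_mul_one_sub hz, smul_smul]
  congr 1
  obtain ⟨k, rfl⟩ : ∃ k : ℕ, n = k := ⟨n.natAbs, by omega⟩
  rw [if_pos hn.le, e2, min_eq_right hn.le, Nat.abs_cast, Int.natAbs_natCast,
    _root_.zpow_neg, zpow_natCast, ← inv_pow, _root_.zpow_zero, mul_one, ← mul_pow]
  congr 1
  field_simp

/-- The residue term combines with the single integral of the finite kernel to the gas kernel. -/
theorem gas_residue (h : IsBranch α β sq) {ro : ℝ} (h1 : 1 < ro) (h2 : ro < α ^ 2) (d dm : ℤ) (a b : Fin 2) :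
    -(if dm < 0 then ∮ z in C(0, 3), z ^ (d - 1) * (symbA α β z ^ (-dm)) a b else 0) +
      (∮ w in C(0, ro), w ^ (d - 1) * (projF α β sq w * symbA α β w ^ (-dm)) a b) =
    ∮ z in C(0, (1 + β ^ 2) / 2),
      z ^ (d - 1) * ((projF α β sq z - (if dm < 0 then 1 else 0)) * symbA α β z ^ (-dm)) a b := by
  have hb1 : β ^ 2 < 1 := by have := h.beta_pos; have := h.beta_lt; nlinarith
  have hsph : ∀ r : ℝ, β ^ 2 < r → r < α ^ 2 → r ≠ 1 → ∀ w ∈ Metric.sphere (0 : ℂ) r, w ∉ cuts α β ∧ w ≠ 1 := by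
    intro r k1 k2 k3 w hw
    rw [Metric.mem_sphere, dist_zero_right] at hw
    exact ⟨h.notMem_cuts_of_norm (hw ▸ k1) (hw ▸ k2), by rintro rfl; rw [norm_one] at hw; exact k3 hw.symm⟩
  have hann : ∀ f : ℂ → ℂ, DifferentiableOn ℂ f (cuts α β)ᶜ →
      (∮ z in C(0, ro), f z) = ∮ z in C(0, (1 + β ^ 2) / 2), f z := by
    intro f hf
    refine circleIntegral_annulus (by nlinarith [sq_nonneg β]) (by linarith) fun w k1 k2 => ?_
    exact hf.differentiableAt (isOpen_compl_cuts.mem_nhds (h.notMem_cuts_of_norm (by linarith) (by linarith)))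
  have hzp : DifferentiableOn ℂ (fun z : ℂ => z ^ (d - 1)) (cuts α β)ᶜ := by
    intro z hz
    have hz0 : z ≠ 0 := ne_zero_of_notMem_cuts hz
    exact ((differentiableAt_id).zpow (Or.inl hz0)).differentiableWithinAt
  have hF := h.projF_differentiableOn a b
  have hE := h.eig1_differentiableOn
  have hso := hsph ro (by linarith) h2 h1.ne'
  have hsi := hsph ((1 + β ^ 2) / 2) (by linarith) (by linarith) (by linarith)
  have hEne : ∀ z ∈ (cuts α β)ᶜ, eig1 α β sq z ≠ 0 := fun z hz => h.eig1_ne_zero hz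
  by_cases hdm : dm < 0
  · simp only [if_pos hdm]
    have e3 : (∮ z in C(0, 3), z ^ (d - 1) * (symbA α β z ^ (-dm)) a b) =
        ∮ z in C(0, ro), z ^ (d - 1) * (symbA α β z ^ (-dm)) a b := by
      have hd : ∀ z : ℂ, 1 < ‖z‖ → DifferentiableAt ℂ (fun z => z ^ (d - 1) * (symbA α β z ^ (-dm)) a b) z := by
        intro z hz
        have hz0 : z ≠ 0 := by rintro rfl; norm_num at hz
        have hz1 : z - 1 ≠ 0 := by rw [sub_ne_zero]; rintro rfl; norm_num at hz
        refine DifferentiableAt.mul ((differentiableAt_id).zpow (Or.inl hz0)) ?_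
        obtain ⟨k, hk⟩ : ∃ k : ℕ, -dm = k := ⟨dm.natAbs, by omega⟩
        have e : (fun z => (symbA α β z ^ (-dm)) a b) = fun z => ((z - 1)⁻¹) ^ k * (numB α β z ^ k) a b := by
          ext z
          rw [hk, zpow_natCast, symbA_eq, smul_pow, Matrix.smul_apply, smul_eq_mul]
        rw [e]
        have := differentiable_pow_entry (differentiable_numB α β) k a b z
        exact (((differentiableAt_id.sub_const (1 : ℂ)).inv hz1).pow k).mul this
      rcases le_total ro 3 with h3 | h3
      · exact circleIntegral_annulus (by linarith) h3 fun w k1 _ => hd w (by linarith)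
      · exact (circleIntegral_annulus (by linarith) h3 fun w k1 _ => hd w (by linarith)).symm
    set f : ℂ → ℂ := fun z => z ^ (d - 1) * -((-(z * (z - 1)) / eig1 α β sq z) ^ (-dm).natAbs *
      ((1 : Matrix (Fin 2) (Fin 2) ℂ) a b - projF α β sq z a b)) with hf
    have hfd : DifferentiableOn ℂ f (cuts α β)ᶜ := by
      refine hzp.mul (DifferentiableOn.neg ?_)
      exact (DifferentiableOn.pow (DifferentiableOn.div (by fun_prop) hE hEne) _).mul (hF.const_sub _)
    have key : ∀ z, z ∉ cuts α β ∧ z ≠ 1 → z ^ (d - 1) * ((projF α β sq z - 1) * symbA α β z ^ (-dm)) a b = f z := by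
      rintro z ⟨k1, k2⟩
      have := h.one_sub_projF_mul_symbA_zpow k1 k2 (n := -dm) (by omega)
      rw [← neg_sub (1 : Matrix (Fin 2) (Fin 2) ℂ), Matrix.neg_mul, this, hf]
      simp
    rw [e3, circleIntegral.integral_congr (by nlinarith [sq_nonneg β]) fun z hz => key z (hsi z hz), ← hann f hfd,
      ← circleIntegral.integral_congr (by linarith) fun z hz => key z (hso z hz)]
    have ci : ∀ (X : ℂ → Matrix (Fin 2) (Fin 2) ℂ), (∀ a b, DifferentiableOn ℂ (fun z => X z a b) (cuts α β)ᶜ) →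
        CircleIntegrable (fun w => w ^ (d - 1) * (X w * symbA α β w ^ (-dm)) a b) 0 ro := by
      intro X hX
      apply ContinuousOn.circleIntegrable (by linarith)
      refine (hzp.continuousOn.mono fun z hz => (hso z hz).1).mul ?_
      obtain ⟨k, hk⟩ : ∃ k : ℕ, -dm = k := ⟨dm.natAbs, by omega⟩
      have e : (fun z => (X z * symbA α β z ^ (-dm)) a b) = fun z => ∑ c, X z a c * (((z - 1)⁻¹) ^ k * (numB α β z ^ k) c b) := by
        ext z
        rw [hk, zpow_natCast, symbA_eq, smul_pow, Matrix.mul_apply]; rfl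
      rw [e]
      refine continuousOn_finsetSum _ fun c _ => ((hX a c).continuousOn.mono fun z hz => (hso z hz).1).mul ?_
      refine ContinuousOn.mul (ContinuousOn.pow (ContinuousOn.inv₀ (by fun_prop) fun z hz => sub_ne_zero.2 (hso z hz).2) k) ?_
      exact (differentiable_pow_entry (differentiable_numB α β) k c b).continuous.continuousOn
    rw [neg_add_eq_sub]
    have c1 := ci _ h.projF_differentiableOn
    have c2 := ci (fun _ => 1) fun a b => differentiableOn_const ((1 : Matrix (Fin 2) (Fin 2) ℂ) a b)
    simp only [Matrix.one_mul] at c2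
    rw [← circleIntegral.integral_sub c1 c2]
    congr 1
    ext z
    rw [Matrix.sub_mul, Matrix.one_mul, Matrix.sub_apply]; ring
  · simp only [if_neg hdm, neg_zero, zero_add, sub_zero]
    set f : ℂ → ℂ := fun z => z ^ (d - 1) * (((z - 1) / eig1 α β sq z) ^ (-dm).natAbs * projF α β sq z a b) with hf
    have hfd : DifferentiableOn ℂ f (cuts α β)ᶜ := by
      refine hzp.mul ?_
      exact (DifferentiableOn.pow (DifferentiableOn.div (by fun_prop) hE hEne) _).mul hF
    have key : ∀ z, z ∉ cuts α β ∧ z ≠ 1 → z ^ (d - 1) * (projF α β sq z * symbA α β z ^ (-dm)) a b = f z := by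
      rintro z ⟨k1, k2⟩
      have := h.projF_mul_symbA_zpow_neg k1 k2 (n := -dm) (by omega)
      rw [this, hf]
      simp
    rw [circleIntegral.integral_congr (by linarith) fun z hz => key z (hso z hz), hann f hfd,
      ← circleIntegral.integral_congr (by nlinarith [sq_nonneg β]) fun z hz => key z (hsi z hz)]

end IsBranch

namespace IsBranch

variable {α β : ℝ} {sq : ℂ → ℂ}

/-- The finite kernel is the gas kernel plus a double contour integral on separated contours. -/
theorem KN_eq (h : IsBranch α β sq) {K : ℕ} {m n dm dn : ℤ} (hmn : Even (m + n)) (hd : Even (dm + dn))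
    (hm : (m - 2 * K).natAbs ≤ 2 * K) {ri ro r : ℝ} (hi0 : β ^ 2 < ri) (hi1 : ri < 1) (ho1 : 1 < ro) (ho : ro < α ^ 2)
    (hir : ri < r) (hro : r < ro) (a b : Fin 2) :
    KN α β sq (2 * K) m n (m + dm) (n + dn) a b = Kgas α β sq dm dn a b +
      (2 * (Real.pi : ℂ) * Complex.I)⁻¹ * (2 * (Real.pi : ℂ) * Complex.I)⁻¹ *
      ∑ c, ∮ z in C(0, r),
        ((∮ w in C(0, ro), (z - w)⁻¹ * (((w - 1) ^ (2 * K + (2 * K - (m + dm)).natAbs))⁻¹ *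
          gfun α β (projF α β sq) K ((m + dm + (n + dn)) / 2) (2 * K - (m + dm)) a c w *
          hfun α β K ((m + n) / 2) (m - 2 * K) c b z)) -
        ∮ w in C(0, ri), (z - w)⁻¹ * (((w - 1) ^ (2 * K + (2 * K - (m + dm)).natAbs))⁻¹ *
          gfun α β (projF α β sq) K ((m + dm + (n + dn)) / 2) (2 * K - (m + dm)) a c w *
          hfun α β K ((m + n) / 2) (m - 2 * K) c b z)) := by
  set J := (m + n) / 2 with hJ
  set J' := (m + dm + (n + dn)) / 2 with hJ'
  set d := (dm + dn) / 2 with hdd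
  have hJJ : J' - J = d := by obtain ⟨x, hx⟩ := hmn; obtain ⟨y, hy⟩ := hd; omega
  have hdbl := h.double_integral_eq (K := K) (J := J) (J' := J') (k := 2 * K - (m + dm)) (j := m - 2 * K) hm a b
  have hI : (2 * (Real.pi : ℂ) * Complex.I) ≠ 0 := by simp [Real.pi_ne_zero]
  have hdc : ∀ c, _ := fun c => double_contour (isOpen_compl_cuts (α := α) (β := β)) (by nlinarith [sq_nonneg β]) hi1 ho1 hir hro
    (fun w h1 h2 => h.notMem_cuts_of_norm (by linarith) (by linarith))
    (fun w h1 => notMem_cuts_of_norm_sub_one h1) (2 * K + (2 * K - (m + dm)).natAbs)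
    (h.gfun_projF_differentiableOn K J' (2 * K - (m + dm)) a c)
    (h := hfun α β K J (m - 2 * K) c b) (fun z hz => hfun_differentiableAt α β K J _ c b hz)
  have hsph : ∀ w ∈ Metric.sphere (0 : ℂ) ro, w ∉ cuts α β ∧ w ≠ 1 := by
    intro w hw
    rw [Metric.mem_sphere, dist_zero_right] at hw
    exact ⟨h.notMem_cuts_of_norm (by linarith) (by linarith), by rintro rfl; rw [norm_one] at hw; linarith⟩
  have hres : ∑ c, (∮ w in C(0, ro), ((w - 1) ^ (2 * K + (2 * K - (m + dm)).natAbs))⁻¹ *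
      gfun α β (projF α β sq) K J' (2 * K - (m + dm)) a c w * hfun α β K J (m - 2 * K) c b w) =
      ∮ w in C(0, ro), w ^ (d - 1) * (projF α β sq w * symbA α β w ^ (-dm)) a b := by
    have ci : ∀ c, CircleIntegrable (fun w => ((w - 1) ^ (2 * K + (2 * K - (m + dm)).natAbs))⁻¹ *
      gfun α β (projF α β sq) K J' (2 * K - (m + dm)) a c w * hfun α β K J (m - 2 * K) c b w) 0 ro := by
      intro c
      apply ContinuousOn.circleIntegrable (by linarith)
      refine ContinuousOn.mul (ContinuousOn.mul (ContinuousOn.inv₀ (by fun_prop) fun w h1 =>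
        pow_ne_zero _ (sub_ne_zero.2 (hsph w h1).2)) ?_) ?_
      · exact (h.gfun_projF_differentiableOn K J' _ a c).continuousOn.mono fun w h1 => (hsph w h1).1
      · exact fun z h1 => (hfun_differentiableAt α β K J _ c b
          (ne_zero_of_notMem_cuts (hsph z h1).1)).continuousAt.continuousWithinAt
    rw [Fin.sum_univ_two, ← circleIntegral.integral_add (ci 0) (ci 1)]
    apply circleIntegral.integral_congr (by linarith)
    intro w hw
    have := h.sum_residue_eq (K := K) (J := J) (J' := J') (k := 2 * K - (m + dm)) hm a b (hsph w hw).1 (hsph w hw).2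
    rw [Fin.sum_univ_two] at this
    beta_reduce
    rw [this, hJJ]
    rw [show 2 * (K : ℤ) - (m + dm) + (m - 2 * K) = -dm by ring]
  have hg := h.gas_residue ho1 ho d dm a b
  have hlhs : KN α β sq (2 * K) m n (m + dm) (n + dn) a b =
      -(if dm < 0 then (2 * (Real.pi : ℂ) * Complex.I)⁻¹ * ∮ z in C(0, 3), z ^ (d - 1) * (symbA α β z ^ (-dm)) a b else 0) +
      (2 * (Real.pi : ℂ) * Complex.I)⁻¹ * (2 * (Real.pi : ℂ) * Complex.I)⁻¹ *
      (∮ z in C(0, 3), z⁻¹ *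
        ∮ w in C(1, 1 / 2), (z - w)⁻¹ *
          ((z ^ K * (z - 1) ^ (2 * K)) / (w ^ K * (w - 1) ^ (2 * K)) * w ^ J' * (z ^ J)⁻¹) *
          (symbA α β w ^ (2 * K - (m + dm)) * projF α β sq w * symbA α β z ^ (m - 2 * K)) a b) := by
    have e1 : 2 * K / 2 = K := by omega
    have e2 : m - (m + dm) = -dm := by ring
    rw [KN, Matrix.add_apply, Matrix.neg_apply]
    simp only [e1, e2, Nat.cast_mul, Nat.cast_ofNat, ← hJ, ← hJ', hJJ, Matrix.of_apply]
    congr 2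
    have : m + dm < m ↔ dm < 0 := by omega
    by_cases hdm : dm < 0
    · rw [if_pos hdm, if_pos (this.2 hdm), Matrix.of_apply]
    · rw [if_neg hdm, if_neg (mt this.1 hdm), Matrix.zero_apply]
  have hK : Kgas α β sq dm dn a b = (2 * (Real.pi : ℂ) * Complex.I)⁻¹ * ∮ z in C(0, (1 + β ^ 2) / 2),
      z ^ (d - 1) * ((projF α β sq z - (if dm < 0 then 1 else 0)) * symbA α β z ^ (-dm)) a b := rfl
  rw [hlhs, hdbl, Finset.sum_congr rfl fun c _ => hdc c, Finset.sum_add_distrib, ← Finset.mul_sum, hres, hK, ← hg]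
  split_ifs <;> field_simp <;> ring

end IsBranch

/-- The quotient `numB ^ 2 / z`. -/
noncomputable def sqB (α β : ℝ) (z : ℂ) : Matrix (Fin 2) (Fin 2) ℂ :=
  !![4 * (α : ℂ) ^ 2 * z + (z + 1) ^ 2, 2 * (α : ℂ) * ((α : ℂ) + β) * (z + 1);
    2 * (β : ℂ) * ((α : ℂ) + β) * z * (z + 1), (z + 1) ^ 2 + 4 * (β : ℂ) ^ 2 * z]

theorem numB_sq {α β : ℝ} (h : α * β = 1) (z : ℂ) : numB α β z ^ 2 = z • sqB α β z := by
  have h2 : (α : ℂ) * β = 1 := by exact_mod_cast h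
  ext i j
  fin_cases i <;> fin_cases j <;> simp [numB, sqB, pow_two]
  · linear_combination (z * (z + 1) ^ 2) * h2
  · ring
  · ring
  · linear_combination (z * (z + 1) ^ 2) * h2

theorem numB_pow {α β : ℝ} (h : α * β = 1) (z : ℂ) (k : ℕ) :
    numB α β z ^ k = z ^ (k / 2) • (sqB α β z ^ (k / 2) * numB α β z ^ (k % 2)) := by
  conv_lhs => rw [← Nat.div_add_mod k 2, pow_add, pow_mul, numB_sq h, smul_pow, Matrix.smul_mul]

theorem differentiable_sqB (α β : ℝ) (i j : Fin 2) : Differentiable ℂ fun z => sqB α β z i j := by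
  fin_cases i <;> fin_cases j <;> simp [sqB] <;> fun_prop

theorem differentiable_mul_entry {M N : ℂ → Matrix (Fin 2) (Fin 2) ℂ}
    (hM : ∀ i j, Differentiable ℂ fun z => M z i j) (hN : ∀ i j, Differentiable ℂ fun z => N z i j) (i j : Fin 2) :
    Differentiable ℂ fun z => (M z * N z) i j := by
  simp only [Matrix.mul_apply]
  exact Differentiable.fun_sum fun l _ => (hM i l).mul (hN l j)

/-- A polynomial matrix of degree at most two has a reversal with entire entries. -/
theorem exists_reversal_sqB (α β : ℝ) : ∃ M : ℂ → Matrix (Fin 2) (Fin 2) ℂ,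
    (∀ i j, Differentiable ℂ fun z => M z i j) ∧ ∀ s : ℂ, s ≠ 0 → sqB α β s⁻¹ = (s ^ 2)⁻¹ • M s := by
  refine ⟨fun z => !![4 * (α : ℂ) ^ 2 * z + (z + 1) ^ 2, 2 * (α : ℂ) * ((α : ℂ) + β) * (z + z ^ 2);
    2 * (β : ℂ) * ((α : ℂ) + β) * (z + 1), (z + 1) ^ 2 + 4 * (β : ℂ) ^ 2 * z], ?_, ?_⟩
  · intro i j
    fin_cases i <;> fin_cases j <;> simp <;> fun_prop
  · intro s hs
    ext i j
    fin_cases i <;> fin_cases j <;> simp [sqB] <;> field_simp <;> ring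

theorem exists_reversal_numB (α β : ℝ) : ∃ M : ℂ → Matrix (Fin 2) (Fin 2) ℂ,
    (∀ i j, Differentiable ℂ fun z => M z i j) ∧ ∀ s : ℂ, s ≠ 0 → numB α β s⁻¹ = (s ^ 2)⁻¹ • M s := by
  refine ⟨fun z => !![2 * (α : ℂ) * z, (α : ℂ) * (z + z ^ 2); (β : ℂ) * (z + 1), 2 * (β : ℂ) * z], ?_, ?_⟩
  · intro i j
    fin_cases i <;> fin_cases j <;> simp <;> fun_prop
  · intro s hs
    ext i j
    fin_cases i <;> fin_cases j <;> simp [numB] <;> field_simp <;> ring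

theorem circleIntegral_numB_inner {α β : ℝ} (h : α * β = 1) {ρ : ℝ} (h0 : 0 < ρ) (h1 : ρ < 1) {z : ℂ} (hz : ρ < ‖z‖)
    (M k : ℕ) {e : ℤ} (he : 0 ≤ e + ((k / 2 : ℕ) : ℤ)) (a c : Fin 2) :
    (∮ w in C(0, ρ), (z - w)⁻¹ * (((w - 1) ^ M)⁻¹ * (w ^ e * (numB α β w ^ k) a c))) = 0 := by
  set U : ℂ → Matrix (Fin 2) (Fin 2) ℂ := fun w => sqB α β w ^ (k / 2) * numB α β w ^ (k % 2) with hU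
  have hUd : ∀ i j, Differentiable ℂ fun w => U w i j :=
    differentiable_mul_entry (differentiable_pow_entry (differentiable_sqB α β) _)
      (differentiable_pow_entry (differentiable_numB α β) _)
  have : ∀ w ∈ Metric.sphere (0 : ℂ) ρ, (z - w)⁻¹ * (((w - 1) ^ M)⁻¹ * (w ^ e * (numB α β w ^ k) a c)) =
      (z - w)⁻¹ * (((w - 1) ^ M)⁻¹ * (w ^ (e + ((k / 2 : ℕ) : ℤ)).toNat * U w a c)) := by
    intro w hw
    have hw0 : w ≠ 0 := by rintro rfl; simp at hw; exact h0.ne hw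
    rw [numB_pow h, Matrix.smul_apply, smul_eq_mul, ← mul_assoc (w ^ e), ← zpow_natCast w (k / 2), ← zpow_add₀ hw0,
      ← zpow_natCast w, Int.toNat_of_nonneg he]
  rw [circleIntegral.integral_congr h0.le this]
  apply circleIntegral_disc h0.le
  intro w hw
  rw [sub_zero] at hw
  have k1 : z - w ≠ 0 := by rw [sub_ne_zero]; rintro rfl; linarith
  have k2 : (w - 1) ^ M ≠ 0 := pow_ne_zero _ (by rw [sub_ne_zero]; rintro rfl; rw [norm_one] at hw; linarith)
  have k3 := hUd a c w
  exact ((differentiableAt_id.const_sub z).inv k1).mul ((((differentiableAt_id.sub_const (1 : ℂ)).pow M).inv k2).mul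
    ((differentiableAt_id.pow _).mul k3))

theorem circleIntegral_numB_outer {α β : ℝ} (h : α * β = 1) {ρ : ℝ} (h1 : 1 < ρ) {z : ℂ} (hz : ‖z‖ < ρ)
    (M k : ℕ) {e : ℤ} (he : e + 3 * ((k / 2 : ℕ) : ℤ) + 2 * ((k % 2 : ℕ) : ℤ) + 1 ≤ M) (a c : Fin 2) :
    (∮ w in C(0, ρ), (z - w)⁻¹ * (((w - 1) ^ M)⁻¹ * (w ^ e * (numB α β w ^ k) a c))) = 0 := by
  obtain ⟨V, hVd, hV⟩ := exists_reversal_sqB α β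
  obtain ⟨B, hBd, hB⟩ := exists_reversal_numB α β
  have h0 : 0 < ρ := by linarith
  have hi : 0 < ρ⁻¹ := inv_pos.2 h0
  have hi1 : ρ⁻¹ < 1 := inv_lt_one_of_one_lt₀ h1
  set U : ℂ → Matrix (Fin 2) (Fin 2) ℂ := fun w => V w ^ (k / 2) * B w ^ (k % 2) with hU
  have hUd : ∀ i j, Differentiable ℂ fun w => U w i j :=
    differentiable_mul_entry (differentiable_pow_entry hVd _) (differentiable_pow_entry hBd _)
  set t : ℕ := (M - e - 3 * ((k / 2 : ℕ) : ℤ) - 2 * ((k % 2 : ℕ) : ℤ) - 1 : ℤ).toNat with ht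
  have hte : (t : ℤ) = M - e - 3 * ((k / 2 : ℕ) : ℤ) - 2 * ((k % 2 : ℕ) : ℤ) - 1 := Int.toNat_of_nonneg (by omega)
  have hrev := circleIntegral_inv (fun w => (z - w)⁻¹ * (((w - 1) ^ M)⁻¹ * (w ^ e * (numB α β w ^ k) a c))) hi
  rw [inv_inv] at hrev
  rw [hrev]
  have key : ∀ s ∈ Metric.sphere (0 : ℂ) ρ⁻¹,
      (z - s⁻¹)⁻¹ * (((s⁻¹ - 1) ^ M)⁻¹ * (s⁻¹ ^ e * (numB α β s⁻¹ ^ k) a c)) * (s ^ 2)⁻¹ =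
      (z * s - 1)⁻¹ * (((1 - s) ^ M)⁻¹ * (s ^ t * U s a c)) := by
    intro s hs
    rw [Metric.mem_sphere, dist_zero_right] at hs
    have hs0 : s ≠ 0 := by rintro rfl; rw [norm_zero] at hs; linarith
    have hs1 : 1 - s ≠ 0 := by rw [sub_ne_zero]; rintro rfl; rw [norm_one] at hs; linarith
    have hzs : z * s - 1 ≠ 0 := by
      rw [sub_ne_zero]; intro h2
      have := congrArg norm h2
      rw [norm_mul, hs, norm_one] at this
      have : ‖z‖ = ρ := by field_simp at this; linarith
      linarith
    have e1 : z - s⁻¹ = (z * s - 1) / s := by field_simp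
    have e2 : s⁻¹ - 1 = (1 - s) / s := by field_simp
    have e3 : (numB α β s⁻¹ ^ k) a c = (s ^ (k / 2))⁻¹ * ((s ^ 2) ^ (k / 2))⁻¹ * ((s ^ 2) ^ (k % 2))⁻¹ * U s a c := by
      rw [numB_pow h, hV s hs0, hB s hs0, smul_pow, smul_pow, smul_mul_smul_comm, smul_smul, Matrix.smul_apply, smul_eq_mul]
      simp only [inv_pow]; ring
    have e4 : s ^ t = s ^ M * (s ^ e)⁻¹ * ((s ^ (k / 2))⁻¹ * ((s ^ 2) ^ (k / 2))⁻¹ * ((s ^ 2) ^ (k % 2))⁻¹) * s⁻¹ := by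
      rw [← zpow_natCast s t, hte, zpow_sub₀ hs0, zpow_sub₀ hs0, zpow_sub₀ hs0, zpow_sub₀ hs0, zpow_natCast, zpow_one,
        show 3 * ((k / 2 : ℕ) : ℤ) = ((k / 2 + 2 * (k / 2) : ℕ) : ℤ) by push_cast; ring,
        show 2 * ((k % 2 : ℕ) : ℤ) = ((2 * (k % 2) : ℕ) : ℤ) by push_cast; ring, zpow_natCast, zpow_natCast, pow_add,
        pow_mul, pow_mul]
      field_simp
    rw [e1, e2, e3, e4, div_pow, _root_.inv_zpow]
    field_simp
  rw [circleIntegral.integral_congr hi.le key]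
  apply circleIntegral_disc hi.le
  intro s hs
  rw [sub_zero] at hs
  have hs1 : (1 - s) ^ M ≠ 0 := pow_ne_zero _ (by rw [sub_ne_zero]; rintro rfl; rw [norm_one] at hs; linarith)
  have hzs : z * s - 1 ≠ 0 := by
    rw [sub_ne_zero]; intro h2
    have := congrArg norm h2
    rw [norm_mul, norm_one] at this
    have h3 : ‖z‖ * ‖s‖ ≤ ‖z‖ * ρ⁻¹ := mul_le_mul_of_nonneg_left hs (norm_nonneg _)
    have h4 : ‖z‖ * ρ⁻¹ < 1 := by rw [← div_eq_mul_inv, div_lt_one h0]; exact hz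
    linarith
  have k3 := hUd a c s
  exact ((((differentiableAt_id.const_mul z).sub_const (1 : ℂ)).inv hzs)).mul
    ((((differentiableAt_id.const_sub (1 : ℂ)).pow M).inv hs1).mul ((differentiableAt_id.pow _).mul k3))

/-- The projection `F`, or `F - 1` when `0 < k`: the one on which `symbA ^ k` contracts. -/
noncomputable def subF (α β : ℝ) (sq : ℂ → ℂ) (k : ℤ) (w : ℂ) : Matrix (Fin 2) (Fin 2) ℂ :=
  if 0 < k then projF α β sq w - 1 else projF α β sq w

namespace IsBranch

variable {α β : ℝ} {sq : ℂ → ℂ}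

theorem subF_differentiableOn (h : IsBranch α β sq) (k : ℤ) (a b : Fin 2) :
    DifferentiableOn ℂ (fun w => subF α β sq k w a b) (cuts α β)ᶜ := by
  unfold subF
  split_ifs
  · simp only [Matrix.sub_apply]
    exact (h.projF_differentiableOn a b).sub_const _
  · exact h.projF_differentiableOn a b

theorem gfun_subF_differentiableOn (h : IsBranch α β sq) (K : ℕ) (J k : ℤ) (a c : Fin 2) :
    DifferentiableOn ℂ (gfun α β (subF α β sq k) K J k a c) (cuts α β)ᶜ := fun _ hw =>
  (gfun_differentiableAt α β K J k a c (ne_zero_of_notMem_cuts hw) fun a b =>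
    (h.subF_differentiableOn k a b).differentiableAt (isOpen_compl_cuts.mem_nhds hw)).differentiableWithinAt

theorem polyQ_mul_subF (h : IsBranch α β sq) {w : ℂ} (hw : w ∉ cuts α β) (k : ℤ) :
    polyQ α β k w * subF α β sq k w = eig2 α β sq w ^ k.natAbs • subF α β sq k w := by
  unfold subF
  split_ifs with hk
  · have := h.polyQ_mul_one_sub hw k
    rw [if_pos hk.le] at this
    rw [← neg_sub, mul_neg, this, smul_neg]
  · rw [h.polyQ_mul_projF hw]
    split_ifs with h0
    · have : k = 0 := by omega
      simp [this]
    · rfl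

theorem gfun_projF_eq (K : ℕ) {J k : ℤ} (hk : 0 < k) (a c : Fin 2) (w : ℂ) :
    gfun α β (projF α β sq) K J k a c w =
      gfun α β (subF α β sq k) K J k a c w + w ^ (J - (K : ℤ)) * (numB α β w ^ k.natAbs) a c := by
  have e : polyQ α β k w * subF α β sq k w = polyQ α β k w * projF α β sq w - polyQ α β k w := by
    rw [subF, if_pos hk, mul_sub, mul_one]
  have e2 : polyQ α β k w = numB α β w ^ k.natAbs := by rw [polyQ, if_pos hk.le]
  rw [gfun, gfun, e, Matrix.sub_apply, min_eq_right hk.le, _root_.zpow_zero, e2]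
  ring

/-- On a circle on which the polynomial part integrates to zero, `projF` may be replaced by `subF`. -/
theorem circleIntegral_gfun_subF (h : IsBranch α β sq) {ρ : ℝ} (h0 : β ^ 2 < ρ) (h1 : ρ < α ^ 2) (h2 : ρ ≠ 1) {z : ℂ}
    (hz : ‖z‖ ≠ ρ) (K M : ℕ) (J k : ℤ) (a c : Fin 2)
    (hv : 0 < k → (∮ w in C(0, ρ), (z - w)⁻¹ *
      (((w - 1) ^ M)⁻¹ * (w ^ (J - (K : ℤ)) * (numB α β w ^ k.natAbs) a c))) = 0) (H : ℂ) :
    (∮ w in C(0, ρ), (z - w)⁻¹ * (((w - 1) ^ M)⁻¹ * gfun α β (projF α β sq) K J k a c w * H)) =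
      (∮ w in C(0, ρ), (z - w)⁻¹ * (((w - 1) ^ M)⁻¹ * gfun α β (subF α β sq k) K J k a c w)) * H := by
  have hρ : 0 < ρ := lt_of_le_of_lt (sq_nonneg β) h0
  have hw : ∀ w ∈ Metric.sphere (0 : ℂ) ρ, w ∉ cuts α β ∧ w ≠ 1 ∧ z - w ≠ 0 := by
    intro w hw
    rw [Metric.mem_sphere, dist_zero_right] at hw
    refine ⟨h.notMem_cuts_of_norm (by linarith) (by linarith), ?_, ?_⟩
    · rintro rfl; rw [norm_one] at hw; exact h2 hw.symm
    · intro e; rw [sub_eq_zero] at e; rw [e] at hz; exact hz hw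
  have hpole : ContinuousOn (fun w : ℂ => (z - w)⁻¹) (Metric.sphere 0 ρ) :=
    ContinuousOn.inv₀ (by fun_prop) fun w k => (hw w k).2.2
  have hpow : ContinuousOn (fun w : ℂ => ((w - 1) ^ M)⁻¹) (Metric.sphere 0 ρ) :=
    ContinuousOn.inv₀ (by fun_prop) fun w k => pow_ne_zero _ (sub_ne_zero.2 (hw w k).2.1)
  have i1 : CircleIntegrable (fun w => (z - w)⁻¹ * (((w - 1) ^ M)⁻¹ * gfun α β (subF α β sq k) K J k a c w)) 0 ρ :=
    (hpole.mul (hpow.mul ((h.gfun_subF_differentiableOn K J k a c).continuousOn.mono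
      fun w k => (hw w k).1))).circleIntegrable hρ.le
  rw [← smul_eq_mul (b := H), ← circleIntegral.integral_smul_const]
  by_cases hk : 0 < k
  · have hz1 : ContinuousOn (fun w : ℂ => w ^ (J - (K : ℤ))) (Metric.sphere 0 ρ) :=
      continuousOn_id.zpow₀ _ fun w k => Or.inl (ne_zero_of_notMem_cuts (hw w k).1)
    have i2 : CircleIntegrable (fun w => (z - w)⁻¹ *
        (((w - 1) ^ M)⁻¹ * (w ^ (J - (K : ℤ)) * (numB α β w ^ k.natAbs) a c))) 0 ρ :=
      (hpole.mul (hpow.mul (hz1.mul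
        (differentiable_pow_entry (differentiable_numB α β) _ a c).continuous.continuousOn))).circleIntegrable hρ.le
    have e := circleIntegral.integral_add i1 i2
    rw [hv hk, add_zero] at e
    rw [circleIntegral.integral_smul_const, ← e, ← circleIntegral.integral_smul_const]
    refine circleIntegral.integral_congr hρ.le fun w _ => ?_
    rw [gfun_projF_eq K hk, smul_eq_mul]
    ring
  · refine circleIntegral.integral_congr hρ.le fun w _ => ?_
    have : subF α β sq k = projF α β sq := by funext w; rw [subF, if_neg hk]
    rw [this, smul_eq_mul]; ring

theorem norm_gfun_sq (h : IsBranch α β sq) {w : ℂ} (hw : w ∉ cuts α β) (h1 : w ≠ 1) (K : ℕ) (J k : ℤ) (a c : Fin 2) :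
    ‖((w - 1) ^ (2 * K + k.natAbs))⁻¹ * gfun α β (subF α β sq k) K J k a c w‖ ^ 2 =
      ‖w‖ ^ (2 * J + k - 4 * K) * ((4 * dv w) ^ (2 * K))⁻¹ * (‖om α β sq w‖ ^ k.natAbs)⁻¹ *
        ‖subF α β sq k w a c‖ ^ 2 := by
  have h0 := norm_pos_iff.2 (ne_zero_of_notMem_cuts hw)
  have h2 := norm_pos_iff.2 (sub_ne_zero.2 h1)
  have h3 := norm_pos_iff.2 (h.om_ne_zero hw h1)
  have e := h.norm_eig2_sq hw h1
  have e1 : (‖eig2 α β sq w‖ ^ k.natAbs) ^ 2 = ‖w‖ ^ k.natAbs * (‖w - 1‖ ^ k.natAbs) ^ 2 * (‖om α β sq w‖ ^ k.natAbs)⁻¹ := by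
    rw [← pow_mul, mul_comm k.natAbs 2, pow_mul, e, div_pow, mul_pow, ← pow_mul, ← pow_mul, mul_comm 2 k.natAbs]
    rfl
  have e2 : 4 * dv w = ‖w - 1‖ ^ 2 * ‖w‖⁻¹ := by unfold dv; field_simp
  rw [e2, gfun, h.polyQ_mul_subF hw, Matrix.smul_apply, smul_eq_mul]
  simp only [norm_mul, norm_inv, norm_pow, norm_zpow, norm_neg, mul_pow]
  rw [e1]
  have e3 : (‖w‖ ^ (J - (K : ℤ))) ^ 2 * (‖w‖ ^ min k 0) ^ 2 * ‖w‖ ^ k.natAbs = ‖w‖ ^ (2 * J + k - 4 * K) * ‖w‖ ^ (2 * K) := by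
    rw [← zpow_natCast (‖w‖ ^ (J - (K : ℤ))), ← zpow_natCast (‖w‖ ^ min k 0), ← _root_.zpow_mul, ← _root_.zpow_mul, ← zpow_natCast ‖w‖ k.natAbs,
      ← zpow_natCast ‖w‖ (2 * K), ← zpow_add₀ h0.ne', ← zpow_add₀ h0.ne', ← zpow_add₀ h0.ne']
    congr 1
    push_cast
    rcases le_total k 0 with hk | hk
    · rw [min_eq_left hk, abs_of_nonpos hk]; ring
    · rw [min_eq_right hk, abs_of_nonneg hk]; ring
  have e6 : (‖w - 1‖ ^ 2 * ‖w‖⁻¹) ^ (2 * K) = (‖w - 1‖ ^ (2 * K)) ^ 2 * (‖w‖ ^ (2 * K))⁻¹ := by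
    rw [mul_pow, inv_pow, ← pow_mul, mul_comm 2, pow_mul]
  have e5 : (‖w‖ ^ (J - (K : ℤ))) ^ 2 * (‖w‖ ^ min k 0) ^ 2 * ‖w‖ ^ k.natAbs * (‖w‖ ^ (2 * K))⁻¹ = ‖w‖ ^ (2 * J + k - 4 * K) := by
    rw [e3]; field_simp
  have e7 : ‖w - 1‖ ^ (2 * K + k.natAbs) = ‖w - 1‖ ^ (2 * K) * ‖w - 1‖ ^ k.natAbs := pow_add _ _ _
  rw [← e5, inv_pow, e7]
  rw [mul_pow] at e6
  rw [e6]
  field_simp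

end IsBranch

theorem dv_inv {z : ℂ} (h0 : z ≠ 0) : dv z⁻¹ = dv z := by
  have h := norm_pos_iff.2 h0
  have e : z⁻¹ - 1 = -(z - 1) * z⁻¹ := by field_simp; ring
  rw [dv, e, norm_mul, norm_neg, norm_inv, dv]
  field_simp

theorem zpow_le_pow_natAbs {x : ℝ} (hx : 1 ≤ x) (s : ℤ) : x ^ s ≤ x ^ s.natAbs := by
  rw [← zpow_natCast]
  exact zpow_le_zpow_right₀ hx (by rw [Int.natCast_natAbs]; exact le_abs_self s)

namespace IsBranch

variable {α β : ℝ} {sq : ℂ → ℂ}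

theorem norm_gfun_sq_le (h : IsBranch α β sq) {R C g : ℝ} (hR1 : 1 < R) (hR2 : R < α ^ 2)
    (hC : C = (R + 1) ^ 2 / (4 * R)) (hg : 0 < g) (hg2 : g ^ 2 = hs α β ^ 2 - C) {l : ℂ} (hl : ‖l‖ = R)
    {w : ℂ} (hw : w = om α β sq l ∨ w = (om α β sq l)⁻¹) (K : ℕ) (J k : ℤ)
    (hi : (2 * J + k - 4 * K).natAbs ≤ 2 * K)
    (hs' : ((2 * J + k - 4 * K).natAbs : ℝ) * hs α β * (C ^ 2 - 2 * C + hs α β ^ 2) ≤ ((2 * K : ℕ) : ℝ) * g ^ 3)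
    (a c : Fin 2) :
    ‖((w - 1) ^ (2 * K + k.natAbs))⁻¹ * gfun α β (subF α β sq k) K J k a c w‖ ^ 2 ≤
      C ^ (2 * K - (2 * J + k - 4 * K).natAbs) * ((hs α β + g) ^ 2) ^ (2 * J + k - 4 * K).natAbs *
        ((4 * hs α β ^ 2) ^ (2 * K))⁻¹ * (R ^ k.natAbs)⁻¹ * ‖subF α β sq k w a c‖ ^ 2 := by
  have hb : β ^ 2 < 1 := by nlinarith [h.beta_lt, h.beta_pos]
  have hlc : l ∉ cuts α β := h.notMem_cuts_of_norm (by linarith) (by linarith)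
  have hl1 : l ≠ 1 := by rintro rfl; rw [norm_one] at hl; linarith
  have hd := h.om_dual hlc (by linarith)
  have ho0 := h.om_ne_zero hlc hl1
  have ho1 := h.om_ne_one hlc hl1
  have hgt := h.one_lt_norm_om hlc hl1
  have hwc : w ∉ cuts α β := by
    rcases hw with rfl | rfl
    · exact hd.1
    · exact (h.inv_notMem hd.1).1
  have hw1 : w ≠ 1 := by
    rcases hw with rfl | rfl
    · exact ho1
    · simpa using ho1
  have hdw : dv w = dv (om α β sq l) := by
    rcases hw with rfl | rfl
    · rfl
    · exact dv_inv ho0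
  have how : om α β sq w = l := by
    rcases hw with rfl | rfl
    · exact h.om_om hlc (by linarith)
    · rw [h.om_inv hd.1]; exact h.om_om hlc (by linarith)
  have hnw : ‖w‖ ^ (2 * J + k - 4 * K) ≤ ‖om α β sq l‖ ^ (2 * J + k - 4 * K).natAbs := by
    rcases hw with rfl | rfl
    · exact zpow_le_pow_natAbs hgt.le _
    · rw [norm_inv, _root_.inv_zpow, ← _root_.zpow_neg]
      refine (zpow_le_pow_natAbs hgt.le _).trans_eq ?_
      rw [Int.natAbs_neg]
  set s := (2 * J + k - 4 * K).natAbs with hs_def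
  have hc := h.conc_circle hlc hl hC hg hg2 (2 * K - s) s (by
    rw [Nat.cast_sub hi, sub_add_cancel]; exact hs')
  have hdd := h.dv_mul_dv hlc hl1
  have hdl : 0 < dv l := by
    have h1 := norm_pos_iff.2 (sub_ne_zero.2 hl1)
    have h2 : 0 < ‖l‖ := by linarith
    unfold dv; positivity
  have hhs := h.one_lt_hs
  rw [h.norm_gfun_sq hwc hw1, how, hl, hdw]
  have e1 : 4 * dv (om α β sq l) = 4 * hs α β ^ 2 / dv l := by
    rw [← hdd]; field_simp
  have e2 : ‖om α β sq l‖ = yv α β sq l / dv l := by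
    rw [h.yv_eq hlc hl1]; field_simp
  have hR0 : 0 < R := by linarith
  have key : ‖w‖ ^ (2 * J + k - 4 * K) * ((4 * dv (om α β sq l)) ^ (2 * K))⁻¹ ≤
      C ^ (2 * K - s) * ((hs α β + g) ^ 2) ^ s * ((4 * hs α β ^ 2) ^ (2 * K))⁻¹ := by
    calc _ ≤ ‖om α β sq l‖ ^ s * ((4 * dv (om α β sq l)) ^ (2 * K))⁻¹ := by
          have : 0 ≤ dv (om α β sq l) := by unfold dv; positivity
          gcongr
      _ = dv l ^ (2 * K - s) * yv α β sq l ^ s * ((4 * hs α β ^ 2) ^ (2 * K))⁻¹ := by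
          rw [e1, e2, div_pow, div_pow, pow_sub₀ _ hdl.ne' hi]
          field_simp
      _ ≤ _ := by gcongr
  gcongr

end IsBranch

namespace IsBranch

variable {α β : ℝ} {sq : ℂ → ℂ}

theorem circle_facts (h : IsBranch α β sq) {R : ℝ} (hR1 : 1 < R) (hR2 : R < α ^ 2) {l : ℂ} (hl : ‖l‖ = R) :
    l ∉ cuts α β ∧ l ≠ 1 ∧ om α β sq l ∉ cuts α β ∧ (om α β sq l)⁻¹ ∉ cuts α β := by
  have hb : β ^ 2 < 1 := by nlinarith [h.beta_lt, h.beta_pos]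
  have hlc : l ∉ cuts α β := h.notMem_cuts_of_norm (by linarith) (by linarith)
  have hd := (h.om_dual hlc (by linarith)).1
  exact ⟨hlc, by rintro rfl; rw [norm_one] at hl; linarith, hd, (h.inv_notMem hd).1⟩

theorem subF_congr {k k' : ℤ} (hk : 0 < k ↔ 0 < k') (w : ℂ) : subF α β sq k w = subF α β sq k' w := by
  simp only [subF, hk]

theorem exists_circle_bound (h : IsBranch α β sq) {R : ℝ} (hR1 : 1 < R) (hR2 : R < α ^ 2) :
    ∃ B : ℝ, 0 ≤ B ∧ ∀ l : ℂ, ‖l‖ = R → ‖omd α β sq l‖ ≤ B ∧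
      ∀ w, w = om α β sq l ∨ w = (om α β sq l)⁻¹ → ∀ (k : ℤ) (a c : Fin 2), ‖subF α β sq k w a c‖ ≤ B := by
  have hfac : ∀ l ∈ Metric.sphere (0 : ℂ) R, l ∉ cuts α β ∧ l ≠ 1 ∧ om α β sq l ∉ cuts α β ∧ (om α β sq l)⁻¹ ∉ cuts α β :=
    fun l hl => h.circle_facts hR1 hR2 (by rwa [Metric.mem_sphere, dist_zero_right] at hl)
  have hcom : ContinuousOn (om α β sq) (Metric.sphere 0 R) := fun l hl =>
    (h.om_hasDerivAt (hfac l hl).1 (hfac l hl).2.1).continuousAt.continuousWithinAt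
  have hcomi : ContinuousOn (fun l => (om α β sq l)⁻¹) (Metric.sphere 0 R) :=
    hcom.inv₀ fun l hl => h.om_ne_zero (hfac l hl).1 (hfac l hl).2.1
  have hcd : ContinuousOn (omd α β sq) (Metric.sphere 0 R) := fun l hl =>
    (h.continuousAt_omd (hfac l hl).1 (hfac l hl).2.1).continuousWithinAt
  have hF1 : ∀ (k : ℤ) (a c : Fin 2), ContinuousOn (fun l => subF α β sq k (om α β sq l) a c) (Metric.sphere 0 R) :=
    fun k a c => (h.subF_differentiableOn k a c).continuousOn.comp hcom fun l hl => (hfac l hl).2.2.1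
  have hF2 : ∀ (k : ℤ) (a c : Fin 2), ContinuousOn (fun l => subF α β sq k (om α β sq l)⁻¹ a c) (Metric.sphere 0 R) :=
    fun k a c => (h.subF_differentiableOn k a c).continuousOn.comp hcomi fun l hl => (hfac l hl).2.2.2
  obtain ⟨B₀, hB₀⟩ := (isCompact_sphere (0 : ℂ) R).exists_bound_of_continuousOn hcd
  choose B₁ hB₁ using fun (k : ℤ) (a c : Fin 2) => (isCompact_sphere (0 : ℂ) R).exists_bound_of_continuousOn (hF1 k a c)
  choose B₂ hB₂ using fun (k : ℤ) (a c : Fin 2) => (isCompact_sphere (0 : ℂ) R).exists_bound_of_continuousOn (hF2 k a c)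
  have hmem : ((R : ℂ)) ∈ Metric.sphere (0 : ℂ) R := by
    rw [Metric.mem_sphere, dist_zero_right, Complex.norm_real, Real.norm_eq_abs, abs_of_pos (by linarith)]
  have p0 : 0 ≤ B₀ := (norm_nonneg _).trans (hB₀ _ hmem)
  have p1 : ∀ k a c, 0 ≤ B₁ k a c := fun k a c => (norm_nonneg _).trans (hB₁ k a c _ hmem)
  have p2 : ∀ k a c, 0 ≤ B₂ k a c := fun k a c => (norm_nonneg _).trans (hB₂ k a c _ hmem)
  have q1 : ∀ k a c, B₁ k a c ≤ ∑ a, ∑ c, (B₁ k a c + B₂ k a c) := by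
    intro k a c
    refine le_trans ?_ (Finset.single_le_sum (f := fun a => ∑ c, (B₁ k a c + B₂ k a c))
      (fun a _ => Finset.sum_nonneg fun c _ => add_nonneg (p1 k a c) (p2 k a c)) (Finset.mem_univ a))
    refine le_trans ?_ (Finset.single_le_sum (f := fun c => (B₁ k a c + B₂ k a c))
      (fun c _ => add_nonneg (p1 k a c) (p2 k a c)) (Finset.mem_univ c))
    linarith [p2 k a c]
  have q2 : ∀ k a c, B₂ k a c ≤ ∑ a, ∑ c, (B₁ k a c + B₂ k a c) := by
    intro k a c
    refine le_trans ?_ (Finset.single_le_sum (f := fun a => ∑ c, (B₁ k a c + B₂ k a c))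
      (fun a _ => Finset.sum_nonneg fun c _ => add_nonneg (p1 k a c) (p2 k a c)) (Finset.mem_univ a))
    refine le_trans ?_ (Finset.single_le_sum (f := fun c => (B₁ k a c + B₂ k a c))
      (fun c _ => add_nonneg (p1 k a c) (p2 k a c)) (Finset.mem_univ c))
    linarith [p1 k a c]
  have s : ∀ k, 0 ≤ ∑ a, ∑ c, (B₁ k a c + B₂ k a c) := fun k => Finset.sum_nonneg fun a _ =>
    Finset.sum_nonneg fun c _ => add_nonneg (p1 k a c) (p2 k a c)
  refine ⟨B₀ + ∑ a, ∑ c, (B₁ 0 a c + B₂ 0 a c) + ∑ a, ∑ c, (B₁ 1 a c + B₂ 1 a c), by linarith [s 0, s 1], ?_⟩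
  intro l hl
  have hl' : l ∈ Metric.sphere (0 : ℂ) R := by rwa [Metric.mem_sphere, dist_zero_right]
  refine ⟨by linarith [hB₀ l hl', s 0, s 1], fun w hw k a c => ?_⟩
  have hkk : ∃ k' : ℤ, (k' = 0 ∨ k' = 1) ∧ (0 < k ↔ 0 < k') := by
    by_cases hk : 0 < k
    · exact ⟨1, Or.inr rfl, by simp [hk]⟩
    · exact ⟨0, Or.inl rfl, by simp [hk]⟩
  obtain ⟨k', hk', hkk⟩ := hkk
  rw [subF_congr hkk]
  have : ‖subF α β sq k' w a c‖ ≤ ∑ a, ∑ c, (B₁ k' a c + B₂ k' a c) := by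
    rcases hw with rfl | rfl
    · exact (hB₁ k' a c l hl').trans (q1 k' a c)
    · exact (hB₂ k' a c l hl').trans (q2 k' a c)
  rcases hk' with rfl | rfl <;> linarith [s 0, s 1]

/-- Both `w`-integrals, moved to the curves `om (C(0,R))^{±1}`, are controlled by the values of the
integrand there. -/
theorem exists_contour_bound (h : IsBranch α β sq) {T R r : ℝ} (hT1 : 1 < T) (hT2 : T < α ^ 2) (hR1 : 1 < R)
    (hR2 : R < α ^ 2) (hom : om α β sq ((-R : ℝ) : ℂ) = ((-T : ℝ) : ℂ)) (hr1 : T⁻¹ < r) (hr2 : r < T) :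
    ∃ B : ℝ, 0 ≤ B ∧ ∀ (z : ℂ), ‖z‖ = r → ∀ (K M : ℕ) (J k : ℤ) (a c : Fin 2) (E : ℝ),
      (∀ l : ℂ, ‖l‖ = R → ∀ w, w = om α β sq l ∨ w = (om α β sq l)⁻¹ →
        ‖((w - 1) ^ M)⁻¹ * gfun α β (subF α β sq k) K J k a c w‖ ≤ E * ‖subF α β sq k w a c‖) → 0 ≤ E →
      ‖∮ w in C(0, T), (z - w)⁻¹ * (((w - 1) ^ M)⁻¹ * gfun α β (subF α β sq k) K J k a c w)‖ ≤ B * E ∧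
      ‖∮ w in C(0, T⁻¹), (z - w)⁻¹ * (((w - 1) ^ M)⁻¹ * gfun α β (subF α β sq k) K J k a c w)‖ ≤ B * E := by
  obtain ⟨B, hB0, hB⟩ := h.exists_circle_bound hR1 hR2
  have hT0 : 0 < T := by linarith
  have hTi : 0 < T⁻¹ := inv_pos.2 hT0
  have hr0 : 0 < r := by linarith
  have hRc : ((-R : ℝ) : ℂ) ∉ cuts α β := (h.circle_facts hR1 hR2
    (by rw [Complex.norm_real, Real.norm_eq_abs, abs_neg, abs_of_pos (by linarith)])).1
  have d1 : 0 < T - r := by linarith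
  have d2 : 0 < r - T⁻¹ := by linarith
  refine ⟨2 * Real.pi * R * (((T - r)⁻¹ + (r - T⁻¹)⁻¹) * B * B), by positivity, ?_⟩
  intro z hz K M J k a c E hE hE0
  set G : ℂ → ℂ := fun w => ((w - 1) ^ M)⁻¹ * gfun α β (subF α β sq k) K J k a c w with hG
  have hGd : ∀ w, w ∉ cuts α β → w ≠ 1 → DifferentiableAt ℂ G w := by
    intro w h1 h2
    refine DifferentiableAt.mul (DifferentiableAt.inv (by fun_prop) (pow_ne_zero _ (sub_ne_zero.2 h2))) ?_
    exact (h.gfun_subF_differentiableOn K J k a c).differentiableAt (isOpen_compl_cuts.mem_nhds h1)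
  have hbound : ∀ l : ℂ, ‖l‖ = R → ∀ w, w = om α β sq l ∨ w = (om α β sq l)⁻¹ → ‖G w‖ ≤ E * B := fun l hl w hw =>
    (hE l hl w hw).trans (mul_le_mul_of_nonneg_left ((hB l hl).2 w hw k a c) hE0)
  have hTl : ∀ l : ℂ, ‖l‖ = R → T ≤ ‖om α β sq l‖ := fun l hl =>
    h.le_norm_om hT1 hR1 hom hRc (h.circle_facts hR1 hR2 hl).1 hl
  have hsph : ∀ l ∈ Metric.sphere (0 : ℂ) R, ‖l‖ = R := fun l hl => by
    rwa [Metric.mem_sphere, dist_zero_right] at hl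
  constructor
  · have hcomp := h.circleIntegral_comp_om (f := fun w => (z - w)⁻¹ * G w) (r₀ := max 1 r) (le_max_left _ _) (by
      rintro w ⟨hw1, hw2⟩
      have hw3 : 1 < ‖w‖ := (le_max_left _ _).trans_lt hw1
      have hw4 : r < ‖w‖ := (le_max_right _ _).trans_lt hw1
      refine (DifferentiableAt.mul (DifferentiableAt.inv (by fun_prop) ?_) (hGd w hw2 ?_)).differentiableWithinAt
      · intro e; rw [sub_eq_zero] at e; rw [e] at hz; linarith
      · rintro rfl; rw [norm_one] at hw3; exact lt_irrefl _ hw3) (max_lt hT1 hr2) hT2 hR1 hR2 hom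
    rw [hcomp, norm_neg]
    refine (circleIntegral.norm_integral_le_of_norm_le_const (by linarith)
      (C := (((T - r)⁻¹ + (r - T⁻¹)⁻¹) * B * B) * E) fun l hl => ?_).trans_eq (by ring)
    have hl := hsph l hl
    have k1 : T - r ≤ ‖z - om α β sq l‖ := by
      have := norm_sub_norm_le (om α β sq l) z
      rw [norm_sub_rev] at this; linarith [hTl l hl]
    have k2 : ‖(z - om α β sq l)⁻¹‖ ≤ (T - r)⁻¹ := by rw [norm_inv]; gcongr
    have k3 : (T - r)⁻¹ ≤ (T - r)⁻¹ + (r - T⁻¹)⁻¹ := le_add_of_nonneg_right (inv_pos.2 d2).le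
    calc _ = ‖(z - om α β sq l)⁻¹‖ * ‖G (om α β sq l)‖ * ‖omd α β sq l‖ := by rw [norm_mul, norm_mul]
      _ ≤ ((T - r)⁻¹ + (r - T⁻¹)⁻¹) * (E * B) * B := by
        have := hbound l hl _ (Or.inl rfl)
        have := (hB l hl).1
        have := k2.trans k3
        gcongr
      _ = _ := by ring
  · have hcomp := h.circleIntegral_comp_om (f := fun w => ((z - w⁻¹)⁻¹ * G w⁻¹) * (w ^ 2)⁻¹) (r₀ := max 1 r⁻¹) (le_max_left _ _) (by
      rintro w ⟨hw1, hw2⟩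
      have hw3 : 1 < ‖w‖ := (le_max_left _ _).trans_lt hw1
      have hw4 : r⁻¹ < ‖w‖ := (le_max_right _ _).trans_lt hw1
      have hw0 : w ≠ 0 := ne_zero_of_notMem_cuts hw2
      have hi : DifferentiableAt ℂ (fun w : ℂ => w⁻¹) w := differentiableAt_inv hw0
      have hGi : DifferentiableAt ℂ (fun w : ℂ => G w⁻¹) w := (hGd w⁻¹ (h.inv_notMem hw2).1 (by
        rw [Ne, inv_eq_one]; rintro rfl; rw [norm_one] at hw3; exact lt_irrefl _ hw3)).comp (f := fun w : ℂ => w⁻¹) w hi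
      have hne : z - w⁻¹ ≠ 0 := by
        intro e; rw [sub_eq_zero] at e; rw [e, norm_inv] at hz
        rw [← hz, inv_inv] at hw4; exact lt_irrefl _ hw4
      exact (((hi.const_sub z).inv hne).mul hGi |>.mul
        ((by fun_prop : DifferentiableAt ℂ (fun w : ℂ => w ^ 2) w).inv (pow_ne_zero _ hw0))).differentiableWithinAt)
      (max_lt hT1 (inv_lt_of_inv_lt₀ hT0 hr1)) hT2 hR1 hR2 hom
    rw [circleIntegral_inv _ hT0, hcomp, norm_neg]
    refine (circleIntegral.norm_integral_le_of_norm_le_const (by linarith)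
      (C := (((T - r)⁻¹ + (r - T⁻¹)⁻¹) * B * B) * E) fun l hl => ?_).trans_eq (by ring)
    have hl := hsph l hl
    have k0 : ‖(om α β sq l)⁻¹‖ ≤ T⁻¹ := by rw [norm_inv]; have := hTl l hl; gcongr
    have k1 : r - T⁻¹ ≤ ‖z - (om α β sq l)⁻¹‖ := by
      have := norm_sub_norm_le z (om α β sq l)⁻¹
      linarith
    have k2 : ‖(z - (om α β sq l)⁻¹)⁻¹‖ ≤ (r - T⁻¹)⁻¹ := by rw [norm_inv]; gcongr
    have k3 : (r - T⁻¹)⁻¹ ≤ (T - r)⁻¹ + (r - T⁻¹)⁻¹ := le_add_of_nonneg_left (inv_pos.2 d1).le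
    have k4 : ‖(om α β sq l ^ 2)⁻¹‖ ≤ 1 := by
      rw [norm_inv, norm_pow]
      exact inv_le_one_of_one_le₀ (one_le_pow₀ (hT1.le.trans (hTl l hl)))
    calc _ = ‖(z - (om α β sq l)⁻¹)⁻¹‖ * ‖G (om α β sq l)⁻¹‖ * ‖(om α β sq l ^ 2)⁻¹‖ * ‖omd α β sq l‖ := by
          rw [norm_mul, norm_mul, norm_mul]
      _ ≤ ((T - r)⁻¹ + (r - T⁻¹)⁻¹) * (E * B) * 1 * B := by
        have := hbound l hl _ (Or.inr rfl)
        have := (hB l hl).1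
        have := k2.trans k3
        gcongr
      _ = _ := by ring

end IsBranch

namespace IsBranch

variable {α β : ℝ} {sq : ℂ → ℂ}

theorem norm_polyQ_le (h : IsBranch α β sq) {z : ℂ} (hz : z ∉ cuts α β) (j : ℤ) (c b : Fin 2) :
    ‖polyQ α β j z c b‖ ≤ ‖eig1 α β sq z‖ ^ j.natAbs *
      (‖projF α β sq z c b‖ + ‖(1 - projF α β sq z) c b‖) := by
  have e : polyQ α β j z = polyQ α β j z * projF α β sq z + polyQ α β j z * (1 - projF α β sq z) := by
    rw [← mul_add, add_sub_cancel, mul_one]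
  have h1 := h.norm_eig2_le hz
  have h2 : ‖(if 0 ≤ j then eig1 α β sq z else eig2 α β sq z) ^ j.natAbs‖ ≤ ‖eig1 α β sq z‖ ^ j.natAbs := by
    rw [norm_pow]; split_ifs
    · exact le_rfl
    · gcongr
  have h3 : ‖(if 0 ≤ j then eig2 α β sq z else eig1 α β sq z) ^ j.natAbs‖ ≤ ‖eig1 α β sq z‖ ^ j.natAbs := by
    rw [norm_pow]; split_ifs
    · gcongr
    · exact le_rfl
  rw [e, h.polyQ_mul_projF hz, h.polyQ_mul_one_sub hz, Matrix.add_apply, Matrix.smul_apply, Matrix.smul_apply,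
    smul_eq_mul, smul_eq_mul, mul_add]
  refine (norm_add_le _ _).trans ?_
  rw [norm_mul, norm_mul]
  gcongr

theorem exists_hfun_bound (h : IsBranch α β sq) {r C g : ℝ} (hr1 : β ^ 2 < r) (hr2 : r < α ^ 2)
    (hC : C = (r + 1) ^ 2 / (4 * r)) (hg : 0 < g) (hg2 : g ^ 2 = hs α β ^ 2 - C) :
    ∃ B : ℝ, 0 ≤ B ∧ ∀ z : ℂ, ‖z‖ = r → ∀ (K : ℕ) (J j : ℤ) (c b : Fin 2), j.natAbs ≤ 2 * K →
      (j.natAbs : ℝ) * hs α β * (C ^ 2 - 2 * C + hs α β ^ 2) ≤ ((2 * K : ℕ) : ℝ) * g ^ 3 →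
      ‖hfun α β K J j c b z‖ ^ 2 ≤ B * (r ^ (4 * K - 2 * J + j - 2) * 4 ^ (2 * K) *
        (C ^ (2 * K - j.natAbs) * ((hs α β + g) ^ 2) ^ j.natAbs)) := by
  have hr0 : 0 < r := lt_of_le_of_lt (sq_nonneg β) hr1
  have hfac : ∀ z ∈ Metric.sphere (0 : ℂ) r, z ∉ cuts α β := fun z hz => by
    rw [Metric.mem_sphere, dist_zero_right] at hz
    exact h.notMem_cuts_of_norm (by linarith) (by linarith)
  have hcont : ∀ c b : Fin 2, ContinuousOn (fun z => ‖projF α β sq z c b‖ + ‖(1 - projF α β sq z) c b‖)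
      (Metric.sphere 0 r) := by
    intro c b
    have hF : ContinuousOn (fun z => projF α β sq z c b) (Metric.sphere 0 r) :=
      (h.projF_differentiableOn c b).continuousOn.mono hfac
    exact hF.norm.add (continuousOn_const.sub hF).norm
  choose B hB using fun c b => (isCompact_sphere (0 : ℂ) r).exists_bound_of_continuousOn (hcont c b)
  refine ⟨∑ c, ∑ b, B c b ^ 2, by positivity, ?_⟩
  intro z hz K J j c b hj hs'
  have hzm : z ∈ Metric.sphere (0 : ℂ) r := by rwa [Metric.mem_sphere, dist_zero_right]
  have hzc := hfac z hzm
  have hc := h.conc_circle hzc hz hC hg hg2 (2 * K - j.natAbs) j.natAbs (by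
    rw [Nat.cast_sub hj, sub_add_cancel]; exact hs')
  have hQ := h.norm_polyQ_le hzc j c b
  have hBB : ‖projF α β sq z c b‖ + ‖(1 - projF α β sq z) c b‖ ≤ B c b := (Real.le_norm_self _).trans (hB c b z hzm)
  have hle : B c b ^ 2 ≤ ∑ c, ∑ b, B c b ^ 2 :=
    (Finset.single_le_sum (f := fun b => B c b ^ 2) (fun b _ => sq_nonneg _) (Finset.mem_univ b)).trans
      (Finset.single_le_sum (f := fun c => ∑ b, B c b ^ 2) (fun c _ => Finset.sum_nonneg fun b _ => sq_nonneg _) (Finset.mem_univ c))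
  have e1 : (‖eig1 α β sq z‖ ^ j.natAbs) ^ 2 = (4 * r ^ 2 * yv α β sq z) ^ j.natAbs := by
    rw [← pow_mul, mul_comm, pow_mul, h.norm_eig1_sq, hz]
  have e2 : (‖z - 1‖ ^ (2 * K - j.natAbs)) ^ 2 = (4 * r * dv z) ^ (2 * K - j.natAbs) := by
    rw [← pow_mul, mul_comm, pow_mul]
    congr 1
    unfold dv; rw [hz]; field_simp
  have e3 : (r ^ ((K : ℤ) - J - 1)) ^ 2 * (r ^ min j 0) ^ 2 * (r ^ (2 * K - j.natAbs) * (r ^ 2) ^ j.natAbs) =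
      r ^ (4 * K - 2 * J + j - 2) := by
    rw [← zpow_natCast (r ^ ((K : ℤ) - J - 1)), ← zpow_natCast (r ^ min j 0), ← _root_.zpow_mul, ← _root_.zpow_mul,
      ← pow_mul, ← pow_add, ← zpow_natCast r, ← zpow_add₀ hr0.ne', ← zpow_add₀ hr0.ne']
    congr 1
    push_cast [Nat.cast_sub hj]
    rcases le_total j 0 with hk | hk
    · rw [min_eq_left hk, abs_of_nonpos hk]; ring
    · rw [min_eq_right hk, abs_of_nonneg hk]; ring
  have hyv : 0 ≤ yv α β sq z := by unfold yv; positivity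
  have hdv : 0 ≤ dv z := by unfold dv; positivity
  rw [hfun]
  simp only [norm_mul, norm_pow, norm_zpow, norm_neg, hz]
  calc _ ≤ (r ^ ((K : ℤ) - J - 1) * r ^ min j 0 * ‖z - 1‖ ^ (2 * K - j.natAbs) *
        (‖eig1 α β sq z‖ ^ j.natAbs * B c b)) ^ 2 := by
        have : 0 ≤ ‖eig1 α β sq z‖ ^ j.natAbs := by positivity
        have := hQ.trans (mul_le_mul_of_nonneg_left hBB this)
        gcongr
    _ = B c b ^ 2 * (r ^ (4 * K - 2 * J + j - 2) * 4 ^ (2 * K) * (dv z ^ (2 * K - j.natAbs) * yv α β sq z ^ j.natAbs)) := by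
        have e4 : (4 : ℝ) ^ (2 * K) = 4 ^ (2 * K - j.natAbs) * 4 ^ j.natAbs := by
          rw [← pow_add]; congr 1; omega
        rw [← e3, mul_pow, mul_pow, mul_pow, mul_pow, e1, e2, e4, mul_pow, mul_pow, mul_pow, mul_pow]
        ring
    _ ≤ _ := by gcongr

end IsBranch

theorem exp_two_mul_add_one_sq (u : ℝ) : (Real.exp (2 * u) + 1) ^ 2 / (4 * Real.exp (2 * u)) = Real.cosh u ^ 2 := by
  have e : Real.exp (2 * u) = Real.exp u ^ 2 := by rw [← Real.exp_nat_mul]; norm_cast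
  have := Real.exp_pos u
  rw [e, Real.cosh_eq, Real.exp_neg]
  field_simp
  ring

/-- The size of the integrand of the remainder on the two contours. -/
noncomputable def remSize (c p q : ℝ) (N j i k : ℕ) (s : ℤ) : ℝ :=
  Real.exp (2 * N * (Real.log (Real.cosh p) - Real.log (Real.cosh q)) + 2 * p * s + 2 * q * i +
    2 * j * (Real.log (c + gapu c p) - Real.log (Real.cosh p)) -
    2 * k * (Real.log (c + gapu c q) - Real.log (Real.cosh q)))

theorem remSize_eq {c p q : ℝ} (hp : Real.cosh p < c) (hq : Real.cosh q < c) {N j i k : ℕ} (hj : j ≤ N) (hi : i ≤ N)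
    (s : ℤ) :
    Real.exp (2 * p) ^ s * 4 ^ N * ((Real.cosh p ^ 2) ^ (N - j) * ((c + gapu c p) ^ 2) ^ j) *
      ((c ^ 2 / Real.cosh q ^ 2) ^ (N - i) * ((c ^ 2 / Real.cosh q ^ 2) * Real.exp (2 * q)) ^ i *
        ((4 * c ^ 2) ^ N)⁻¹ * (((c + gapu c q) ^ 2 / Real.cosh q ^ 2) ^ k)⁻¹) = remSize c p q N j i k s := by
  have hcp := Real.cosh_pos p
  have hcq := Real.cosh_pos q
  have hgp := gapu_pos hp
  have hgq := gapu_pos hq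
  have hc : 0 < c := by linarith
  have hpow : ∀ {x : ℝ}, 0 < x → ∀ n : ℕ, x ^ n = Real.exp (n * Real.log x) := fun {x} hx n => by
    rw [Real.exp_nat_mul, Real.exp_log hx]
  have h1 : (Real.cosh p ^ 2) ^ (N - j) * ((c + gapu c p) ^ 2) ^ j =
      Real.exp (2 * N * Real.log (Real.cosh p) + 2 * j * (Real.log (c + gapu c p) - Real.log (Real.cosh p))) := by
    rw [← pow_mul, ← pow_mul, hpow hcp, hpow (by linarith : 0 < c + gapu c p), ← Real.exp_add]
    congr 1; push_cast [Nat.cast_sub hj]; ring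
  have h2 : Real.exp (2 * p) ^ s = Real.exp (2 * p * s) := by
    rw [← Real.rpow_intCast, ← Real.exp_mul]
  have h3 : (4 : ℝ) ^ N * ((c ^ 2 / Real.cosh q ^ 2) ^ (N - i) * ((c ^ 2 / Real.cosh q ^ 2) * Real.exp (2 * q)) ^ i *
      ((4 * c ^ 2) ^ N)⁻¹) = Real.exp (- (2 * N * Real.log (Real.cosh q)) + 2 * q * i) := by
    have e1 : Real.exp (- (2 * N * Real.log (Real.cosh q)) + 2 * q * i) = ((Real.cosh q ^ 2) ^ N)⁻¹ * Real.exp (2 * q) ^ i := by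
      rw [← pow_mul, hpow hcq, ← Real.exp_neg, ← Real.exp_nat_mul, ← Real.exp_add]
      congr 1; push_cast; ring
    have e2 : (c ^ 2 / Real.cosh q ^ 2) ^ N = (c ^ 2 / Real.cosh q ^ 2) ^ (N - i) * (c ^ 2 / Real.cosh q ^ 2) ^ i := by
      rw [← pow_add]; congr 1; omega
    rw [e1, mul_pow _ (Real.exp (2 * q)), ← mul_assoc ((c ^ 2 / Real.cosh q ^ 2) ^ (N - i)), ← e2, div_pow, mul_pow]
    field_simp
  have h4 : (((c + gapu c q) ^ 2 / Real.cosh q ^ 2) ^ k)⁻¹ =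
      Real.exp (-(2 * k * (Real.log (c + gapu c q) - Real.log (Real.cosh q)))) := by
    rw [← div_pow, ← pow_mul, hpow (by positivity), Real.log_div (by linarith) hcq.ne', ← Real.exp_neg]
    congr 1; push_cast; ring
  calc _ = Real.exp (2 * p) ^ s * ((Real.cosh p ^ 2) ^ (N - j) * ((c + gapu c p) ^ 2) ^ j) *
      ((4 : ℝ) ^ N * ((c ^ 2 / Real.cosh q ^ 2) ^ (N - i) * ((c ^ 2 / Real.cosh q ^ 2) * Real.exp (2 * q)) ^ i *
      ((4 * c ^ 2) ^ N)⁻¹)) * (((c + gapu c q) ^ 2 / Real.cosh q ^ 2) ^ k)⁻¹ := by ring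
    _ = _ := by
      rw [h1, h2, h3, h4, remSize, ← Real.exp_add, ← Real.exp_add, ← Real.exp_add]
      congr 1; ring

namespace IsBranch

variable {α β : ℝ} {sq : ℂ → ℂ}

theorem exists_remainder_bound (h : IsBranch α β sq) {p q : ℝ} (hpq : |p| < q) (hq : q < Real.log α) :
    ∃ B : ℝ, 0 ≤ B ∧ ∀ (K : ℕ) (J J' k j : ℤ) (a b c : Fin 2), j.natAbs ≤ 2 * K →
      (j.natAbs : ℝ) * hs α β * (Real.cosh p ^ 4 - 2 * Real.cosh p ^ 2 + hs α β ^ 2) ≤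
        ((2 * K : ℕ) : ℝ) * gapu (hs α β) p ^ 3 →
      (2 * J' + k - 4 * K).natAbs ≤ 2 * K →
      ((2 * J' + k - 4 * K).natAbs : ℝ) * (Real.cosh q ^ 4 - 2 * Real.cosh q ^ 2 + hs α β ^ 2) ≤
        ((2 * K : ℕ) : ℝ) * (Real.cosh q * Real.sinh q ^ 3) →
      (0 < k → 0 ≤ J' - (K : ℤ) + ((k.natAbs / 2 : ℕ) : ℤ)) →
      (0 < k → J' - (K : ℤ) + 3 * ((k.natAbs / 2 : ℕ) : ℤ) + 2 * ((k.natAbs % 2 : ℕ) : ℤ) + 1 ≤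
        (2 * K + k.natAbs : ℕ)) →
      ‖∮ z in C(0, Real.exp (2 * p)),
        ((∮ w in C(0, Real.exp (2 * q)), (z - w)⁻¹ * (((w - 1) ^ (2 * K + k.natAbs))⁻¹ *
          gfun α β (projF α β sq) K J' k a c w * hfun α β K J j c b z)) -
        ∮ w in C(0, (Real.exp (2 * q))⁻¹), (z - w)⁻¹ * (((w - 1) ^ (2 * K + k.natAbs))⁻¹ *
          gfun α β (projF α β sq) K J' k a c w * hfun α β K J j c b z))‖ ≤
      B * √(remSize (hs α β) p q (2 * K) j.natAbs (2 * J' + k - 4 * K).natAbs k.natAbs (4 * K - 2 * J + j - 2)) := by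
  have hp := abs_lt.1 hpq
  have hq0 : 0 < q := (abs_nonneg p).trans_lt hpq
  have hcp := h.cosh_lt (u := p) (by linarith) (by linarith)
  have hcq := h.cosh_lt (u := q) (by linarith) hq
  have hbp := h.exp_bounds (u := p) (by linarith) (by linarith)
  have hbq := h.exp_bounds (u := q) (by linarith) hq
  have hbq' := h.exp_bounds (u := -q) (by linarith) (by linarith)
  have hT1 : 1 < Real.exp (2 * q) := Real.one_lt_exp_iff.2 (by linarith)
  have hTi : (Real.exp (2 * q))⁻¹ = Real.exp (2 * -q) := by rw [← Real.exp_neg]; congr 1; ring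
  have hTi1 : (Real.exp (2 * q))⁻¹ < 1 := inv_lt_one_of_one_lt₀ hT1
  obtain ⟨R, hR, hR1, hR2, hom⟩ := h.dual_radius hT1 hbq.2
  rw [gapv_exp] at hR
  set T := Real.exp (2 * q) with hT
  set r := Real.exp (2 * p) with hr
  set c := hs α β with hc
  have hc1 := h.one_lt_hs
  have hrT : r < T := Real.exp_lt_exp.2 (by linarith)
  have hrTi : T⁻¹ < r := by rw [hTi]; exact Real.exp_lt_exp.2 (by linarith)
  have hch := Real.cosh_pos q
  have hsh : 0 < Real.sinh q := Real.sinh_pos_iff.2 hq0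
  have hcs := Real.cosh_sq q
  have hgq := gapu_pos hcq
  have hgqs := gapu_sq hcq
  have hgp := gapu_pos hcp
  have hcgq : 0 < c - gapu c q := by nlinarith
  have hc0 : 0 < c := by linarith
  have hR' : R = (c + gapu c q) ^ 2 / Real.cosh q ^ 2 := by
    rw [hR, show Real.cosh q ^ 2 = (c - gapu c q) * (c + gapu c q) by linear_combination hgqs]
    field_simp
  have hCR : c ^ 2 / Real.cosh q ^ 2 = (R + 1) ^ 2 / (4 * R) := by
    rw [hR, show Real.cosh q ^ 2 = (c - gapu c q) * (c + gapu c q) by linear_combination hgqs]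
    have : 0 < c + gapu c q := by linarith
    field_simp
    ring
  have hg2 : (c * Real.sinh q / Real.cosh q) ^ 2 = c ^ 2 - c ^ 2 / Real.cosh q ^ 2 := by
    field_simp; rw [hcs]; ring
  have hcg : (c + c * Real.sinh q / Real.cosh q) ^ 2 = (c ^ 2 / Real.cosh q ^ 2) * T := by
    have e1 : T = (Real.cosh q + Real.sinh q) ^ 2 := by
      rw [Real.cosh_add_sinh, hT, ← Real.exp_nat_mul]; norm_cast
    rw [e1]; field_simp
  obtain ⟨B₁, hB₁, hb₁⟩ := h.exists_contour_bound hT1 hbq.2 hR1 hR2 hom hrTi hrT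
  obtain ⟨B₂, hB₂, hb₂⟩ := h.exists_hfun_bound hbp.1 hbp.2 (exp_two_mul_add_one_sq p).symm hgp (gapu_sq hcp)
  have hr0 : 0 < r := Real.exp_pos _
  refine ⟨2 * Real.pi * r * (2 * B₁ * √B₂), by positivity, ?_⟩
  intro K J J' k j a b d hj hsj hi hsi hin hout
  set i := (2 * J' + k - 4 * K).natAbs with hi_def
  set X := r ^ (4 * K - 2 * J + j - 2) * 4 ^ (2 * K) *
        ((Real.cosh p ^ 2) ^ (2 * K - j.natAbs) * ((c + gapu c p) ^ 2) ^ j.natAbs) with hX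
  set Y := (c ^ 2 / Real.cosh q ^ 2) ^ (2 * K - i) * ((c ^ 2 / Real.cosh q ^ 2) * T) ^ i *
        ((4 * c ^ 2) ^ (2 * K))⁻¹ * (R ^ k.natAbs)⁻¹ with hY
  have hXY : X * Y = remSize c p q (2 * K) j.natAbs i k.natAbs (4 * K - 2 * J + j - 2) := by
    rw [← remSize_eq hcp hcq hj hi, hX, hY, hR']
  have hX0 : 0 ≤ X := by positivity
  have hR0 : 0 < R := by linarith
  have hT0 : 0 < T := by linarith
  have hY0 : 0 ≤ Y := by positivity
  refine (circleIntegral.norm_integral_le_of_norm_le_const hr0.le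
    (C := 2 * B₁ * √B₂ * √(X * Y)) fun z hz => ?_).trans_eq (by rw [hXY]; ring)
  rw [Metric.mem_sphere, dist_zero_right] at hz
  rw [h.circleIntegral_gfun_subF hbq.1 hbq.2 hT1.ne' (by rw [hz]; exact hrT.ne) K _ J' k a d (fun hk =>
      circleIntegral_numB_outer h.mul_eq hT1 (by rw [hz]; exact hrT) _ _ (hout hk) a d),
    h.circleIntegral_gfun_subF (by rw [hTi]; exact hbq'.1) (by rw [hTi]; exact hbq'.2) hTi1.ne
      (by rw [hz]; exact hrTi.ne') K _ J' k a d (fun hk =>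
      circleIntegral_numB_inner h.mul_eq (inv_pos.2 hT0) hTi1 (by rw [hz]; exact hrTi) _ _ (hin hk) a d)]
  have hsqY : ∀ x : ℝ, (√Y * x) ^ 2 = Y * x ^ 2 := fun x => by rw [mul_pow, Real.sq_sqrt hY0]
  obtain ⟨b1, b2⟩ := hb₁ z hz K (2 * K + k.natAbs) J' k a d √Y (fun l hl w hw => by
    have := h.norm_gfun_sq_le hR1 hR2 hCR (by positivity) hg2 hl hw K J' k hi (by
      have e1 : c * ((c ^ 2 / Real.cosh q ^ 2) ^ 2 - 2 * (c ^ 2 / Real.cosh q ^ 2) + c ^ 2) =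
          (Real.cosh q ^ 4 - 2 * Real.cosh q ^ 2 + c ^ 2) * (c ^ 3 / Real.cosh q ^ 4) := by
        field_simp; ring
      have e2 : (c * Real.sinh q / Real.cosh q) ^ 3 = (Real.cosh q * Real.sinh q ^ 3) * (c ^ 3 / Real.cosh q ^ 4) := by
        field_simp
      rw [mul_assoc, e1, e2, ← mul_assoc, ← mul_assoc]
      exact mul_le_mul_of_nonneg_right hsi (by positivity)) a d
    rw [hcg] at this
    refine le_of_sq_le_sq (this.trans_eq ?_) (by positivity)
    exact (hsqY ‖subF α β sq k w a d‖).symm) (Real.sqrt_nonneg _)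
  have b3 : ‖hfun α β K J j d b z‖ ≤ √B₂ * √X := by
    have := hb₂ z hz K J j d b hj (by convert hsj using 2; ring)
    refine le_of_sq_le_sq (this.trans_eq ?_) (by positivity)
    rw [mul_pow, Real.sq_sqrt hX0, Real.sq_sqrt hB₂]
  rw [← sub_mul, norm_mul, Real.sqrt_mul hX0]
  calc _ ≤ (B₁ * √Y + B₁ * √Y) * (√B₂ * √X) := by
        have := (norm_sub_le _ _).trans (add_le_add b1 b2)
        gcongr
    _ = _ := by ring

end IsBranch

theorem tendsto_affine_div_two_mul {u : ℕ → ℤ} {x : ℝ}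
    (h : Tendsto (fun k : ℕ => (u k : ℝ) / (2 * k)) atTop (nhds x)) (s a b : ℤ) :
    Tendsto (fun k : ℕ => ((s * u k + a + b * (2 * k) : ℤ) : ℝ) / (2 * k)) atTop (nhds (s * x + b)) := by
  have h0 : Tendsto (fun k : ℕ => (a : ℝ) / (2 * k)) atTop (nhds 0) :=
    (tendsto_natCast_atTop_atTop.const_mul_atTop (by norm_num : (0 : ℝ) < 2)).const_div_atTop _
  have := ((h.const_mul (s : ℝ)).add h0).add_const (b : ℝ)
  rw [add_zero] at this
  refine this.congr' ?_
  filter_upwards [eventually_gt_atTop 0] with k hk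
  have : (k : ℝ) ≠ 0 := by positivity
  push_cast
  field_simp

theorem tendsto_natAbs_div_two_mul {u : ℕ → ℤ} {x : ℝ}
    (h : Tendsto (fun k : ℕ => (u k : ℝ) / (2 * k)) atTop (nhds x)) :
    Tendsto (fun k : ℕ => ((u k).natAbs : ℝ) / (2 * k)) atTop (nhds |x|) := by
  refine h.abs.congr fun k => ?_
  rw [abs_div, Nat.cast_natAbs, Int.cast_abs, abs_of_nonneg (by positivity : (0 : ℝ) ≤ 2 * k)]

theorem eventually_natAbs_mul_le {u : ℕ → ℤ} {x A C : ℝ}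
    (h : Tendsto (fun k : ℕ => (u k : ℝ) / (2 * k)) atTop (nhds x)) (hx : |x| * A < C) :
    ∀ᶠ k in atTop, ((u k).natAbs : ℝ) * A ≤ ((2 * k : ℕ) : ℝ) * C := by
  have := ((tendsto_natAbs_div_two_mul h).mul_const A).eventually_lt_const hx
  filter_upwards [this, eventually_gt_atTop 0] with k h1 hk
  have hk' : (0 : ℝ) < 2 * k := by positivity
  rw [div_mul_eq_mul_div, div_lt_iff₀ hk'] at h1
  push_cast
  linarith

theorem eventually_natAbs_le {u : ℕ → ℤ} {x : ℝ}
    (h : Tendsto (fun k : ℕ => (u k : ℝ) / (2 * k)) atTop (nhds x)) (hx : |x| < 1) :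
    ∀ᶠ k in atTop, (u k).natAbs ≤ 2 * k := by
  filter_upwards [eventually_natAbs_mul_le (A := 1) (C := 1) h (by simpa using hx)] with k hk
  rw [mul_one, mul_one] at hk
  exact_mod_cast hk

theorem tendsto_remSize {c p q ξ₁ ξ₂ : ℝ} {j i k s : ℕ → ℤ}
    (hj : Tendsto (fun K : ℕ => (j K : ℝ) / (2 * K)) atTop (nhds ξ₁))
    (hi : Tendsto (fun K : ℕ => (i K : ℝ) / (2 * K)) atTop (nhds ξ₂))
    (hk : Tendsto (fun K : ℕ => (k K : ℝ) / (2 * K)) atTop (nhds (-ξ₁)))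
    (hs : Tendsto (fun K : ℕ => (s K : ℝ) / (2 * K)) atTop (nhds (-ξ₂)))
    (hpq : gapPhase c |ξ₁| ξ₂ p < gapPhase c |ξ₁| |ξ₂| q) :
    Tendsto (fun K : ℕ => remSize c p q (2 * K) (j K).natAbs (i K).natAbs (k K).natAbs (s K)) atTop (nhds 0) := by
  have hj' := tendsto_natAbs_div_two_mul hj
  have hi' := tendsto_natAbs_div_two_mul hi
  have hk' := tendsto_natAbs_div_two_mul hk
  rw [abs_neg] at hk'
  have key := ((((hs.const_mul (2 * p)).add (hi'.const_mul (2 * q))).add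
    (hj'.const_mul (2 * (Real.log (c + gapu c p) - Real.log (Real.cosh p))))).sub
    (hk'.const_mul (2 * (Real.log (c + gapu c q) - Real.log (Real.cosh q))))).const_add
    (2 * (Real.log (Real.cosh p) - Real.log (Real.cosh q)))
  have hneg : 2 * (Real.log (Real.cosh p) - Real.log (Real.cosh q)) +
      (2 * p * -ξ₂ + 2 * q * |ξ₂| + 2 * (Real.log (c + gapu c p) - Real.log (Real.cosh p)) * |ξ₁| -
        2 * (Real.log (c + gapu c q) - Real.log (Real.cosh q)) * |ξ₁|) < 0 := by
    unfold gapPhase at hpq; linarith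
  have hbot := ((tendsto_natCast_atTop_atTop (R := ℝ)).const_mul_atTop (by norm_num : (0 : ℝ) < 2)).atTop_mul_neg hneg key
  refine (Real.tendsto_exp_atBot.comp hbot).congr' ?_
  filter_upwards [eventually_gt_atTop 0] with K hK
  have : (K : ℝ) ≠ 0 := by positivity
  rw [Function.comp_apply, remSize]
  congr 1
  push_cast
  field_simp
  ring

theorem IsBranch.tendsto_KN {α β : ℝ} {sq : ℂ → ℂ} (h : IsBranch α β sq) {ξ₁ ξ₂ : ℝ} (hξ₁ : |ξ₁| < 1) (hξ₂ : |ξ₂| < 1)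
    (hgas : GasPhase α β sq ξ₁ ξ₂) {dm dn : ℤ} (hd : Even (dm + dn)) {m n : ℕ → ℤ} (hmn : ∀ k, Even (m k + n k))
    (hm : Tendsto (fun k : ℕ => (m k : ℝ) / (2 * k)) atTop (nhds (1 + ξ₁)))
    (hn : Tendsto (fun k : ℕ => (n k : ℝ) / (2 * k)) atTop (nhds (1 + ξ₂))) (a b : Fin 2) :
    Tendsto (fun k : ℕ => KN α β sq (2 * k) (m k) (n k) (m k + dm) (n k + dn) a b) atTop
      (nhds (Kgas α β sq dm dn a b)) := by
  obtain ⟨p, q, hpq, hq, hsp, hsq, hlt⟩ := h.exists_contours hgas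
  obtain ⟨B, hB, hrem⟩ := h.exists_remainder_bound hpq hq
  have hp := abs_lt.1 hpq
  have hq0 : 0 < q := (abs_nonneg p).trans_lt hpq
  have hbq := h.exp_bounds (u := q) (by linarith) hq
  have hbq' := h.exp_bounds (u := -q) (by linarith) (by linarith)
  have hinv : (Real.exp (2 * q))⁻¹ = Real.exp (2 * -q) := by rw [← Real.exp_neg]; congr 1; ring
  have hj : Tendsto (fun k : ℕ => ((m k - 2 * k : ℤ) : ℝ) / (2 * k)) atTop (nhds ξ₁) := by
    convert tendsto_affine_div_two_mul hm 1 0 (-1) using 2 <;> push_cast <;> ring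
  have hk : Tendsto (fun k : ℕ => ((2 * k - (m k + dm) : ℤ) : ℝ) / (2 * k)) atTop (nhds (-ξ₁)) := by
    convert tendsto_affine_div_two_mul hm (-1) (-dm) 1 using 2 <;> push_cast <;> ring
  have hi : Tendsto (fun k : ℕ => ((n k + dn - 2 * k : ℤ) : ℝ) / (2 * k)) atTop (nhds ξ₂) := by
    convert tendsto_affine_div_two_mul hn 1 dn (-1) using 2 <;> push_cast <;> ring
  have hi3 : Tendsto (fun k : ℕ => ((n k + dn - 2 * k + 3 : ℤ) : ℝ) / (2 * k)) atTop (nhds ξ₂) := by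
    convert tendsto_affine_div_two_mul hn 1 (dn + 3) (-1) using 2 <;> push_cast <;> ring
  have hss : Tendsto (fun k : ℕ => ((2 * k - n k - 2 : ℤ) : ℝ) / (2 * k)) atTop (nhds (-ξ₂)) := by
    convert tendsto_affine_div_two_mul hn (-1) (-2) 1 using 2 <;> push_cast <;> ring
  have hsize := (tendsto_remSize (c := hs α β) hj hi hk hss hlt).sqrt
  rw [Real.sqrt_zero] at hsize
  set C : ℂ := (2 * (Real.pi : ℂ) * Complex.I)⁻¹ * (2 * (Real.pi : ℂ) * Complex.I)⁻¹ with hC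
  have hmain := hsize.const_mul (‖C‖ * (2 * B))
  rw [mul_zero] at hmain
  rw [tendsto_iff_norm_sub_tendsto_zero]
  refine squeeze_zero' (Eventually.of_forall fun _ => norm_nonneg _) ?_ hmain
  filter_upwards [eventually_natAbs_le hj hξ₁, eventually_natAbs_mul_le hj (by rw [← mul_assoc]; exact hsp),
    eventually_natAbs_le hi hξ₂, eventually_natAbs_mul_le hi hsq, eventually_natAbs_le hi3 hξ₂] with K h1 h2 h3 h4 h5
  obtain ⟨x, hx⟩ := hmn K
  obtain ⟨y, hy⟩ := hd
  have e1 : 2 * ((m K + dm + (n K + dn)) / 2) + (2 * K - (m K + dm)) - 4 * K = n K + dn - 2 * K := by omega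
  have e2 : 4 * K - 2 * ((m K + n K) / 2) + (m K - 2 * K) - 2 = 2 * K - n K - 2 := by omega
  have hr := fun d => hrem K ((m K + n K) / 2) ((m K + dm + (n K + dn)) / 2) (2 * K - (m K + dm)) (m K - 2 * K) a b d h1
    (by rw [mul_assoc]; exact h2) (by rw [e1]; exact h3) (by rw [e1]; exact h4) (fun h6 => by omega)
    (fun h6 => by omega)
  rw [e1, e2] at hr
  rw [h.KN_eq (hmn K) ⟨y, hy⟩ h1 (hinv ▸ hbq'.1) (by rw [hinv, ← Real.exp_zero]; exact Real.exp_lt_exp.2 (by linarith)) (Real.one_lt_exp_iff.2 (by linarith)) hbq.2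
    (r := Real.exp (2 * p)) (by rw [hinv]; exact Real.exp_lt_exp.2 (by linarith)) (Real.exp_lt_exp.2 (by linarith)) a b,
    add_sub_cancel_left, norm_mul, mul_assoc ‖C‖]
  refine mul_le_mul_of_nonneg_left ?_ (norm_nonneg _)
  refine (norm_sum_le _ _).trans ((Finset.sum_le_sum fun d _ => hr d).trans_eq ?_)
  rw [Finset.sum_const, Finset.card_univ, Fintype.card_fin, nsmul_eq_mul]
  push_cast
  ring

/-- Gas-phase limit of the two-periodic Aztec diamond kernel: for `(ξ₁,ξ₂)` in the
gas phase and `(m,n) ∼ ((1+ξ₁)N, (1+ξ₂)N)`, with fixed offsets `(Δm,Δn)`,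
`𝕂_N(m,n;m+Δm,n+Δn) → 𝕂_gas(Δm,Δn)` as `N → ∞` through even integers. -/
theorem gas_phase_limit (α β : ℝ) (hα : 1 < α) (hαβ : α * β = 1)
    (sq : ℂ → ℂ)
    (hsq_sq : ∀ z ∉ cuts α β, (sq z) ^ 2 = z * (z + (α : ℂ) ^ 2) * (z + (β : ℂ) ^ 2))
    (hsq_an : DifferentiableOn ℂ sq (cuts α β)ᶜ)
    (hsq_pos : ∀ x : ℝ, 0 < x → 0 < (sq (x : ℂ)).re ∧ (sq (x : ℂ)).im = 0)
    (ξ₁ ξ₂ : ℝ) (hξ₁ : -1 < ξ₁ ∧ ξ₁ < 1) (hξ₂ : -1 < ξ₂ ∧ ξ₂ < 1)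
    (hgas : GasPhase α β sq ξ₁ ξ₂)
    (dm dn : ℤ) (hd : Even (dm + dn))
    (m n : ℕ → ℤ) (hmn : ∀ k, Even (m k + n k))
    (hm : Tendsto (fun k : ℕ => (m k : ℝ) / (2 * k)) atTop (nhds (1 + ξ₁)))
    (hn : Tendsto (fun k : ℕ => (n k : ℝ) / (2 * k)) atTop (nhds (1 + ξ₂))) :
    ∀ a b : Fin 2,
      Tendsto
        (fun k : ℕ => KN α β sq (2 * k) (m k) (n k) (m k + dm) (n k + dn) a b)
        atTop (nhds (Kgas α β sq dm dn a b)) := by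
  have h : IsBranch α β sq := ⟨hα, hαβ, hsq_sq, hsq_an, hsq_pos⟩
  exact fun a b => h.tendsto_KN (abs_lt.2 hξ₁) (abs_lt.2 hξ₂) hgas hd hmn hm hn a b
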